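/- arXiv:2009.12593 — 2 statements merged into one kernel-verified Lean document; each statement's English description precedes it below -/
import Mathlib

section
/- For every integer n ≥ 9: every connected 𝒫₄-free 3-graph H on n vertices containing three pairwise disjoint edges satisfies |H| ≤ C(n−4,2) + 11, and equality holds if and only if H is isomorphic to the balloon Bₙ. -/
open Finset

/-- `H` is a 3-graph on the vertex set `V`: every edge is a 3-element subset of `V`. -/
def ThreeGraphOn (V : Finset ℕ) (H : Finset (Finset ℕ)) : Prop :=
  ∀ e ∈ H, e ⊆ V ∧ e.card = 3

/-- Four edges form a 3-uniform minimal 4-path: `aᵢ ∩ aⱼ ≠ ∅ ↔ |i - j| ≤ 1`. -/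
def IsMinPath4 (a₀ a₁ a₂ a₃ : Finset ℕ) : Prop :=
  (a₀ ∩ a₁).Nonempty ∧ (a₁ ∩ a₂).Nonempty ∧ (a₂ ∩ a₃).Nonempty ∧
    a₀ ∩ a₂ = ∅ ∧ a₀ ∩ a₃ = ∅ ∧ a₁ ∩ a₃ = ∅

/-- `H` contains no minimal 4-path. -/
def P4Free (H : Finset (Finset ℕ)) : Prop :=
  ¬∃ a₀ ∈ H, ∃ a₁ ∈ H, ∃ a₂ ∈ H, ∃ a₃ ∈ H, IsMinPath4 a₀ a₁ a₂ a₃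

/-- `H` is connected on `V`: every partition of `V` into two nonempty parts
is crossed by an edge of `H`. -/
def ConnectedHG (V : Finset ℕ) (H : Finset (Finset ℕ)) : Prop :=
  ∀ U W : Finset ℕ, U ∪ W = V → Disjoint U W → U.Nonempty → W.Nonempty →
    ∃ e ∈ H, (e ∩ U).Nonempty ∧ (e ∩ W).Nonempty

/-- `H` contains three pairwise disjoint edges. -/
def HasM3 (H : Finset (Finset ℕ)) : Prop :=
  ∃ e₁ ∈ H, ∃ e₂ ∈ H, ∃ e₃ ∈ H, e₁ ∩ e₂ = ∅ ∧ e₁ ∩ e₃ = ∅ ∧ e₂ ∩ e₃ = ∅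

/-- `H` contains a copy of the minimal 4-cycle `C₄`: six distinct vertices
with edges `{x₁,y₁,y₂}`, `{y₁,y₂,x₂}`, `{x₂,z₁,z₂}`, `{z₁,z₂,x₁}`. -/
def HasC4 (H : Finset (Finset ℕ)) : Prop :=
  ∃ x₁ x₂ y₁ y₂ z₁ z₂ : ℕ, ({x₁, x₂, y₁, y₂, z₁, z₂} : Finset ℕ).card = 6 ∧
    ({x₁, y₁, y₂} : Finset ℕ) ∈ H ∧ ({y₁, y₂, x₂} : Finset ℕ) ∈ H ∧
    ({x₂, z₁, z₂} : Finset ℕ) ∈ H ∧ ({z₁, z₂, x₁} : Finset ℕ) ∈ H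

/-- `H` is the balloon `Bₙ` on `V`: a full star on `V \ {z₁, z₂, z₃}` with
center `x`, together with the eleven extra edges `{y₁,y₂,y₃}`, `{z₁,z₂,z₃}`,
and `{x,yᵢ,zⱼ}` for `i,j ∈ {1,2,3}`. -/
def IsBOn (V : Finset ℕ) (H : Finset (Finset ℕ)) : Prop :=
  ∃ x y₁ y₂ y₃ z₁ z₂ z₃ : ℕ, ({x, y₁, y₂, y₃, z₁, z₂, z₃} : Finset ℕ) ⊆ V ∧
    ({x, y₁, y₂, y₃, z₁, z₂, z₃} : Finset ℕ).card = 7 ∧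
    H = ((V \ {z₁, z₂, z₃}).powersetCard 3).filter (fun t => x ∈ t) ∪
      ({{y₁, y₂, y₃}, {z₁, z₂, z₃},
        {x, y₁, z₁}, {x, y₁, z₂}, {x, y₁, z₃},
        {x, y₂, z₁}, {x, y₂, z₂}, {x, y₂, z₃},
        {x, y₃, z₁}, {x, y₃, z₂}, {x, y₃, z₃}} : Finset (Finset ℕ))

def CConn {α : Type} [DecidableEq α] (S : Finset α) (r : α → α → Prop) : Prop :=
  ∀ T ⊆ S, T.Nonempty → T ≠ S → ∃ a ∈ T, ∃ b ∈ S \ T, r a b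

def CP4 {α : Type} (S : Finset α) (r : α → α → Prop) : Prop :=
  ∀ a ∈ S, ∀ b ∈ S, ∀ c ∈ S, ∀ d ∈ S, r a b → r b c → r c d → ¬ r a c → ¬ r a d → ¬ r b d → False

theorem cp4_compl {α : Type} {S : Finset α} {r : α → α → Prop} (hs : ∀ a b, r a b → r b a)
    (h : CP4 S r) : CP4 S (fun a b => ¬ r a b) := by
  intro a ha b hb c hc d hd h1 h2 h3 h4 h5 h6
  simp only [not_not] at h4 h5 h6
  exact h c hc a ha d hd b hb (hs _ _ h4) h5 (hs _ _ h6) h3 (fun h => h2 (hs _ _ h)) h1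

theorem seinsche_aux {α : Type} [DecidableEq α] {S : Finset α} {r : α → α → Prop}
    (hs : ∀ a b, r a b → r b a) (h : CP4 S r) (h1 : CConn S r)
    (v : α) (hv : v ∈ S) (u : α) (hvu : ¬ r v u)
    (T U : Finset α) (hTU : ∀ a, a ∈ S ↔ a = v ∨ a ∈ T ∨ a ∈ U) (hvT : v ∉ T) (hvU : v ∉ U)
    (hUn : U.Nonempty) (huT : u ∈ T) (hdis : ∀ a ∈ T, ∀ b ∈ U, ¬ r a b)
    (hTU' : ∀ a ∈ T, a ∉ U) : False := by
  classical
  obtain ⟨a, ha, b, hb, hab⟩ := h1 (T.filter (fun a => ¬ r v a)) (by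
      intro a ha; rw [hTU]; simp at ha; tauto) ⟨u, by simp [huT, hvu]⟩
    (by intro h; have := h ▸ hv; simp at this; tauto)
  obtain ⟨w, hw, c, hc, hwc⟩ := h1 U (by intro a ha; rw [hTU]; tauto) hUn
    (by rintro rfl; exact hvU hv)
  simp only [mem_filter, mem_sdiff, not_and, not_not] at ha hb hc
  have hcv : c = v := by
    rcases (hTU c).1 hc.1 with h | h | h
    · exact h
    · exact absurd (hs _ _ hwc) (hdis c h w hw)
    · exact absurd h hc.2
  subst hcv
  have hbT : b ∈ T := by
    rcases (hTU b).1 hb.1 with h | h | h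
    · subst h; exact absurd (hs _ _ hab) ha.2
    · exact h
    · exact absurd hab (hdis a ha.1 b h)
  have hvb := hb.2 hbT
  exact h a ((hTU a).2 (by tauto)) b hb.1 c hv w ((hTU w).2 (by tauto)) hab (hs _ _ hvb)
    (hs _ _ hwc) (fun h => ha.2 (hs _ _ h)) (hdis a ha.1 w hw) (hdis b hbT w hw)

theorem seinsche_aux2 {α : Type} [DecidableEq α] {S : Finset α} {r : α → α → Prop}
    (hs : ∀ a b, r a b → r b a) (h : CP4 S r) (h1 : CConn S r)
    (h2 : CConn S (fun a b => ¬ r a b)) (hc : 3 ≤ S.card) (v : α) (hv : v ∈ S)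
    (h3 : ¬ CConn (S.erase v) r) : False := by
  unfold CConn at h3
  push Not at h3
  obtain ⟨T, hT, hTn, hTne, hd⟩ := h3
  obtain ⟨a, ha, u, hu, hau⟩ := h2 {v} (by simpa using hv) ⟨v, by simp⟩ (by
    intro h; rw [← h] at hc; simp at hc)
  simp only [mem_singleton, mem_sdiff] at ha hu
  subst ha
  have hvT : a ∉ T := fun h => by simpa using hT h
  have hsub : ∀ b, b ∈ S ↔ b = a ∨ b ∈ T ∨ b ∈ (S.erase a) \ T := by
    intro b
    have : b ∈ T → b ∈ S := fun h => (mem_erase.1 (hT h)).2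
    simp only [mem_sdiff, mem_erase]
    constructor
    · intro h; by_cases b = a <;> by_cases b ∈ T <;> simp_all
    · rintro (rfl | h | h)
      · exact hv
      · exact this h
      · exact h.1.2
  have hne : ((S.erase a) \ T).Nonempty := by
    rw [sdiff_nonempty]; intro h; exact hTne (subset_antisymm hT h)
  by_cases huT : u ∈ T
  · exact seinsche_aux hs h h1 a hv u hau T _ hsub hvT (by simp) hne huT
      (fun x hx y hy => hd x hx y hy) (by intro x hx; simp [hx])
  · refine seinsche_aux hs h h1 a hv u hau ((S.erase a) \ T) T ?_ (by simp) hvT hTn ?_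
      (fun x hx y hy hr => hd y hy x hx (hs _ _ hr)) ?_
    · intro b; rw [hsub b]; tauto
    · simp [huT, hu]
    · intro b hb; simp at hb; exact hb.2

theorem seinsche {α : Type} [DecidableEq α] (n : ℕ) : ∀ (S : Finset α) (r : α → α → Prop)
    (_ : ∀ a b, r a b → r b a) (_ : CP4 S r) (_ : S.card = n + 2) (_ : CConn S r)
    (_ : CConn S (fun a b => ¬ r a b)), False := by
  induction n with
  | zero =>
    intro S r hs h hc h1 h2
    obtain ⟨a, b, hab, rfl⟩ := card_eq_two.1 hc
    obtain ⟨x, hx, y, hy, hxy⟩ := h1 {a} (by simp) (by simp) (by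
      intro h; have := congrArg card h; rw [hc] at this; simp at this)
    obtain ⟨x', hx', y', hy', hxy'⟩ := h2 {a} (by simp) (by simp) (by
      intro h; have := congrArg card h; rw [hc] at this; simp at this)
    simp at hx hy hx' hy'
    have : y = b := by tauto
    have : y' = b := by tauto
    subst hx hx'
    simp_all
  | succ n ih =>
    intro S r hs h hc h1 h2
    have : S.Nonempty := by rw [← card_pos]; omega
    obtain ⟨v, hv⟩ := this
    have hsub : CP4 (S.erase v) r := by
      intro a ha b hb c hc d hd
      exact h a (mem_of_mem_erase ha) b (mem_of_mem_erase hb) c (mem_of_mem_erase hc)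
        d (mem_of_mem_erase hd)
    by_cases h3 : CConn (S.erase v) r
    · by_cases h4 : CConn (S.erase v) (fun a b => ¬ r a b)
      · exact ih _ r hs hsub (by rw [card_erase_of_mem hv, hc]; omega) h3 h4
      · refine seinsche_aux2 (r := fun a b => ¬ r a b) (fun a b h h' => h (hs _ _ h'))
          (cp4_compl hs h) h2 ?_ (by omega) v hv h4
        simpa using h1
    · exact seinsche_aux2 hs h h1 h2 (by omega) v hv h3

theorem cograph_split {α : Type} [DecidableEq α] (S : Finset α) (r : α → α → Prop)
    (hs : ∀ a b, r a b → r b a) (h : CP4 S r) (e f : α) (he : e ∈ S) (hf : f ∈ S)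
    (hef : ¬ r e f) (hne : e ≠ f) :
    ∃ T U : Finset α, T ⊆ S ∧ U ⊆ S ∧ T.Nonempty ∧ U.Nonempty ∧ e ∈ T ∪ U ∧ f ∈ T ∪ U ∧
      (∀ a ∈ T, ∀ b ∈ U, ¬ r a b) ∧ (∀ a ∈ T ∪ U, ∀ b ∈ S \ (T ∪ U), r a b) := by
  classical
  obtain ⟨T, hT, hmin⟩ := exists_min_image
    (S.powerset.filter (fun T => e ∈ T ∧ ∀ a ∈ T, ∀ b ∈ S \ T, r a b)) card
    ⟨S, by simp only [mem_filter, mem_powerset, he, subset_refl, sdiff_self, true_and]; intro a _ b hb; simp at hb⟩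
  simp only [mem_filter, mem_powerset] at hT hmin
  obtain ⟨hTS, heT, hTr⟩ := hT
  have hfT : f ∈ T := by
    by_contra hfT
    exact hef (hTr e heT f (by simp [hf, hfT]))
  have hcard : 2 ≤ T.card := by
    have : ({e, f} : Finset α) ⊆ T := by
      intro x; simp; rintro (rfl | rfl) <;> assumption
    have := card_le_card this
    rwa [card_pair hne] at this
  have hco : CConn T (fun a b => ¬ r a b) := by
    intro T' hT' hn hneq
    by_contra hcon
    push Not at hcon
    by_cases heT' : e ∈ T'
    · have := hmin T' ⟨hT'.trans hTS, heT', by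
        intro a ha b hb
        by_cases hbT : b ∈ T
        · exact hcon a ha b (by simp at hb ⊢; tauto)
        · exact hTr a (hT' ha) b (by simp at hb ⊢; tauto)⟩
      exact hneq (eq_of_subset_of_card_le hT' this)
    · have := hmin (T \ T') ⟨sdiff_subset.trans hTS, by simp [heT, heT'], by
        intro a ha b hb
        by_cases hbT : b ∈ T
        · exact hs _ _ (hcon b (by simp at hb; tauto) a ha)
        · exact hTr a (mem_sdiff.1 ha).1 b (by simp at hb ⊢; tauto)⟩
      have h2 := card_sdiff_add_card_eq_card hT'
      have := hn.card_pos
      omega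
  have hnc : ¬ CConn T r := by
    intro hc
    exact seinsche (T.card - 2) T r hs (by
      intro a ha b hb c hc d hd
      exact h a (hTS ha) b (hTS hb) c (hTS hc) d (hTS hd)) (by omega) hc hco
  unfold CConn at hnc
  push Not at hnc
  obtain ⟨T1, hT1, hn, hne1, hd⟩ := hnc
  have hu : T1 ∪ T \ T1 = T := union_sdiff_of_subset hT1
  refine ⟨T1, T \ T1, hT1.trans hTS, sdiff_subset.trans hTS, hn, ?_, ?_, ?_, hd, ?_⟩
  · rw [sdiff_nonempty]; intro h; exact hne1 (subset_antisymm hT1 h)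
  · rwa [hu]
  · rwa [hu]
  · rwa [hu]

structure Cfg (V : Finset ℕ) (H S0 S1 S2 R B : Finset (Finset ℕ)) (e0 e1 e2 : Finset ℕ) :
    Prop where
  g3 : ThreeGraphOn V H
  free : P4Free H
  hH : ∀ e, e ∈ H ↔ e ∈ S0 ∨ e ∈ S1 ∨ e ∈ S2 ∨ e ∈ R ∨ e ∈ B
  d01 : ∀ e ∈ S0, ∀ f ∈ S1, Disjoint e f
  d02 : ∀ e ∈ S0, ∀ f ∈ S2, Disjoint e f
  d12 : ∀ e ∈ S1, ∀ f ∈ S2, Disjoint e f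
  dR : ∀ e ∈ S0, ∀ f ∈ R, Disjoint e f
  R1 : ∀ e ∈ S1, ∀ f ∈ R, ¬ Disjoint e f
  R2 : ∀ e ∈ S2, ∀ f ∈ R, ¬ Disjoint e f
  B0 : ∀ e ∈ S0, ∀ f ∈ B, ¬ Disjoint e f
  B1 : ∀ e ∈ S1, ∀ f ∈ B, ¬ Disjoint e f
  B2 : ∀ e ∈ S2, ∀ f ∈ B, ¬ Disjoint e f
  BR : ∀ e ∈ R, ∀ f ∈ B, ¬ Disjoint e f
  m0 : e0 ∈ S0
  m1 : e1 ∈ S1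
  m2 : e2 ∈ S2
  hB : B.Nonempty

theorem eq_triple {s : Finset ℕ} (hs : s.card = 3) {a b c : ℕ} (ha : a ∈ s) (hb : b ∈ s)
    (hc : c ∈ s) (hab : a ≠ b) (hac : a ≠ c) (hbc : b ≠ c) : s = {a, b, c} := by
  symm
  apply eq_of_subset_of_card_le
  · intro x; simp only [mem_insert, mem_singleton]; rintro (rfl | rfl | rfl) <;> assumption
  · rw [hs, card_eq_three.2 ⟨a, b, c, hab, hac, hbc, rfl⟩]

theorem trans_aux {e0 e1 e2 b : Finset ℕ} (h01 : Disjoint e0 e1) (h02 : Disjoint e0 e2)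
    (h12 : Disjoint e1 e2) (hb : b.card = 3) (h0 : ¬ Disjoint e0 b) (h1 : ¬ Disjoint e1 b)
    (h2 : ¬ Disjoint e2 b) : ∃ p ∈ e0, ∃ y ∈ e1, ∃ x ∈ e2, b = {p, y, x} := by
  obtain ⟨p, hp, hp'⟩ := not_disjoint_iff.1 h0
  obtain ⟨y, hy, hy'⟩ := not_disjoint_iff.1 h1
  obtain ⟨x, hx, hx'⟩ := not_disjoint_iff.1 h2
  rw [disjoint_left] at *
  exact ⟨p, hp, y, hy, x, hx, eq_triple hb hp' hy' hx' (by rintro rfl; exact h01 hp hy)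
    (by rintro rfl; exact h02 hp hx) (by rintro rfl; exact h12 hy hx)⟩

namespace Cfg
variable {V : Finset ℕ} {H S0 S1 S2 R B : Finset (Finset ℕ)} {e0 e1 e2 : Finset ℕ}

theorem cardE (c : Cfg V H S0 S1 S2 R B e0 e1 e2) {e : Finset ℕ}
    (h : e ∈ S0 ∨ e ∈ S1 ∨ e ∈ S2 ∨ e ∈ R ∨ e ∈ B) : e.card = 3 := (c.g3 e ((c.hH e).2 h)).2

theorem subE (c : Cfg V H S0 S1 S2 R B e0 e1 e2) {e : Finset ℕ}
    (h : e ∈ S0 ∨ e ∈ S1 ∨ e ∈ S2 ∨ e ∈ R ∨ e ∈ B) : e ⊆ V := (c.g3 e ((c.hH e).2 h)).1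

theorem swap (c : Cfg V H S0 S1 S2 R B e0 e1 e2) : Cfg V H S0 S2 S1 R B e0 e2 e1 where
  g3 := c.g3
  free := c.free
  hH := by intro e; rw [c.hH]; tauto
  d01 := c.d02
  d02 := c.d01
  d12 := fun e he f hf => (c.d12 f hf e he).symm
  dR := c.dR
  R1 := c.R2
  R2 := c.R1
  B0 := c.B0
  B1 := c.B2
  B2 := c.B1
  BR := c.BR
  m0 := c.m0
  m1 := c.m2
  m2 := c.m1
  hB := c.hB

theorem e01 (c : Cfg V H S0 S1 S2 R B e0 e1 e2) : Disjoint e0 e1 := c.d01 _ c.m0 _ c.m1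
theorem e02 (c : Cfg V H S0 S1 S2 R B e0 e1 e2) : Disjoint e0 e2 := c.d02 _ c.m0 _ c.m2
theorem e12 (c : Cfg V H S0 S1 S2 R B e0 e1 e2) : Disjoint e1 e2 := c.d12 _ c.m1 _ c.m2

/-- every edge of `B` is a transversal of centers -/
theorem btrans (c : Cfg V H S0 S1 S2 R B e0 e1 e2) {b : Finset ℕ} (hb : b ∈ B) :
    ∃ p ∈ e0, ∃ y ∈ e1, ∃ x ∈ e2, b = {p, y, x} ∧ (∀ s ∈ S0, p ∈ s) ∧ (∀ s ∈ S1, y ∈ s) ∧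
      (∀ s ∈ S2, x ∈ s) ∧ ∀ r ∈ R, y ∈ r ∨ x ∈ r := by
  obtain ⟨p, hp, y, hy, x, hx, rfl⟩ := trans_aux c.e01 c.e02 c.e12 (c.cardE (by tauto))
    (c.B0 _ c.m0 _ hb) (c.B1 _ c.m1 _ hb) (c.B2 _ c.m2 _ hb)
  refine ⟨p, hp, y, hy, x, hx, rfl, ?_, ?_, ?_, ?_⟩
  · intro s hs
    obtain ⟨q, hq, hq'⟩ := not_disjoint_iff.1 (c.B0 s hs _ hb)
    have h1 := disjoint_left.1 (c.d01 s hs _ c.m1) hq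
    have h2 := disjoint_left.1 (c.d02 s hs _ c.m2) hq
    simp only [mem_insert, mem_singleton] at hq'
    rcases hq' with rfl | rfl | rfl <;> tauto
  · intro s hs
    obtain ⟨q, hq, hq'⟩ := not_disjoint_iff.1 (c.B1 s hs _ hb)
    have h1 := disjoint_right.1 (c.d01 _ c.m0 s hs) hq
    have h2 := disjoint_left.1 (c.d12 s hs _ c.m2) hq
    simp only [mem_insert, mem_singleton] at hq'
    rcases hq' with rfl | rfl | rfl <;> tauto
  · intro s hs
    obtain ⟨q, hq, hq'⟩ := not_disjoint_iff.1 (c.B2 s hs _ hb)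
    have h1 := disjoint_right.1 (c.d02 _ c.m0 s hs) hq
    have h2 := disjoint_right.1 (c.d12 _ c.m1 s hs) hq
    simp only [mem_insert, mem_singleton] at hq'
    rcases hq' with rfl | rfl | rfl <;> tauto
  · intro s hs
    obtain ⟨q, hq, hq'⟩ := not_disjoint_iff.1 (c.BR s hs _ hb)
    have h1 := disjoint_right.1 (c.dR _ c.m0 s hs) hq
    simp only [mem_insert, mem_singleton] at hq'
    rcases hq' with rfl | rfl | rfl <;> tauto

theorem bsub (c : Cfg V H S0 S1 S2 R B e0 e1 e2) {b : Finset ℕ} (hb : b ∈ B) {v : ℕ}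
    (hv : v ∈ b) : v ∈ e0 ∨ v ∈ e1 ∨ v ∈ e2 := by
  obtain ⟨p, hp, y, hy, x, hx, rfl, -⟩ := c.btrans hb
  simp only [mem_insert, mem_singleton] at hv
  rcases hv with rfl | rfl | rfl <;> tauto

theorem del (c : Cfg V H S0 S1 S2 R B e0 e1 e2) {v : ℕ} (h0 : v ∉ e0) (h1 : v ∉ e1)
    (h2 : v ∉ e2) : Cfg (V.erase v) (H.filter (v ∉ ·)) (S0.filter (v ∉ ·)) (S1.filter (v ∉ ·))
      (S2.filter (v ∉ ·)) (R.filter (v ∉ ·)) B e0 e1 e2 where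
  g3 := by
    intro e he
    rw [mem_filter] at he
    exact ⟨subset_erase.2 ⟨(c.g3 e he.1).1, he.2⟩, (c.g3 e he.1).2⟩
  free := by
    rintro ⟨a, ha, b, hb, d, hd, e, he, h⟩
    exact c.free ⟨a, (mem_filter.1 ha).1, b, (mem_filter.1 hb).1, d, (mem_filter.1 hd).1,
      e, (mem_filter.1 he).1, h⟩
  hH := by
    intro e
    have : e ∈ B → v ∉ e := fun he hv => by have := c.bsub he hv; tauto
    simp only [mem_filter, c.hH]
    tauto
  d01 := fun e he f hf => c.d01 e (mem_filter.1 he).1 f (mem_filter.1 hf).1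
  d02 := fun e he f hf => c.d02 e (mem_filter.1 he).1 f (mem_filter.1 hf).1
  d12 := fun e he f hf => c.d12 e (mem_filter.1 he).1 f (mem_filter.1 hf).1
  dR := fun e he f hf => c.dR e (mem_filter.1 he).1 f (mem_filter.1 hf).1
  R1 := fun e he f hf => c.R1 e (mem_filter.1 he).1 f (mem_filter.1 hf).1
  R2 := fun e he f hf => c.R2 e (mem_filter.1 he).1 f (mem_filter.1 hf).1
  B0 := fun e he f hf => c.B0 e (mem_filter.1 he).1 f hf
  B1 := fun e he f hf => c.B1 e (mem_filter.1 he).1 f hf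
  B2 := fun e he f hf => c.B2 e (mem_filter.1 he).1 f hf
  BR := fun e he f hf => c.BR e (mem_filter.1 he).1 f hf
  m0 := mem_filter.2 ⟨c.m0, h0⟩
  m1 := mem_filter.2 ⟨c.m1, h1⟩
  m2 := mem_filter.2 ⟨c.m2, h2⟩
  hB := c.hB

end Cfg

theorem nmeet {a b : Finset ℕ} : ¬ Disjoint a b ↔ (a ∩ b).Nonempty := not_disjoint_iff_nonempty_inter

theorem cp4_of_free {H : Finset (Finset ℕ)} (h : P4Free H) :
    CP4 H (fun a b => ¬ Disjoint a b) := by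
  intro a ha b hb c hc d hd h1 h2 h3 h4 h5 h6
  simp only [not_not, disjoint_iff_inter_eq_empty] at h4 h5 h6
  exact h ⟨a, ha, b, hb, c, hc, d, hd, nmeet.1 h1, nmeet.1 h2, nmeet.1 h3, h4, h5, h6⟩

/-- three pairwise disjoint edges, `b` of size three meeting all of `T ∪ U`: not all in `T`. -/
theorem notall {T U : Finset (Finset ℕ)} {b e0 e1 e2 f : Finset ℕ} (hb : b.card = 3)
    (h01 : Disjoint e0 e1) (h02 : Disjoint e0 e2) (h12 : Disjoint e1 e2)
    (b0 : ¬ Disjoint e0 b) (b1 : ¬ Disjoint e1 b) (b2 : ¬ Disjoint e2 b) (bf : ¬ Disjoint f b)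
    (f0 : Disjoint e0 f) (f1 : Disjoint e1 f) (f2 : Disjoint e2 f) : False := by
  obtain ⟨p, hp, y, hy, x, hx, rfl⟩ := trans_aux h01 h02 h12 hb b0 b1 b2
  obtain ⟨q, hq, hq'⟩ := not_disjoint_iff.1 bf
  simp only [mem_insert, mem_singleton] at hq'
  rw [disjoint_left] at f0 f1 f2
  rcases hq' with rfl | rfl | rfl <;> tauto

theorem mkcfg_aux {V : Finset ℕ} {H : Finset (Finset ℕ)} (hH : ThreeGraphOn V H)
    (hfree : P4Free H) {e0 e1 e2 : Finset ℕ} (S0 G B : Finset (Finset ℕ))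
    (h01 : Disjoint e0 e1) (h02 : Disjoint e0 e2) (h12 : Disjoint e1 e2)
    (hU : ∀ e, e ∈ H ↔ e ∈ S0 ∨ e ∈ G ∨ e ∈ B) (hd : ∀ a ∈ S0, ∀ b ∈ G, Disjoint a b)
    (hB0 : ∀ a ∈ S0, ∀ b ∈ B, ¬ Disjoint a b) (hBG : ∀ a ∈ G, ∀ b ∈ B, ¬ Disjoint a b)
    (hB : B.Nonempty) (h0 : e0 ∈ S0) (h1 : e1 ∈ G) (h2 : e2 ∈ G) :
    ∃ S1 S2 R, Cfg V H S0 S1 S2 R B e0 e1 e2 := by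
  have hfree' : P4Free G := by
    rintro ⟨a, ha, b, hb, d, hd, e, he, h⟩
    exact hfree ⟨a, (hU _).2 (by tauto), b, (hU _).2 (by tauto), d, (hU _).2 (by tauto),
      e, (hU _).2 (by tauto), h⟩
  have key : ∀ S1 S2 : Finset (Finset ℕ), S1 ⊆ G → S2 ⊆ G → e1 ∈ S1 → e2 ∈ S2 →
      (∀ a ∈ S1, ∀ b ∈ S2, Disjoint a b) → (∀ a ∈ S1 ∪ S2, ∀ b ∈ G \ (S1 ∪ S2), ¬ Disjoint a b) →
      ∃ S1 S2 R, Cfg V H S0 S1 S2 R B e0 e1 e2 := by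
    intro S1 S2 hS1 hS2 h1 h2 hd' hm
    refine ⟨S1, S2, G \ (S1 ∪ S2), ?_⟩
    refine ⟨hH, hfree, ?_, ?_, ?_, hd', ?_, ?_, ?_, hB0, ?_, ?_, ?_, h0, h1, h2, hB⟩
    · intro e
      have := @hS1 e
      have := @hS2 e
      rw [hU]; simp only [mem_sdiff, mem_union]; tauto
    · exact fun a ha b hb => hd a ha b (hS1 hb)
    · exact fun a ha b hb => hd a ha b (hS2 hb)
    · exact fun a ha b hb => hd a ha b (mem_sdiff.1 hb).1
    · exact fun a ha b hb => hm a (mem_union_left _ ha) b hb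
    · exact fun a ha b hb => hm a (mem_union_right _ ha) b hb
    · exact fun a ha b hb => hBG a (hS1 ha) b hb
    · exact fun a ha b hb => hBG a (hS2 ha) b hb
    · exact fun a ha b hb => hBG a (mem_sdiff.1 ha).1 b hb
  obtain ⟨b, hb⟩ := hB
  have hbc : b.card = 3 := (hH b ((hU b).2 (by tauto))).2
  have hne : e1 ≠ e2 := by
    rintro rfl
    have := disjoint_self.1 h12
    have h3 := (hH e1 ((hU _).2 (by tauto))).2
    simp [this] at h3
  obtain ⟨T, U, hT, hU', hTn, hUn, he1, he2, hTU, hrest⟩ := cograph_split G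
    (fun a b => ¬ Disjoint a b) (fun a b h h' => h h'.symm) (cp4_of_free hfree') e1 e2 h1 h2
    (by simpa using h12) hne
  simp only [not_not] at hTU
  obtain ⟨t, ht⟩ := hTn
  obtain ⟨u, hu⟩ := hUn
  have bad : ∀ f ∈ G, Disjoint e1 f → Disjoint e2 f → False := fun f hf hf1 hf2 =>
    notall (T := T) (U := U) hbc h01 h02 h12 (hB0 _ h0 _ hb) (hBG _ h1 _ hb) (hBG _ h2 _ hb) (hBG _ hf _ hb)
      (hd _ h0 _ hf) hf1 hf2
  rw [mem_union] at he1 he2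
  rcases he1 with he1 | he1 <;> rcases he2 with he2 | he2
  · exact (bad u (hU' hu) (hTU _ he1 _ hu) (hTU _ he2 _ hu)).elim
  · exact key T U hT hU' he1 he2 hTU hrest
  · refine key U T hU' hT he1 he2 (fun a ha b hb => (hTU b hb a ha).symm) ?_
    rwa [union_comm]
  · exact (bad t (hT ht) (hTU _ ht _ he1).symm (hTU _ ht _ he2).symm).elim

theorem mkcfg {V : Finset ℕ} {H : Finset (Finset ℕ)} (hH : ThreeGraphOn V H)
    (hconn : ConnectedHG V H) (hfree : P4Free H) (hM3 : HasM3 H) :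
    ∃ S0 S1 S2 R B e0 e1 e2, Cfg V H S0 S1 S2 R B e0 e1 e2 := by
  obtain ⟨e0, h0, e1, h1, e2, h2, h01, h02, h12⟩ := hM3
  rw [← disjoint_iff_inter_eq_empty] at h01 h02 h12
  have hne : e0 ≠ e1 := by
    rintro rfl
    have := disjoint_self.1 h01
    have h3 := (hH e0 h0).2
    simp [this] at h3
  obtain ⟨T, U, hT, hU, hTn, hUn, he0, he1, hTU, hrest⟩ := cograph_split H
    (fun a b => ¬ Disjoint a b) (fun a b h h' => h h'.symm) (cp4_of_free hfree) e0 e1 h0 h1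
    (by simpa using h01) hne
  simp only [not_not] at hTU
  obtain ⟨t, ht⟩ := hTn
  obtain ⟨u, hu⟩ := hUn
  have hBn : (H \ (T ∪ U)).Nonempty := by
    by_contra hcon
    rw [not_nonempty_iff_eq_empty, sdiff_eq_empty_iff_subset] at hcon
    have hsub : T.biUnion id ⊆ V := by
      intro x hx
      simp only [mem_biUnion, id] at hx
      obtain ⟨a, ha, hx⟩ := hx
      exact (hH a (hT ha)).1 hx
    have hd : ∀ f ∈ U, ∀ q ∈ f, q ∉ T.biUnion id := by
      intro f hf q hq hq'
      simp only [mem_biUnion, id] at hq'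
      obtain ⟨a, ha, hx⟩ := hq'
      exact disjoint_left.1 (hTU a ha f hf) hx hq
    have nonem : ∀ f ∈ H, ∃ q, q ∈ f := by
      intro f hf
      have := (hH f hf).2
      exact card_pos.1 (by omega)
    obtain ⟨e, he, heT, heU⟩ := hconn (T.biUnion id) (V \ T.biUnion id)
      (union_sdiff_of_subset hsub) disjoint_sdiff (by
        obtain ⟨q, hq⟩ := nonem t (hT ht)
        exact ⟨q, mem_biUnion.2 ⟨t, ht, hq⟩⟩) (by
        obtain ⟨q, hq⟩ := nonem u (hU hu)
        exact ⟨q, mem_sdiff.2 ⟨(hH u (hU hu)).1 hq, hd u hu q hq⟩⟩)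
    obtain ⟨q, hq⟩ := heT
    obtain ⟨q', hq'⟩ := heU
    rw [mem_inter] at hq hq'
    rcases mem_union.1 (hcon he) with h | h
    · exact (mem_sdiff.1 hq'.2).2 (mem_biUnion.2 ⟨e, h, hq'.1⟩)
    · exact hd e h q hq.1 hq.2
  have he2 : e2 ∈ T ∪ U := by
    by_contra h
    exact hrest e0 he0 e2 (mem_sdiff.2 ⟨h2, h⟩) h02
  have hBT : ∀ a ∈ T, ∀ b ∈ H \ (T ∪ U), ¬ Disjoint a b := fun a ha => hrest a (mem_union_left _ ha)
  have hBU : ∀ a ∈ U, ∀ b ∈ H \ (T ∪ U), ¬ Disjoint a b := fun a ha => hrest a (mem_union_right _ ha)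
  have hUT : ∀ a ∈ U, ∀ b ∈ T, Disjoint a b := fun a ha b hb => (hTU b hb a ha).symm
  have hu1 : ∀ e, e ∈ H ↔ e ∈ T ∨ e ∈ U ∨ e ∈ H \ (T ∪ U) := by
    intro e
    have := @hT e
    have := @hU e
    simp only [mem_sdiff, mem_union]; tauto
  have hu2 : ∀ e, e ∈ H ↔ e ∈ U ∨ e ∈ T ∨ e ∈ H \ (T ∪ U) := by
    intro e; rw [hu1]; tauto
  obtain ⟨b, hb⟩ := hBn
  have bad : ∀ f ∈ T ∪ U, Disjoint e0 f → Disjoint e1 f → Disjoint e2 f → False :=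
    fun f hf hf0 hf1 hf2 =>
    notall (T := T) (U := U) (hH b (mem_sdiff.1 hb).1).2 h01 h02 h12 (hrest _ he0 _ hb)
      (hrest _ he1 _ hb) (hrest _ he2 _ hb) (hrest _ hf _ hb) hf0 hf1 hf2
  have hBn : (H \ (T ∪ U)).Nonempty := ⟨b, hb⟩
  rw [mem_union] at he0 he1 he2
  have fin : ∀ (S0 G : Finset (Finset ℕ)) (f0 f1 f2 : Finset ℕ),
      (∃ S1 S2 R, Cfg V H S0 S1 S2 R (H \ (T ∪ U)) f0 f1 f2) →
      ∃ S0 S1 S2 R B e0 e1 e2, Cfg V H S0 S1 S2 R B e0 e1 e2 := by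
    rintro S0 G f0 f1 f2 ⟨S1, S2, R, h⟩
    exact ⟨_, _, _, _, _, _, _, _, h⟩
  rcases he0 with he0 | he0 <;> rcases he1 with he1 | he1 <;> rcases he2 with he2 | he2
  · exact (bad u (mem_union_right _ hu) (hTU _ he0 _ hu) (hTU _ he1 _ hu) (hTU _ he2 _ hu)).elim
  · exact fin U T _ _ _ (mkcfg_aux hH hfree U T _ h02.symm h12.symm h01 hu2 hUT hBU hBT hBn he2 he0 he1)
  · exact fin U T _ _ _ (mkcfg_aux hH hfree U T _ h01.symm h12 h02 hu2 hUT hBU hBT hBn he1 he0 he2)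
  · exact fin T U _ _ _ (mkcfg_aux hH hfree T U _ h01 h02 h12 hu1 hTU hBT hBU hBn he0 he1 he2)
  · exact fin U T _ _ _ (mkcfg_aux hH hfree U T _ h01 h02 h12 hu2 hUT hBU hBT hBn he0 he1 he2)
  · exact fin T U _ _ _ (mkcfg_aux hH hfree T U _ h01.symm h12 h02 hu1 hTU hBT hBU hBn he1 he0 he2)
  · exact fin T U _ _ _ (mkcfg_aux hH hfree T U _ h02.symm h12.symm h01 hu1 hTU hBT hBU hBn he2 he0 he1)
  · exact (bad t (mem_union_left _ ht) (hTU _ ht _ he0).symm (hTU _ ht _ he1).symm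
      (hTU _ ht _ he2).symm).elim

def starF (W : Finset ℕ) (x : ℕ) : Finset (Finset ℕ) := (W.powersetCard 3).filter (fun t => x ∈ t)

theorem card_starF {W : Finset ℕ} {x : ℕ} (hx : x ∈ W) :
    (starF W x).card = (W.card - 1).choose 2 := by
  have : starF W x = ((W.erase x).powersetCard 2).image (insert x) := by
    ext t
    simp only [starF, mem_filter, mem_powersetCard, mem_image]
    constructor
    · rintro ⟨⟨h1, h2⟩, h3⟩
      exact ⟨t.erase x, ⟨erase_subset_erase _ h1, by rw [card_erase_of_mem h3, h2]⟩, insert_erase h3⟩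
    · rintro ⟨a, ⟨h1, h2⟩, rfl⟩
      have hxa : x ∉ a := fun h => by simpa using h1 h
      refine ⟨⟨insert_subset hx (h1.trans (erase_subset _ _)), by rw [card_insert_of_notMem hxa, h2]⟩,
        mem_insert_self _ _⟩
  rw [this, card_image_of_injOn, card_powersetCard, card_erase_of_mem hx]
  intro a ha b hb hab
  simp only [mem_coe, mem_powersetCard] at ha hb
  have hxa : x ∉ a := fun h => by simpa using ha.1 h
  have hxb : x ∉ b := fun h => by simpa using hb.1 h
  have := congrArg (fun s => s.erase x) hab
  simpa [erase_insert hxa, erase_insert hxb] using this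

def crossF (x : ℕ) (Y Z : Finset ℕ) : Finset (Finset ℕ) :=
  (Y ×ˢ Z).image (fun q => ({x, q.1, q.2} : Finset ℕ))

theorem card_crossF {x : ℕ} {Y Z : Finset ℕ} (hxY : x ∉ Y) (hxZ : x ∉ Z) (hYZ : Disjoint Y Z)
    (hY : Y.card = 3) (hZ : Z.card = 3) : (crossF x Y Z).card = 9 := by
  rw [crossF, card_image_of_injOn, card_product, hY, hZ]
  rintro ⟨a, b⟩ hab ⟨c, d⟩ hcd h
  simp only [coe_product, Set.mem_prod, mem_coe] at hab hcd
  rw [disjoint_left] at hYZ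
  dsimp only at h
  have h1 : a ∈ ({x, c, d} : Finset ℕ) := by rw [← h]; simp
  have h2 : b ∈ ({x, c, d} : Finset ℕ) := by rw [← h]; simp
  simp only [mem_insert, mem_singleton] at h1 h2
  have : a = c := by
    rcases h1 with rfl | h1 | rfl
    · tauto
    · exact h1
    · exact absurd hcd.2 (hYZ hab.1)
  have : b = d := by
    rcases h2 with rfl | rfl | h2
    · tauto
    · exact absurd hab.2 (hYZ hcd.1)
    · exact h2
  simp_all

def Bal (V : Finset ℕ) (x : ℕ) (Y Z : Finset ℕ) : Finset (Finset ℕ) :=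
  starF (V \ Z) x ∪ ({Y, Z} ∪ crossF x Y Z)

theorem card_Bal {V : Finset ℕ} {x : ℕ} {Y Z : Finset ℕ} (hxY : x ∉ Y) (hxZ : x ∉ Z)
    (hYZ : Disjoint Y Z) (hY : Y.card = 3) (hZ : Z.card = 3) (hxV : x ∈ V)
    (hZV : Z ⊆ V) : (Bal V x Y Z).card = (V.card - 4).choose 2 + 11 := by
  have hz : ∀ t ∈ crossF x Y Z, x ∈ t ∧ ∃ z ∈ Z, z ∈ t := by
    intro t ht
    simp only [crossF, mem_image, mem_product, Prod.exists] at ht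
    obtain ⟨a, b, hab, rfl⟩ := ht
    exact ⟨by simp, b, hab.2, by simp⟩
  have hne : Y ≠ Z := by
    rintro rfl
    have := disjoint_self.1 hYZ
    simp [this] at hY
  rw [Bal, card_union_of_disjoint, card_union_of_disjoint, card_pair hne,
    card_crossF hxY hxZ hYZ hY hZ, card_starF (by simp [hxV, hxZ]), card_sdiff_of_subset hZV, hZ]
  · rfl
  · rw [disjoint_left]
    intro t ht ht'
    simp only [mem_insert, mem_singleton] at ht
    have := (hz t ht').1
    rcases ht with rfl | rfl <;> tauto
  · rw [disjoint_left]
    intro t ht ht'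
    simp only [starF, mem_filter, mem_powersetCard] at ht
    simp only [mem_union, mem_insert, mem_singleton] at ht'
    rcases ht' with (rfl | rfl) | h
    · tauto
    · tauto
    · obtain ⟨z, hz, hzt⟩ := (hz t h).2
      have := ht.1.1 hzt
      simp [hz] at this

theorem bal_expl (V : Finset ℕ) (x y₁ y₂ y₃ z₁ z₂ z₃ : ℕ) :
    Bal V x {y₁, y₂, y₃} {z₁, z₂, z₃} = ((V \ {z₁, z₂, z₃}).powersetCard 3).filter (fun t => x ∈ t) ∪
      ({{y₁, y₂, y₃}, {z₁, z₂, z₃},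
        {x, y₁, z₁}, {x, y₁, z₂}, {x, y₁, z₃},
        {x, y₂, z₁}, {x, y₂, z₂}, {x, y₂, z₃},
        {x, y₃, z₁}, {x, y₃, z₂}, {x, y₃, z₃}} : Finset (Finset ℕ)) := by
  rw [Bal, starF]
  congr 1
  ext t
  simp only [crossF, mem_union, mem_insert, mem_singleton, mem_image, mem_product, Prod.exists]
  constructor
  · rintro ((rfl | rfl) | ⟨a, b, ⟨rfl | rfl | rfl, rfl | rfl | rfl⟩, rfl⟩) <;> simp
  · rintro (h | h | h | h | h | h | h | h | h | h | h)
    · exact Or.inl (Or.inl h)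
    · exact Or.inl (Or.inr h)
    all_goals exact Or.inr ⟨_, _, ⟨by tauto, by tauto⟩, h.symm⟩

theorem isB_of_bal {V : Finset ℕ} {x : ℕ} {Y Z : Finset ℕ} (hxY : x ∉ Y) (hxZ : x ∉ Z)
    (hYZ : Disjoint Y Z) (hY : Y.card = 3) (hZ : Z.card = 3) (hxV : x ∈ V)
    (hZV : Z ⊆ V) (hYV : Y ⊆ V) : IsBOn V (Bal V x Y Z) := by
  obtain ⟨y₁, y₂, y₃, a1, a2, a3, rfl⟩ := card_eq_three.1 hY
  obtain ⟨z₁, z₂, z₃, b1, b2, b3, rfl⟩ := card_eq_three.1 hZ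
  refine ⟨x, y₁, y₂, y₃, z₁, z₂, z₃, ?_, ?_, bal_expl ..⟩
  · intro t ht
    simp only [mem_insert, mem_singleton] at ht
    simp only [insert_subset_iff, singleton_subset_iff] at hZV hYV
    rcases ht with rfl | rfl | rfl | rfl | rfl | rfl | rfl <;> tauto
  · have : ({x, y₁, y₂, y₃, z₁, z₂, z₃} : Finset ℕ) = insert x ({y₁, y₂, y₃} ∪ {z₁, z₂, z₃}) := by
      ext t; simp only [mem_insert, mem_singleton, mem_union, or_assoc]
    rw [this, card_insert_of_notMem (by rw [mem_union]; tauto), card_union_of_disjoint hYZ, hY, hZ]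

theorem card_isB {V : Finset ℕ} {H : Finset (Finset ℕ)} (h : IsBOn V H) :
    H.card = (V.card - 4).choose 2 + 11 := by
  obtain ⟨x, y₁, y₂, y₃, z₁, z₂, z₃, h1, h2, rfl⟩ := h
  rw [← bal_expl]
  have e : ({x, y₁, y₂, y₃, z₁, z₂, z₃} : Finset ℕ) = insert x ({y₁, y₂, y₃} ∪ {z₁, z₂, z₃}) := by
      ext t; simp only [mem_insert, mem_singleton, mem_union, or_assoc]
  rw [e] at h1 h2
  have c1 := card_insert_le x ({y₁, y₂, y₃} ∪ {z₁, z₂, z₃} : Finset ℕ)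
  have c2 := card_union_add_card_inter ({y₁, y₂, y₃} : Finset ℕ) {z₁, z₂, z₃}
  have c3 := card_le_three (a := y₁) (b := y₂) (c := y₃)
  have c4 := card_le_three (a := z₁) (b := z₂) (c := z₃)
  have hx : x ∉ ({y₁, y₂, y₃} ∪ {z₁, z₂, z₃} : Finset ℕ) := by
    intro h
    rw [insert_eq_of_mem h] at h2
    omega
  rw [mem_union, not_or] at hx
  rw [insert_subset_iff, union_subset_iff] at h1
  refine card_Bal hx.1 hx.2 ?_ (by omega) (by omega) h1.1 h1.2.2
  rw [disjoint_iff_inter_eq_empty, ← card_eq_zero]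
  omega

def Good (V : Finset ℕ) (H B : Finset (Finset ℕ)) : Prop :=
  H.card < (V.card - 4).choose 2 + 11 ∨
    (H.card = (V.card - 4).choose 2 + 11 ∧ IsBOn V H ∧ 9 ≤ B.card)

theorem good_bal {V : Finset ℕ} {H S0 S1 S2 R B : Finset (Finset ℕ)} {e0 e1 e2 : Finset ℕ}
    (c : Cfg V H S0 S1 S2 R B e0 e1 e2) {y : ℕ} (hy : y ∈ e1) (h0 : S0 ⊆ {e0}) (h2 : S2 ⊆ {e2})
    (h1 : ∀ s ∈ S1, y ∈ s) (hR : ∀ s ∈ R, y ∈ s) (hB : ∀ s ∈ B, y ∈ s) : Good V H B := by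
  have hy0 : y ∉ e0 := disjoint_right.1 c.e01 hy
  have hy2 : y ∉ e2 := disjoint_left.1 c.e12 hy
  have k0 : e0.card = 3 := c.cardE (Or.inl c.m0)
  have k2 : e2.card = 3 := c.cardE (by have := c.m2; tauto)
  have s0 : e0 ⊆ V := c.subE (Or.inl c.m0)
  have s2 : e2 ⊆ V := c.subE (by have := c.m2; tauto)
  have hyV : y ∈ V := c.subE (e := e1) (by have := c.m1; tauto) hy
  have hsub : H ⊆ Bal V y e2 e0 := by
    intro e he
    have hc := (c.g3 e he).2
    have hV := (c.g3 e he).1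
    simp only [Bal, starF, mem_union, mem_filter, mem_powersetCard, mem_insert, mem_singleton,
      subset_sdiff]
    rcases (c.hH e).1 he with h | h | h | h | h
    · have := h0 h; rw [mem_singleton] at this; tauto
    · have := (c.d01 _ c.m0 _ h).symm
      have := h1 e h
      tauto
    · have := h2 h; rw [mem_singleton] at this; tauto
    · have := (c.dR _ c.m0 _ h).symm
      have := hR e h
      tauto
    · obtain ⟨p, hp, y', hy', x, hx, rfl, -⟩ := c.btrans h
      have hyy := hB _ h
      simp only [mem_insert, mem_singleton] at hyy
      right; right
      have : y = y' := by
        rcases hyy with rfl | rfl | rfl <;> tauto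
      subst this
      simp only [crossF, mem_image, mem_product, Prod.exists]
      refine ⟨x, p, ⟨hx, hp⟩, ?_⟩
      ext t; simp only [mem_insert, mem_singleton]; tauto
  have hcb := card_Bal hy2 hy0 c.e02.symm k2 k0 hyV s0
  have hle := card_le_card hsub
  rw [hcb] at hle
  rcases hle.lt_or_eq with h | h
  · exact Or.inl h
  · right
    have heq : H = Bal V y e2 e0 := eq_of_subset_of_card_le hsub (by omega)
    refine ⟨h, heq ▸ isB_of_bal hy2 hy0 c.e02.symm k2 k0 hyV s0 s2, ?_⟩
    rw [← card_crossF hy2 hy0 c.e02.symm k2 k0]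
    apply card_le_card
    intro t ht
    have htH : t ∈ H := by rw [heq, Bal]; simp [ht]
    simp only [crossF, mem_image, mem_product, Prod.exists] at ht
    obtain ⟨x, p, ⟨hx, hp⟩, rfl⟩ := ht
    rcases (c.hH _).1 htH with h | h | h | h | h
    · exact absurd hy (disjoint_left.1 (c.d01 _ h _ c.m1) (by simp))
    · exact absurd hp (disjoint_right.1 (c.d01 _ c.m0 _ h) (by simp))
    · exact absurd hp (disjoint_right.1 (c.d02 _ c.m0 _ h) (by simp))
    · exact absurd hp (disjoint_right.1 (c.dR _ c.m0 _ h) (by simp))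
    · exact h

def cnt3 (P : Fin 3 → Bool) : ℕ := (P 0).toNat + (P 1).toNat + (P 2).toNat

theorem pair_dec : ∀ P Q : Fin 3 → Bool,
    (∀ i i' i'', ¬ (i ≠ i' ∧ i ≠ i'' ∧ i' ≠ i'' ∧ P i = true ∧ P i' = true ∧ Q i' = true ∧
      Q i'' = true)) →
    cnt3 P + cnt3 Q ≤ 4 ∧ (cnt3 P = 2 → cnt3 Q = 2 → ∀ i, P i = Q i) := by
  decide +kernel

theorem two_dec : ∀ P : Fin 3 → Bool, cnt3 P = 2 → ∃ a b, a ≠ b ∧ P a = true ∧ P b = true := by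
  decide +kernel

def nz (n : ℕ) : Bool := !(n == 0)

def tb (a b c : Bool) : ℕ := match a.toNat + b.toNat + c.toNat with
  | 0 => 0
  | 1 => 3
  | 2 => 4
  | _ => 6

theorem tb_bd {a b c : ℕ} (ha : a ≤ 3) (hb : b ≤ 3) (hc : c ≤ 3) (hab : a + b ≤ 4)
    (hac : a + c ≤ 4) (hbc : b + c ≤ 4) : a + b + c ≤ tb (nz a) (nz b) (nz c) := by
  have key : ∀ a b c : Fin 4, a.1 + b.1 ≤ 4 → a.1 + c.1 ≤ 4 → b.1 + c.1 ≤ 4 →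
      a.1 + b.1 + c.1 ≤ tb (nz a.1) (nz b.1) (nz c.1) := by decide +kernel
  exact key ⟨a, by omega⟩ ⟨b, by omega⟩ ⟨c, by omega⟩ hab hac hbc

def nn (a b : Bool) : ℕ := (!a && !b).toNat

def e3 (a b c : Bool) : ℕ := nn a b + nn b c + nn a c

theorem big_dec : ∀ a b c d e f g h i : Bool,
    (a || b || c || d || e || f || g || h || i) = true →
    (a && b && c && d && e && f && g && h && i) = false →
    tb a e i + tb b f g + tb c d h + (e3 a b c + e3 d e f + e3 g h i) +
      (e3 a d g + e3 b e h + e3 c f i) ≤ 17 ∨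
    (a && b && c && !d && !e && !f && !g && !h && !i) = true ∨
    (!a && !b && !c && d && e && f && !g && !h && !i) = true ∨
    (!a && !b && !c && !d && !e && !f && g && h && i) = true ∨
    (a && !b && !c && d && !e && !f && g && !h && !i) = true ∨
    (!a && b && !c && !d && e && !f && !g && h && !i) = true ∨
    (!a && !b && c && !d && !e && f && !g && !h && i) = true := by
  decide +kernel

theorem cnt_le (P : Fin 3 → Bool) : cnt3 P ≤ 3 := by
  have h0 := Bool.toNat_le (P 0)
  have h1 := Bool.toNat_le (P 1)
  have h2 := Bool.toNat_le (P 2)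
  unfold cnt3; omega

theorem nz_true {P : Fin 3 → Bool} : nz (cnt3 P) = true ↔ ∃ i, P i = true := by
  revert P; decide +kernel

theorem nz_false {P : Fin 3 → Bool} : nz (cnt3 P) = false ↔ ∀ i, P i = false := by
  revert P; decide +kernel

theorem base_num (β : Fin 3 → Fin 3 → Fin 3 → Bool) (γ₁ γ₂ : Fin 3 → Fin 3 → Bool)
    (h4 : ∀ a a' a'' b b' b'' c c' c'' d d' d'' : Fin 3, β a a' a'' = true → β b b' b'' = true →
      β c c' c'' = true → β d d' d'' = true → (a = b ∨ a' = b' ∨ a'' = b'') →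
      (b = c ∨ b' = c' ∨ b'' = c'') → (c = d ∨ c' = d' ∨ c'' = d'') →
      (a ≠ c ∧ a' ≠ c' ∧ a'' ≠ c'') → (a ≠ d ∧ a' ≠ d' ∧ a'' ≠ d'') →
      (b ≠ d ∧ b' ≠ d' ∧ b'' ≠ d'') → False)
    (hγ₁ : ∀ l k, γ₁ l k = true → ∀ i, β i l (k + 1) = false ∧ β i l (k + 2) = false)
    (hγ₂ : ∀ l k, γ₂ l k = true → ∀ i, β i (l + 1) k = false ∧ β i (l + 2) k = false)
    (hne : ∃ i j k, β i j k = true) :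
    (∑ j, ∑ k, cnt3 (fun i => β i j k)) + (∑ j, ∑ k, (γ₁ j k).toNat) +
      (∑ j, ∑ k, (γ₂ j k).toNat) ≤ 17 ∨
    (∃ j, (∀ k, ∃ i, β i j k = true) ∧ ∀ i j' k, β i j' k = true → j' = j) ∨
    (∃ k, (∀ j, ∃ i, β i j k = true) ∧ ∀ i j k', β i j k' = true → k' = k) := by
  obtain ⟨w, hw⟩ : ∃ w : Fin 3 → Fin 3 → ℕ, ∀ j k, w j k = cnt3 (fun i => β i j k) :=
    ⟨_, fun _ _ => rfl⟩
  have hp : ∀ j k j' k', j ≠ j' → k ≠ k' → w j k + w j' k' ≤ 4 ∧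
      (w j k = 2 → w j' k' = 2 → ∀ i, β i j k = β i j' k') := by
    intro j k j' k' hj hk
    rw [hw, hw]
    apply pair_dec
    rintro i i' i'' ⟨h1, h2, h3, p1, p2, p3, p4⟩
    exact h4 _ _ _ _ _ _ _ _ _ _ _ _ p1 p2 p3 p4 (Or.inr (Or.inl rfl)) (Or.inl rfl)
      (Or.inr (Or.inl rfl)) ⟨h1, hj, hk⟩ ⟨h2, hj, hk⟩ ⟨h3, hj, hk⟩
  have hle : ∀ j k, w j k ≤ 3 := fun j k => by rw [hw]; exact cnt_le _
  have hz : ∀ j k, nz (w j k) = true ↔ ∃ i, β i j k = true := fun j k => by rw [hw]; exact nz_true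
  have hz' : ∀ j k, nz (w j k) = false ↔ ∀ i, β i j k = false := fun j k => by
    rw [hw]; exact nz_false
  have g1 : ∀ l k, (γ₁ l k).toNat ≤ nn (nz (w l (k+1))) (nz (w l (k+2))) := by
    intro l k
    cases h : γ₁ l k
    · simp
    · rw [(hz' l (k+1)).2 (fun i => (hγ₁ l k h i).1), (hz' l (k+2)).2 (fun i => (hγ₁ l k h i).2)]
      simp [nn]
  have g2 : ∀ l k, (γ₂ l k).toNat ≤ nn (nz (w (l+1) k)) (nz (w (l+2) k)) := by
    intro l k
    cases h : γ₂ l k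
    · simp
    · rw [(hz' (l+1) k).2 (fun i => (hγ₂ l k h i).1), (hz' (l+2) k).2 (fun i => (hγ₂ l k h i).2)]
      simp [nn]
  simp only [← hw]
  have t1 := tb_bd (hle 0 0) (hle 1 1) (hle 2 2) (hp 0 0 1 1 (by decide) (by decide)).1
    (hp 0 0 2 2 (by decide) (by decide)).1 (hp 1 1 2 2 (by decide) (by decide)).1
  have t2 := tb_bd (hle 0 1) (hle 1 2) (hle 2 0) (hp 0 1 1 2 (by decide) (by decide)).1
    (hp 0 1 2 0 (by decide) (by decide)).1 (hp 1 2 2 0 (by decide) (by decide)).1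
  have t3 := tb_bd (hle 0 2) (hle 1 0) (hle 2 1) (hp 0 2 1 0 (by decide) (by decide)).1
    (hp 0 2 2 1 (by decide) (by decide)).1 (hp 1 0 2 1 (by decide) (by decide)).1
  have nnc : ∀ a b, nn a b = nn b a := by decide
  have e31 : ∀ l, (γ₁ l 0).toNat + (γ₁ l 1).toNat + (γ₁ l 2).toNat ≤
      e3 (nz (w l 0)) (nz (w l 1)) (nz (w l 2)) := by
    intro l
    have a := g1 l 0
    have b := g1 l 1
    have c := g1 l 2
    have x1 : (0 : Fin 3) + 1 = 1 := rfl
    have x2 : (0 : Fin 3) + 2 = 2 := rfl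
    have x3 : (1 : Fin 3) + 1 = 2 := rfl
    have x4 : (1 : Fin 3) + 2 = 0 := rfl
    have x5 : (2 : Fin 3) + 1 = 0 := rfl
    have x6 : (2 : Fin 3) + 2 = 1 := rfl
    rw [x1, x2] at a
    rw [x3, x4, nnc] at b
    rw [x5, x6] at c
    unfold e3; omega
  have e32 : ∀ k, (γ₂ 0 k).toNat + (γ₂ 1 k).toNat + (γ₂ 2 k).toNat ≤
      e3 (nz (w 0 k)) (nz (w 1 k)) (nz (w 2 k)) := by
    intro l
    have a := g2 0 l
    have b := g2 1 l
    have c := g2 2 l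
    have x1 : (0 : Fin 3) + 1 = 1 := rfl
    have x2 : (0 : Fin 3) + 2 = 2 := rfl
    have x3 : (1 : Fin 3) + 1 = 2 := rfl
    have x4 : (1 : Fin 3) + 2 = 0 := rfl
    have x5 : (2 : Fin 3) + 1 = 0 := rfl
    have x6 : (2 : Fin 3) + 2 = 1 := rfl
    rw [x1, x2] at a
    rw [x3, x4, nnc] at b
    rw [x5, x6] at c
    unfold e3; omega
  have r0 := e31 0
  have r1 := e31 1
  have r2 := e31 2
  have s0 := e32 0
  have s1 := e32 1
  have s2 := e32 2
  have hne' : (nz (w 0 0) || nz (w 0 1) || nz (w 0 2) || nz (w 1 0) || nz (w 1 1) || nz (w 1 2) ||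
      nz (w 2 0) || nz (w 2 1) || nz (w 2 2)) = true := by
    obtain ⟨i, j, k, h⟩ := hne
    have := (hz j k).2 ⟨i, h⟩
    fin_cases j <;> fin_cases k <;> simp at this <;> simp [this]
  simp only [Fin.sum_univ_three]
  by_cases hfull : (nz (w 0 0) && nz (w 0 1) && nz (w 0 2) && nz (w 1 0) && nz (w 1 1) &&
      nz (w 1 2) && nz (w 2 0) && nz (w 2 1) && nz (w 2 2)) = false
  · rcases big_dec _ _ _ _ _ _ _ _ _ hne' hfull with h | h | h | h | h | h | h
    · left; omega
    all_goals right
    all_goals simp only [Bool.and_eq_true, Bool.not_eq_true', hz, hz'] at h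
    · left; refine ⟨0, ?_, ?_⟩
      · intro k; fin_cases k <;> simp [h]
      · intro i j k; fin_cases j <;> fin_cases k <;> simp [h]
    · left; refine ⟨1, ?_, ?_⟩
      · intro k; fin_cases k <;> simp [h]
      · intro i j k; fin_cases j <;> fin_cases k <;> simp [h]
    · left; refine ⟨2, ?_, ?_⟩
      · intro k; fin_cases k <;> simp [h]
      · intro i j k; fin_cases j <;> fin_cases k <;> simp [h]
    · right; refine ⟨0, ?_, ?_⟩
      · intro k; fin_cases k <;> simp [h]
      · intro i j k; fin_cases j <;> fin_cases k <;> simp [h]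
    · right; refine ⟨1, ?_, ?_⟩
      · intro k; fin_cases k <;> simp [h]
      · intro i j k; fin_cases j <;> fin_cases k <;> simp [h]
    · right; refine ⟨2, ?_, ?_⟩
      · intro k; fin_cases k <;> simp [h]
      · intro i j k; fin_cases j <;> fin_cases k <;> simp [h]
  · left
    simp only [Bool.not_eq_false, Bool.and_eq_true] at hfull
    obtain ⟨⟨⟨⟨⟨⟨⟨⟨n1, n2⟩, n3⟩, n4⟩, n5⟩, n6⟩, n7⟩, n8⟩, n9⟩ := hfull
    rw [n1, n5, n9] at t1
    rw [n2, n6, n7] at t2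
    rw [n3, n4, n8] at t3
    rw [n1, n2, n3] at r0
    rw [n4, n5, n6] at r1
    rw [n7, n8, n9] at r2
    rw [n1, n4, n7] at s0
    rw [n2, n5, n8] at s1
    rw [n3, n6, n9] at s2
    have z1 : e3 true true true = 0 := rfl
    have z2 : tb true true true = 6 := rfl
    rw [z1] at r0 r1 r2 s0 s1 s2
    rw [z2] at t1 t2 t3
    by_contra hcon
    have q1 := (hp 0 0 1 1 (by decide) (by decide))
    have q2 := (hp 0 0 2 2 (by decide) (by decide))
    have q3 := (hp 1 1 2 2 (by decide) (by decide))
    have q4 := (hp 0 1 1 2 (by decide) (by decide))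
    have q5 := (hp 0 1 2 0 (by decide) (by decide))
    have q6 := (hp 1 2 2 0 (by decide) (by decide))
    have q7 := (hp 0 0 1 2 (by decide) (by decide))
    have w1 : w 0 0 = 2 := by omega
    have w2 : w 1 1 = 2 := by omega
    have w3 : w 2 2 = 2 := by omega
    have w4 : w 1 2 = 2 := by omega
    obtain ⟨a, b, hab, ha, hb⟩ := two_dec (fun i => β i 0 0) (by rw [← hw]; exact w1)
    have a1 : β a 1 1 = true := by rw [← q1.2 w1 w2 a]; exact ha
    have a2 : β b 1 2 = true := by rw [← q7.2 w1 w4 b]; exact hb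
    have a3 : β b 2 2 = true := by rw [← q2.2 w1 w3 b]; exact hb
    exact h4 _ _ _ _ _ _ _ _ _ _ _ _ ha a1 a2 a3 (Or.inl rfl) (Or.inr (Or.inl rfl)) (Or.inl rfl)
      ⟨hab, by decide, by decide⟩ ⟨hab, by decide, by decide⟩ ⟨hab, by decide, by decide⟩

theorem enum3 {e : Finset ℕ} (h : e.card = 3) :
    ∃ f : Fin 3 → ℕ, Function.Injective f ∧ ∀ z, z ∈ e ↔ ∃ i, f i = z := by
  refine ⟨fun i => e.equivFin.symm (Fin.cast h.symm i), ?_, ?_⟩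
  · intro i j hij
    simpa [Subtype.ext_iff] using hij
  · intro z
    constructor
    · intro hz
      exact ⟨Fin.cast h (e.equivFin ⟨z, hz⟩), by simp⟩
    · rintro ⟨i, rfl⟩
      exact (e.equivFin.symm (Fin.cast h.symm i)).2

theorem fin3_pair : ∀ a a' : Fin 3, a ≠ a' → ∃ l, (a = l + 1 ∧ a' = l + 2) ∨ (a = l + 2 ∧ a' = l + 1) := by
  decide

theorem cfg_third {r : Finset ℕ} (h : r.card = 3) {a b : ℕ} (ha : a ∈ r) (hb : b ∈ r)
    (hab : a ≠ b) : ∃ d, d ≠ a ∧ d ≠ b ∧ r = {a, b, d} := by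
  obtain ⟨d, hd⟩ : ∃ d, d ∈ (r.erase a).erase b := by
    apply card_pos.1
    rw [card_erase_of_mem (mem_erase.2 ⟨hab.symm, hb⟩), card_erase_of_mem ha]; omega
  simp only [mem_erase] at hd
  exact ⟨d, hd.2.1, hd.1, eq_triple h ha hb hd.2.2 hab hd.2.1.symm hd.1.symm⟩

theorem good_nine {V : Finset ℕ} {H S0 S1 S2 R B : Finset (Finset ℕ)} {e0 e1 e2 : Finset ℕ}
    (c : Cfg V H S0 S1 S2 R B e0 e1 e2) (hV : V.card = 9) : Good V H B := by
  have k0 : e0.card = 3 := c.cardE (Or.inl c.m0)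
  have k1 : e1.card = 3 := c.cardE (Or.inr (Or.inl c.m1))
  have k2 : e2.card = 3 := c.cardE (Or.inr (Or.inr (Or.inl c.m2)))
  have s0 : e0 ⊆ V := c.subE (Or.inl c.m0)
  have s1 : e1 ⊆ V := c.subE (Or.inr (Or.inl c.m1))
  have s2 : e2 ⊆ V := c.subE (Or.inr (Or.inr (Or.inl c.m2)))
  have hVe : V = e0 ∪ e1 ∪ e2 := by
    symm
    apply eq_of_subset_of_card_le (union_subset (union_subset s0 s1) s2)
    rw [card_union_of_disjoint (disjoint_union_left.2 ⟨c.e02, c.e12⟩),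
      card_union_of_disjoint c.e01]
    omega
  have cov : ∀ e ∈ H, ∀ z ∈ e, z ∈ e0 ∨ z ∈ e1 ∨ z ∈ e2 := by
    intro e he z hz
    have := (c.g3 e he).1 hz
    rw [hVe] at this; simp only [mem_union] at this; tauto
  have t0 : S0 ⊆ {e0} := by
    intro e he
    rw [mem_singleton]
    apply eq_of_subset_of_card_le _ (by rw [k0, c.cardE (Or.inl he)])
    intro z hz
    have h1 := disjoint_left.1 (c.d01 e he _ c.m1) hz
    have h2 := disjoint_left.1 (c.d02 e he _ c.m2) hz
    have := cov e ((c.hH e).2 (Or.inl he)) z hz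
    tauto
  have t1 : S1 ⊆ {e1} := by
    intro e he
    rw [mem_singleton]
    apply eq_of_subset_of_card_le _ (by rw [k1, c.cardE (Or.inr (Or.inl he))])
    intro z hz
    have h1 := disjoint_right.1 (c.d01 _ c.m0 e he) hz
    have h2 := disjoint_left.1 (c.d12 e he _ c.m2) hz
    have := cov e ((c.hH e).2 (Or.inr (Or.inl he))) z hz
    tauto
  have t2 : S2 ⊆ {e2} := by
    intro e he
    rw [mem_singleton]
    apply eq_of_subset_of_card_le _ (by rw [k2, c.cardE (Or.inr (Or.inr (Or.inl he)))])
    intro z hz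
    have h1 := disjoint_right.1 (c.d02 _ c.m0 e he) hz
    have h2 := disjoint_right.1 (c.d12 _ c.m1 e he) hz
    have := cov e ((c.hH e).2 (Or.inr (Or.inr (Or.inl he)))) z hz
    tauto
  obtain ⟨p, pi, hp⟩ := enum3 k0
  obtain ⟨y, yi, hy⟩ := enum3 k1
  obtain ⟨x, xi, hx⟩ := enum3 k2
  have py : ∀ i j, p i ≠ y j := fun i j h =>
    disjoint_left.1 c.e01 ((hp _).2 ⟨i, rfl⟩) ((hy _).2 ⟨j, h.symm⟩)
  have px : ∀ i j, p i ≠ x j := fun i j h =>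
    disjoint_left.1 c.e02 ((hp _).2 ⟨i, rfl⟩) ((hx _).2 ⟨j, h.symm⟩)
  have yx : ∀ i j, y i ≠ x j := fun i j h =>
    disjoint_left.1 c.e12 ((hy _).2 ⟨i, rfl⟩) ((hx _).2 ⟨j, h.symm⟩)
  have hR3 : ∀ r ∈ R, (∃ l k, r = {y (l+1), y (l+2), x k}) ∨ ∃ l k, r = {y l, x (k+1), x (k+2)} := by
    intro r hr
    have hrc : r.card = 3 := c.cardE (by tauto)
    obtain ⟨u, hu, hu'⟩ := not_disjoint_iff.1 (c.R1 _ c.m1 _ hr)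
    obtain ⟨w, hw, hw'⟩ := not_disjoint_iff.1 (c.R2 _ c.m2 _ hr)
    obtain ⟨j, rfl⟩ := (hy _).1 hu
    obtain ⟨k, rfl⟩ := (hx _).1 hw
    obtain ⟨d, h1, h2, rfl⟩ := cfg_third hrc hu' hw' (yx j k)
    rcases cov _ ((c.hH _).2 (by tauto)) d (by simp) with h | h | h
    · exact (disjoint_left.1 (c.dR _ c.m0 _ hr) h (by simp)).elim
    · obtain ⟨j', rfl⟩ := (hy _).1 h
      left
      obtain ⟨l, ⟨rfl, rfl⟩ | ⟨rfl, rfl⟩⟩ := fin3_pair j j' (fun h => h1 (by rw [h]))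
      · refine ⟨l, k, ?_⟩; ext; simp; tauto
      · refine ⟨l, k, ?_⟩; ext; simp; tauto
    · obtain ⟨j', rfl⟩ := (hx _).1 h
      right
      obtain ⟨l, ⟨rfl, rfl⟩ | ⟨rfl, rfl⟩⟩ := fin3_pair k j' (fun h => h2 (by rw [h]))
      · refine ⟨j, l, ?_⟩; ext; simp
      · refine ⟨j, l, ?_⟩; ext; simp; tauto
  have hB3 : ∀ b ∈ B, ∃ i j k, b = {p i, y j, x k} := by
    intro b hb
    obtain ⟨u, hu, v, hv, w, hw, rfl, -⟩ := c.btrans hb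
    obtain ⟨i, rfl⟩ := (hp _).1 hu
    obtain ⟨j, rfl⟩ := (hy _).1 hv
    obtain ⟨k, rfl⟩ := (hx _).1 hw
    exact ⟨i, j, k, rfl⟩
  have disj : ∀ i j k i' j' k', (i ≠ i' ∧ j ≠ j' ∧ k ≠ k') →
      ({p i, y j, x k} : Finset ℕ) ∩ {p i', y j', x k'} = ∅ := by
    rintro i j k i' j' k' ⟨h1, h2, h3⟩
    have h1 := pi.ne h1
    have h2 := yi.ne h2
    have h3 := xi.ne h3
    rw [← disjoint_iff_inter_eq_empty]
    simp [py, px, yx, (py _ _).symm, (px _ _).symm, (yx _ _).symm, h1.symm, h2.symm, h3.symm]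
  have meet : ∀ i j k i' j' k', (i = i' ∨ j = j' ∨ k = k') →
      (({p i, y j, x k} : Finset ℕ) ∩ {p i', y j', x k'}).Nonempty := by
    rintro i j k i' j' k' (rfl | rfl | rfl)
    · exact ⟨p i, by simp⟩
    · exact ⟨y j, by simp⟩
    · exact ⟨x k, by simp⟩
  have inB : ∀ {b}, b ∈ B → b ∈ H := fun h => (c.hH _).2 (by tauto)
  have num := base_num (fun i j k => decide (({p i, y j, x k} : Finset ℕ) ∈ B))
    (fun l k => decide (({y (l+1), y (l+2), x k} : Finset ℕ) ∈ R))
    (fun l k => decide (({y l, x (k+1), x (k+2)} : Finset ℕ) ∈ R))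
    (by
      simp only [decide_eq_true_eq]
      intro a a' a'' b b' b'' d d' d'' f f' f'' h1 h2 h3 h4 m1 m2 m3 n1 n2 n3
      exact c.free ⟨_, inB h1, _, inB h2, _, inB h3, _, inB h4, meet _ _ _ _ _ _ m1,
        meet _ _ _ _ _ _ m2, meet _ _ _ _ _ _ m3, disj _ _ _ _ _ _ n1, disj _ _ _ _ _ _ n2,
        disj _ _ _ _ _ _ n3⟩)
    (by
      simp only [decide_eq_true_eq, decide_eq_false_iff_not]
      intro l k hr i
      refine ⟨fun hb => c.BR _ hr _ hb ?_, fun hb => c.BR _ hr _ hb ?_⟩ <;>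
      simp [py, px, yx, (py _ _).symm, (px _ _).symm, (yx _ _).symm, yi.eq_iff, xi.eq_iff])
    (by
      simp only [decide_eq_true_eq, decide_eq_false_iff_not]
      intro l k hr i
      refine ⟨fun hb => c.BR _ hr _ hb ?_, fun hb => c.BR _ hr _ hb ?_⟩ <;>
      simp [py, px, yx, (py _ _).symm, (px _ _).symm, (yx _ _).symm, yi.eq_iff, xi.eq_iff])
    (by
      obtain ⟨b, hb⟩ := c.hB
      obtain ⟨i, j, k, rfl⟩ := hB3 b hb
      exact ⟨i, j, k, by simpa using hb⟩)
  simp only [decide_eq_true_eq] at num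
  rcases num with num | ⟨j, hj, hj'⟩ | ⟨k, hk, hk'⟩
  · left
    have cB : B.card ≤ ∑ j, ∑ k, cnt3 (fun i => decide (({p i, y j, x k} : Finset ℕ) ∈ B)) := by
      have : B ⊆ (univ.filter (fun t : Fin 3 × Fin 3 × Fin 3 =>
          ({p t.2.2, y t.1, x t.2.1} : Finset ℕ) ∈ B)).image
          (fun t => ({p t.2.2, y t.1, x t.2.1} : Finset ℕ)) := by
        intro b hb
        obtain ⟨i, j, k, rfl⟩ := hB3 b hb
        exact mem_image.2 ⟨(j, k, i), by simpa using hb, rfl⟩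
      refine (card_le_card this).trans (card_image_le.trans ?_)
      rw [card_filter, Fintype.sum_prod_type]
      simp only [Fintype.sum_prod_type]
      apply sum_le_sum; intro j _
      apply sum_le_sum; intro k _
      rw [Fin.sum_univ_three]
      simp only [cnt3, Bool.toNat, Bool.cond_decide, le_refl]
    have cR : R.card ≤ (∑ l, ∑ k, (decide (({y (l+1), y (l+2), x k} : Finset ℕ) ∈ R)).toNat) +
        ∑ l, ∑ k, (decide (({y l, x (k+1), x (k+2)} : Finset ℕ) ∈ R)).toNat := by
      have : R ⊆ (univ.filter (fun t : Fin 3 × Fin 3 =>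
          ({y (t.1+1), y (t.1+2), x t.2} : Finset ℕ) ∈ R)).image
          (fun t => ({y (t.1+1), y (t.1+2), x t.2} : Finset ℕ)) ∪ (univ.filter (fun t : Fin 3 × Fin 3 =>
          ({y t.1, x (t.2+1), x (t.2+2)} : Finset ℕ) ∈ R)).image
          (fun t => ({y t.1, x (t.2+1), x (t.2+2)} : Finset ℕ)) := by
        intro b hb
        rw [mem_union]
        rcases hR3 b hb with ⟨l, k, rfl⟩ | ⟨l, k, rfl⟩
        · left; exact mem_image.2 ⟨(l, k), by simpa using hb, rfl⟩
        · right; exact mem_image.2 ⟨(l, k), by simpa using hb, rfl⟩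
      refine (card_le_card this).trans ((card_union_le _ _).trans ?_)
      apply add_le_add
      · refine card_image_le.trans ?_
        rw [card_filter, Fintype.sum_prod_type]
        simp only [Bool.toNat, Bool.cond_decide, le_refl]
      · refine card_image_le.trans ?_
        rw [card_filter, Fintype.sum_prod_type]
        simp only [Bool.toNat, Bool.cond_decide, le_refl]
    have cH : H.card ≤ 3 + R.card + B.card := by
      have : H ⊆ ({e0, e1, e2} ∪ R) ∪ B := by
        intro e he
        simp only [mem_union, mem_insert, mem_singleton]
        rcases (c.hH e).1 he with h | h | h | h | h
        · have := t0 h; rw [mem_singleton] at this; tauto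
        · have := t1 h; rw [mem_singleton] at this; tauto
        · have := t2 h; rw [mem_singleton] at this; tauto
        · tauto
        · tauto
      refine (card_le_card this).trans ((card_union_le _ _).trans ?_)
      have := card_union_le ({e0, e1, e2} : Finset (Finset ℕ)) R
      have := card_le_three (a := e0) (b := e1) (c := e2)
      omega
    rw [hV]
    have : (9 - 4).choose 2 = 10 := rfl
    omega
  · have hyj : y j ∈ e1 := (hy _).2 ⟨j, rfl⟩
    refine good_bal c hyj t0 t2 ?_ ?_ ?_
    · intro s hs; have := t1 hs; rw [mem_singleton] at this; rwa [this]
    · intro r hr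
      by_contra hcon
      have hall : ∀ k, x k ∈ r := by
        intro k
        obtain ⟨i, hi⟩ := hj k
        obtain ⟨z, hz, hz'⟩ := not_disjoint_iff.1 (c.BR _ hr _ hi)
        simp only [mem_insert, mem_singleton] at hz'
        rcases hz' with rfl | rfl | rfl
        · exact (disjoint_left.1 (c.dR _ c.m0 _ hr) ((hp _).2 ⟨i, rfl⟩) hz).elim
        · exact (hcon hz).elim
        · exact hz
      have : e2 = r := eq_of_subset_of_card_le (by
        intro z hz; obtain ⟨k, rfl⟩ := (hx _).1 hz; exact hall k)
        (by rw [k2, c.cardE (e := r) (by tauto)])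
      exact c.R1 _ c.m1 _ hr (this ▸ c.e12)
    · intro b hb
      obtain ⟨i, j', k, rfl⟩ := hB3 b hb
      rw [hj' i j' k hb]; simp
  · have hyj : x k ∈ e2 := (hx _).2 ⟨k, rfl⟩
    refine good_bal c.swap hyj t0 t1 ?_ ?_ ?_
    · intro s hs; have := t2 hs; rw [mem_singleton] at this; rwa [this]
    · intro r hr
      by_contra hcon
      have hall : ∀ k, y k ∈ r := by
        intro j
        obtain ⟨i, hi⟩ := hk j
        obtain ⟨z, hz, hz'⟩ := not_disjoint_iff.1 (c.BR _ hr _ hi)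
        simp only [mem_insert, mem_singleton] at hz'
        rcases hz' with rfl | rfl | rfl
        · exact (disjoint_left.1 (c.dR _ c.m0 _ hr) ((hp _).2 ⟨i, rfl⟩) hz).elim
        · exact hz
        · exact (hcon hz).elim
      have : e1 = r := eq_of_subset_of_card_le (by
        intro z hz; obtain ⟨k, rfl⟩ := (hy _).1 hz; exact hall k)
        (by rw [k1, c.cardE (e := r) (by tauto)])
      exact c.R2 _ c.m2 _ hr (this ▸ c.e12.symm)
    · intro b hb
      obtain ⟨i, j', k', rfl⟩ := hB3 b hb
      rw [hk' i j' k' hb]; simp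

theorem split3 {e : Finset ℕ} (h : e.card = 3) {y : ℕ} (hy : y ∈ e) :
    ∃ a b, a ≠ y ∧ b ≠ y ∧ a ≠ b ∧ e = {y, a, b} := by
  obtain ⟨a, ha⟩ : ∃ a, a ∈ e.erase y := by
    apply card_pos.1
    rw [card_erase_of_mem hy]; omega
  rw [mem_erase] at ha
  obtain ⟨d, h1, h2, h3⟩ := cfg_third h hy ha.2 ha.1.symm
  exact ⟨a, d, ha.1, h1, h2.symm, h3⟩

theorem allin {D T F : Finset (Finset ℕ)} (h : D ⊆ T ∪ F) (hc : T.card + F.card ≤ D.card) :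
    F ⊆ D := by
  intro f hf
  by_contra hcon
  have : D ⊆ T ∪ F.erase f := by
    intro d hd
    have := h hd
    rw [mem_union] at this ⊢
    rcases this with h | h
    · exact Or.inl h
    · exact Or.inr (mem_erase.2 ⟨by rintro rfl; exact hcon hd, h⟩)
  have h1 := (card_le_card this).trans (card_union_le _ _)
  have h2 := card_erase_of_mem hf
  have h3 := card_pos.2 ⟨f, hf⟩
  omega

theorem onein {D F : Finset (Finset ℕ)} (h : D ⊆ F) (hc : F.card ≤ D.card + 1) {f g : Finset ℕ}
    (hf : f ∈ F) (hg : g ∈ F) (hfg : f ≠ g) : f ∈ D ∨ g ∈ D := by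
  by_contra hcon
  push Not at hcon
  have : D ⊆ (F.erase f).erase g := by
    intro d hd
    exact mem_erase.2 ⟨by rintro rfl; exact hcon.2 hd, mem_erase.2
      ⟨by rintro rfl; exact hcon.1 hd, h hd⟩⟩
  have h1 := card_le_card this
  rw [card_erase_of_mem (mem_erase.2 ⟨hfg.symm, hg⟩), card_erase_of_mem hf] at h1
  have h3 := card_pos.2 ⟨f, hf⟩
  have : 1 < F.card := one_lt_card.2 ⟨f, hf, g, hg, hfg⟩
  omega

theorem bound_succ {n : ℕ} (hn : 10 ≤ n) : (n - 4).choose 2 = (n - 1 - 4).choose 2 + (n - 5) := by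
  obtain ⟨m, rfl⟩ := Nat.exists_eq_add_of_le hn
  have h1 : 10 + m - 4 = (m + 5) + 1 := by omega
  have h2 : 10 + m - 1 - 4 = m + 5 := by omega
  have h3 : 10 + m - 5 = m + 5 := by omega
  rw [h1, h2, h3, Nat.choose_succ_succ' (m+5) 1, Nat.choose_one_right, add_comm]

namespace Cfg
variable {V : Finset ℕ} {H S0 S1 S2 R B : Finset (Finset ℕ)} {e0 e1 e2 : Finset ℕ}

theorem k0 (c : Cfg V H S0 S1 S2 R B e0 e1 e2) : e0.card = 3 := c.cardE (Or.inl c.m0)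
theorem k1 (c : Cfg V H S0 S1 S2 R B e0 e1 e2) : e1.card = 3 := c.cardE (Or.inr (Or.inl c.m1))
theorem k2 (c : Cfg V H S0 S1 S2 R B e0 e1 e2) : e2.card = 3 := c.swap.k1
theorem s0 (c : Cfg V H S0 S1 S2 R B e0 e1 e2) : e0 ⊆ V := c.subE (Or.inl c.m0)
theorem s1 (c : Cfg V H S0 S1 S2 R B e0 e1 e2) : e1 ⊆ V := c.subE (Or.inr (Or.inl c.m1))
theorem s2 (c : Cfg V H S0 S1 S2 R B e0 e1 e2) : e2 ⊆ V := c.swap.s1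

theorem card012 (c : Cfg V H S0 S1 S2 R B e0 e1 e2) : (e0 ∪ e1 ∪ e2).card = 9 := by
  rw [card_union_of_disjoint (disjoint_union_left.2 ⟨c.e02, c.e12⟩),
      card_union_of_disjoint c.e01, c.k0, c.k1, c.k2]

theorem step (_c : Cfg V H S0 S1 S2 R B e0 e1 e2) (hn : 10 ≤ V.card) {v : ℕ} (hv : v ∈ V)
    (ih : Good (V.erase v) (H.filter (v ∉ ·)) B)
    (hD : (H.filter (v ∈ ·)).card ≤ V.card - 5)
    (hD' : V.card - 5 ≤ (H.filter (v ∈ ·)).card → B.card ≤ 3) : Good V H B := by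
  left
  have h1 := card_filter_add_card_filter_not (s := H) (fun e => v ∈ e)
  rw [bound_succ hn]
  unfold Good at ih
  rw [card_erase_of_mem hv] at ih
  rcases ih with h | ⟨h, -, h9⟩
  · omega
  · by_cases h : V.card - 5 ≤ (H.filter (v ∈ ·)).card
    · have := hD' h; omega
    · omega

theorem bcard3 (c : Cfg V H S0 S1 S2 R B e0 e1 e2) {x y : ℕ} (hx : x ∈ e2) (hy : y ∈ e1)
    (h : ∀ b ∈ B, x ∈ b ∧ y ∈ b) : B.card ≤ 3 := by
  have : B ⊆ e0.image (fun p => {p, y, x}) := by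
    intro b hb
    obtain ⟨p, hp, y', hy', x', hx', rfl, -⟩ := c.btrans hb
    obtain ⟨h1, h2⟩ := h _ hb
    have a1 := disjoint_left.1 c.e01 hp
    have a2 := disjoint_left.1 c.e02 hp
    have a3 := disjoint_left.1 c.e12 hy
    have a4 := disjoint_left.1 c.e12 hy'
    refine mem_image.2 ⟨p, hp, ?_⟩
    simp only [mem_insert, mem_singleton] at h1 h2
    have : x = x' := by
      rcases h1 with rfl | rfl | rfl <;> tauto
    have : y = y' := by
      rcases h2 with rfl | rfl | rfl <;> tauto
    subst x y; rfl
  exact (card_le_card this).trans (card_image_le.trans c.k0.le)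

theorem force (c : Cfg V H S0 S1 S2 R B e0 e1 e2) {x v a a' : ℕ} (r1 : {v, x, a} ∈ R)
    (r2 : {v, x, a'} ∈ R) (h1 : v ∉ e1) (h2 : v ∉ e2) (ha : a ∉ e2) (ha' : a' ∉ e2) (haa : a ≠ a')
    (hx : x ∈ e2) : ∀ b ∈ B, x ∈ b := by
  intro b hb
  obtain ⟨p, hp, y', hy', x', hx', rfl, -, -, -, hr⟩ := c.btrans hb
  have g1 := hr _ r1
  have g2 := hr _ r2
  have a4 := disjoint_left.1 c.e12 hy'
  simp only [mem_insert, mem_singleton] at *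
  by_contra hcon
  have q1 : x' ≠ v := by rintro rfl; exact h2 hx'
  have q2 : x' ≠ x := by rintro rfl; tauto
  have q3 : x' ≠ a := by rintro rfl; tauto
  have q4 : x' ≠ a' := by rintro rfl; tauto
  have q5 : y' ≠ v := by rintro rfl; tauto
  have q6 : y' ≠ x := by rintro rfl; tauto
  have : y' = a := by tauto
  have : y' = a' := by tauto
  omega

theorem inR (c : Cfg V H S0 S1 S2 R B e0 e1 e2) {v : ℕ} (h0 : v ∉ e0) (h1 : v ∉ e1) (h2 : v ∉ e2)
    {e : Finset ℕ} (he : e ∈ H) (hv : v ∈ e) (m1 : ¬ Disjoint e1 e) (m2 : ¬ Disjoint e2 e) :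
    e ∈ R := by
  rcases (c.hH e).1 he with h | h | h | h | h
  · exact (m1 (c.d01 _ h _ c.m1).symm).elim
  · exact (m2 (c.d12 _ h _ c.m2).symm).elim
  · exact (m1 (c.d12 _ c.m1 _ h)).elim
  · exact h
  · have := c.bsub h hv; tauto

theorem rform (c : Cfg V H S0 S1 S2 R B e0 e1 e2) {v x x1 x2 y y1 y2 : ℕ} (h1 : v ∉ e1)
    (h2 : v ∉ e2) (he1 : e1 = {y, y1, y2}) (he2 : e2 = {x, x1, x2}) (hr : ∀ r ∈ R, y ∈ r ∨ x ∈ r)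
    {r : Finset ℕ} (hrR : r ∈ R) (hv : v ∈ r) : r = {v, x, y} ∨ r = {v, x, y1} ∨ r = {v, x, y2} ∨
      r = {v, y, x1} ∨ r = {v, y, x2} := by
  have hrc : r.card = 3 := c.cardE (by tauto)
  obtain ⟨u, hu, hu'⟩ := not_disjoint_iff.1 (c.R1 _ c.m1 _ hrR)
  obtain ⟨w, hw, hw'⟩ := not_disjoint_iff.1 (c.R2 _ c.m2 _ hrR)
  have huw : u ≠ w := by rintro rfl; exact disjoint_left.1 c.e12 hu hw
  have : r = {v, u, w} := eq_triple hrc hv hu' hw' (by rintro rfl; exact h1 hu)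
    (by rintro rfl; exact h2 hw) huw
  have hyx : y ∉ e2 := disjoint_left.1 c.e12 (by simp [he1])
  have hxy : x ∉ e1 := disjoint_right.1 c.e12 (by simp [he2])
  have hy : y ∈ e1 := by simp [he1]
  have hx : x ∈ e2 := by simp [he2]
  have key : u = y ∨ w = x := by
    have := hr r hrR
    rw [‹r = _›] at this
    simp only [mem_insert, mem_singleton] at this
    have q1 : y ≠ v := by rintro rfl; tauto
    have q2 : x ≠ v := by rintro rfl; tauto
    have q3 : y ≠ w := by rintro rfl; tauto
    have q4 : x ≠ u := by rintro rfl; tauto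
    tauto
  subst this
  rw [he1] at hu
  rw [he2] at hw
  simp only [mem_insert, mem_singleton] at hu hw
  have com : ∀ a b : ℕ, ({v, a, b} : Finset ℕ) = {v, b, a} := by
    intro a b; rw [pair_comm a b]
  rcases key with rfl | rfl
  · rcases hw with rfl | rfl | rfl
    · left; exact com _ _
    · tauto
    · tauto
  · rw [com u w]
    rcases hu with rfl | rfl | rfl <;> tauto

/-- uncovered vertex -/
theorem caseA (c : Cfg V H S0 S1 S2 R B e0 e1 e2) (hn : 10 ≤ V.card) {v : ℕ} (hv : v ∈ V)
    (ih : Good (V.erase v) (H.filter (v ∉ ·)) B) (h0 : v ∉ e0) (h1 : v ∉ e1) (h2 : v ∉ e2)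
    (u0 : ∀ s ∈ S0, v ∉ s) (u1 : ∀ s ∈ S1, v ∉ s) (u2 : ∀ s ∈ S2, v ∉ s) : Good V H B := by
  obtain ⟨b, hb⟩ := c.hB
  obtain ⟨p, hp, y, hy, x, hx, -, -, -, -, hr⟩ := c.btrans hb
  obtain ⟨y1, y2, hy1, hy2, hy12, he1⟩ := split3 c.k1 hy
  obtain ⟨x1, x2, hx1, hx2, hx12, he2⟩ := split3 c.k2 hx
  have hsub : H.filter (v ∈ ·) ⊆ ∅ ∪ {{v, x, y}, {v, x, y1}, {v, x, y2}, {v, y, x1}, {v, y, x2}} := by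
    intro e he
    rw [mem_filter] at he
    rcases (c.hH e).1 he.1 with h | h | h | h | h
    · exact (u0 e h he.2).elim
    · exact (u1 e h he.2).elim
    · exact (u2 e h he.2).elim
    · have := c.rform h1 h2 he1 he2 hr h he.2
      simpa using this
    · have := c.bsub h he.2; tauto
  have c5 := card_le_five (a := ({v, x, y} : Finset ℕ)) (b := {v, x, y1}) (c := {v, x, y2})
    (d := {v, y, x1}) (e := {v, y, x2})
  refine c.step hn hv ih ?_ ?_
  · have := (card_le_card hsub).trans (card_union_le _ _)
    rw [card_empty] at this
    omega
  · intro hD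
    have all := allin hsub (by rw [card_empty]; omega)
    have my1 : y1 ∈ e1 := by simp [he1]
    have my2 : y2 ∈ e1 := by simp [he1]
    have mx1 : x1 ∈ e2 := by simp [he2]
    have mx2 : x2 ∈ e2 := by simp [he2]
    have inr : ∀ a ∈ e1, ∀ a' ∈ e2, ({v, a, a'} : Finset ℕ) ∈ H.filter (v ∈ ·) →
        ({v, a, a'} : Finset ℕ) ∈ R := by
      intro a ha a' ha' h
      exact c.inR h0 h1 h2 (mem_filter.1 h).1 (by simp) (not_disjoint_iff.2 ⟨a, ha, by simp⟩)
        (not_disjoint_iff.2 ⟨a', ha', by simp⟩)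
    have inr' : ∀ a ∈ e1, ∀ a' ∈ e2, ({v, a', a} : Finset ℕ) ∈ H.filter (v ∈ ·) →
        ({v, a', a} : Finset ℕ) ∈ R := by
      intro a ha a' ha' h
      rw [pair_comm a' a] at h ⊢; exact inr a ha a' ha' h
    have f1 := c.force (inr' y1 my1 x hx (all (by simp))) (inr' y2 my2 x hx (all (by simp))) h1 h2
      (disjoint_left.1 c.e12 my1) (disjoint_left.1 c.e12 my2) hy12 hx
    have f2 := c.swap.force (inr y hy x1 mx1 (all (by simp))) (inr y hy x2 mx2 (all (by simp))) h2 h1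
      (disjoint_right.1 c.e12 mx1) (disjoint_right.1 c.e12 mx2) hx12 hy
    exact c.bcard3 hx hy fun b hb => ⟨f1 b hb, f2 b hb⟩

theorem caseB (c : Cfg V H S0 S1 S2 R B e0 e1 e2) (hn : 10 ≤ V.card) {v : ℕ} (hv : v ∈ V)
    (ih : Good (V.erase v) (H.filter (v ∉ ·)) B) (h0 : v ∉ e0) {s : Finset ℕ} (hs : s ∈ S0)
    (hvs : v ∈ s) : Good V H B := by
  obtain ⟨b, hb⟩ := c.hB
  obtain ⟨p, hp, y, hy, x, hx, -, hp0, -⟩ := c.btrans hb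
  have hpv : p ≠ v := by rintro rfl; exact h0 hp
  have h1 : v ∉ e1 := disjoint_left.1 (c.d01 _ hs _ c.m1) hvs
  have h2 : v ∉ e2 := disjoint_left.1 (c.d02 _ hs _ c.m2) hvs
  have hsub : H.filter (v ∈ ·) ⊆ (V \ ({p, v} ∪ (e1 ∪ e2))).image (fun t => {p, v, t}) := by
    intro e he
    rw [mem_filter] at he
    have he' : e ∈ S0 := by
      rcases (c.hH e).1 he.1 with h | h | h | h | h
      · exact h
      · exact (disjoint_left.1 (c.d01 _ hs _ h) hvs he.2).elim
      · exact (disjoint_left.1 (c.d02 _ hs _ h) hvs he.2).elim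
      · exact (disjoint_left.1 (c.dR _ hs _ h) hvs he.2).elim
      · have := c.bsub h he.2; tauto
    obtain ⟨t, ht1, ht2, rfl⟩ := cfg_third (c.cardE (Or.inl he')) (hp0 _ he') he.2 hpv
    refine mem_image.2 ⟨t, ?_, rfl⟩
    simp only [mem_sdiff, mem_union, mem_insert, mem_singleton]
    have a1 : t ∉ e1 := disjoint_left.1 (c.d01 _ he' _ c.m1) (by simp)
    have a2 : t ∉ e2 := disjoint_left.1 (c.d02 _ he' _ c.m2) (by simp)
    exact ⟨(c.g3 _ he.1).1 (by simp), by tauto⟩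
  have hcard : (V \ ({p, v} ∪ (e1 ∪ e2))).card = V.card - 8 := by
    rw [card_sdiff_of_subset, card_union_of_disjoint, card_union_of_disjoint c.e12, c.k1, c.k2,
      card_pair hpv]
    · rw [disjoint_left]
      intro z hz
      simp only [mem_insert, mem_singleton] at hz
      rw [mem_union]
      have := disjoint_left.1 c.e01 hp
      have := disjoint_left.1 c.e02 hp
      rcases hz with rfl | rfl <;> tauto
    · refine union_subset ?_ (union_subset c.s1 c.s2)
      intro z hz
      simp only [mem_insert, mem_singleton] at hz
      rcases hz with rfl | rfl
      · exact c.s0 hp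
      · exact hv
  have := (card_le_card hsub).trans card_image_le
  refine c.step hn hv ih ?_ ?_ <;> omega

theorem caseC (c : Cfg V H S0 S1 S2 R B e0 e1 e2) (hn : 10 ≤ V.card) {v : ℕ} (hv : v ∈ V)
    (ih : Good (V.erase v) (H.filter (v ∉ ·)) B) (h1 : v ∉ e1) {s : Finset ℕ} (hs : s ∈ S1)
    (hvs : v ∈ s) {t : Finset ℕ} (ht : t ∈ S2) (hte : t ≠ e2) : Good V H B := by
  obtain ⟨b, hb⟩ := c.hB
  obtain ⟨p, hp, y, hy, x, hx, -, -, hy1, hx2, hr⟩ := c.btrans hb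
  have h0 : v ∉ e0 := disjoint_right.1 (c.d01 _ c.m0 _ hs) hvs
  have h2 : v ∉ e2 := disjoint_left.1 (c.d12 _ hs _ c.m2) hvs
  have hyv : y ≠ v := by rintro rfl; exact h1 hy
  obtain ⟨y1, y2, hy1', hy2', hy12, he1⟩ := split3 c.k1 hy
  have my1 : y1 ∈ e1 := by simp [he1]
  have my2 : y2 ∈ e1 := by simp [he1]
  have tc : t.card = 3 := c.cardE (by tauto)
  obtain ⟨x1, x2, hx1', hx2', hx12, he2, hx2t⟩ : ∃ a b, a ≠ x ∧ b ≠ x ∧ a ≠ b ∧ e2 = {x, a, b} ∧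
      b ∉ t := by
    obtain ⟨a, b, h1, h2, h3, h4⟩ := split3 c.k2 hx
    by_cases hbt : b ∈ t
    · refine ⟨b, a, h2, h1, h3.symm, by rw [h4, pair_comm a b], fun hat => hte ?_⟩
      rw [h4]
      exact eq_triple tc (hx2 t ht) hat hbt h1.symm h2.symm h3
    · exact ⟨a, b, h1, h2, h3, h4, hbt⟩
  have mx1 : x1 ∈ e2 := by simp [he2]
  have mx2 : x2 ∈ e2 := by simp [he2]
  obtain ⟨V1, hV1⟩ : ∃ V1, V1 = S1.biUnion id := ⟨_, rfl⟩
  have mV1 : ∀ s ∈ S1, ∀ z ∈ s, z ∈ V1 := by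
    intro s hs z hz; rw [hV1]; exact mem_biUnion.2 ⟨s, hs, hz⟩
  have hsub : H.filter (v ∈ ·) ⊆ (V1 \ {y, v}).image (fun t => {y, v, t}) ∪
      {{v, x, y}, {v, x, y1}, {v, x, y2}, {v, y, x1}} := by
    intro e he
    rw [mem_filter] at he
    rw [mem_union]
    rcases (c.hH e).1 he.1 with h | h | h | h | h
    · exact (disjoint_right.1 (c.d01 _ h _ hs) hvs he.2).elim
    · left
      obtain ⟨t, ht1, ht2, rfl⟩ := cfg_third (c.cardE (Or.inr (Or.inl h))) (hy1 _ h) he.2 hyv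
      refine mem_image.2 ⟨t, ?_, rfl⟩
      simp only [mem_sdiff, mem_insert, mem_singleton]
      exact ⟨mV1 _ h _ (by simp), by tauto⟩
    · exact (disjoint_left.1 (c.d12 _ hs _ h) hvs he.2).elim
    · right
      rcases c.rform h1 h2 he1 he2 hr h he.2 with g | g | g | g | g
      · simp [g]
      · simp [g]
      · simp [g]
      · simp [g]
      · exfalso
        obtain ⟨z, hz, hz'⟩ := not_disjoint_iff.1 (c.R2 _ ht _ h)
        rw [g] at hz'
        simp only [mem_insert, mem_singleton] at hz'
        rcases hz' with rfl | rfl | rfl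
        · exact disjoint_left.1 (c.d12 _ hs _ ht) hvs hz
        · exact disjoint_left.1 (c.d12 _ c.m1 _ ht) hy hz
        · exact hx2t hz
    · have := c.bsub h he.2; tauto
  have cT : ((V1 \ {y, v}).image (fun t => ({y, v, t} : Finset ℕ))).card ≤ V1.card - 2 := by
    refine card_image_le.trans ?_
    rw [card_sdiff_of_subset, card_pair hyv]
    intro z hz
    simp only [mem_insert, mem_singleton] at hz
    rcases hz with rfl | rfl
    · exact mV1 _ c.m1 _ hy
    · exact mV1 _ hs _ hvs
  have c4 := card_le_four (a := ({v, x, y} : Finset ℕ)) (b := {v, x, y1}) (c := {v, x, y2})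
    (d := {v, y, x1})
  obtain ⟨w, hw, hw'⟩ : ∃ w ∈ t, w ∉ e2 := by
    by_contra hcon
    push Not at hcon
    exact hte (eq_of_subset_of_card_le hcon (by rw [tc, c.k2]))
  have hV : V1.card + 7 ≤ V.card := by
    have : V1 ∪ (e0 ∪ insert w e2) ⊆ V := by
      refine union_subset ?_ (union_subset c.s0 (insert_subset (c.subE (e := t) (by tauto) hw) c.s2))
      rw [hV1]
      intro z hz
      obtain ⟨s, hs, hz⟩ := mem_biUnion.1 hz
      exact c.subE (e := s) (by tauto) hz
    have hc := card_le_card this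
    rw [card_union_of_disjoint, card_union_of_disjoint, card_insert_of_notMem hw', c.k0, c.k2] at hc
    · omega
    · rw [disjoint_insert_right]
      exact ⟨disjoint_right.1 (c.d02 _ c.m0 _ ht) hw, c.e02⟩
    · rw [disjoint_left, hV1]
      intro z hz
      obtain ⟨s, hs, hz⟩ := mem_biUnion.1 hz
      have a1 := disjoint_right.1 (c.d01 _ c.m0 _ hs) hz
      have a2 := disjoint_left.1 (c.d12 _ hs _ c.m2) hz
      have a3 := disjoint_left.1 (c.d12 _ hs _ ht) hz
      simp only [mem_union, mem_insert, not_or]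
      exact ⟨a1, by rintro rfl; exact a3 hw, a2⟩
  have hV3 : 2 ≤ V1.card := by
    have : e1 ⊆ V1 := fun z hz => mV1 _ c.m1 _ hz
    have := card_le_card this
    rw [c.k1] at this
    omega
  have hD := (card_le_card hsub).trans (card_union_le _ _)
  refine c.step hn hv ih ?_ ?_
  · omega
  · intro hD'
    have all := allin hsub (by omega)
    have inr : ∀ a ∈ e1, ∀ a' ∈ e2, ({v, a, a'} : Finset ℕ) ∈ H.filter (v ∈ ·) →
        ({v, a, a'} : Finset ℕ) ∈ R := by
      intro a ha a' ha' h
      exact c.inR h0 h1 h2 (mem_filter.1 h).1 (by simp) (not_disjoint_iff.2 ⟨a, ha, by simp⟩)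
        (not_disjoint_iff.2 ⟨a', ha', by simp⟩)
    have inr' : ∀ a ∈ e1, ∀ a' ∈ e2, ({v, a', a} : Finset ℕ) ∈ H.filter (v ∈ ·) →
        ({v, a', a} : Finset ℕ) ∈ R := by
      intro a ha a' ha' h
      rw [pair_comm a' a] at h ⊢; exact inr a ha a' ha' h
    have f1 := c.force (inr' y1 my1 x hx (all (by simp))) (inr' y2 my2 x hx (all (by simp))) h1 h2
      (disjoint_left.1 c.e12 my1) (disjoint_left.1 c.e12 my2) hy12 hx
    have f2 := c.swap.force (inr y hy x1 mx1 (all (by simp)))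
      (inr y hy x hx (by rw [pair_comm y x]; exact all (by simp))) h2 h1
      (disjoint_right.1 c.e12 mx1) (disjoint_right.1 c.e12 hx) hx1' hy
    exact c.bcard3 hx hy fun b hb => ⟨f1 b hb, f2 b hb⟩

theorem direct (c : Cfg V H S0 S1 S2 R B e0 e1 e2) {x y : ℕ} (hx : x ∈ e2) (hy : y ∈ e1)
    (hB : ∀ b ∈ B, x ∈ b ∧ y ∈ b) (h0 : S0 ⊆ {e0}) (h2 : S2 ⊆ {e2}) (h1 : ∀ s ∈ S1, y ∈ s)
    {X : Finset (Finset ℕ)} (hX : X.card ≤ 5) (hR : ∀ r ∈ R, y ∉ r → r ∈ X) : Good V H B := by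
  left
  have hsub : H ⊆ (starF (V \ e0) y ∪ B) ∪ ({e0, e2} ∪ X) := by
    intro e he
    have hc := (c.g3 e he).2
    have hV := (c.g3 e he).1
    simp only [starF, mem_union, mem_filter, mem_powersetCard, mem_insert, mem_singleton,
      subset_sdiff]
    rcases (c.hH e).1 he with h | h | h | h | h
    · have := h0 h; rw [mem_singleton] at this; tauto
    · have := (c.d01 _ c.m0 _ h).symm
      have := h1 e h
      tauto
    · have := h2 h; rw [mem_singleton] at this; tauto
    · have := (c.dR _ c.m0 _ h).symm
      have := hR e h
      tauto
    · tauto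
  have a1 := (card_le_card hsub).trans (card_union_le _ _)
  have a2 := card_union_le (starF (V \ e0) y) B
  have a3 := card_union_le ({e0, e2} : Finset (Finset ℕ)) X
  have a4 := card_le_two (a := e0) (b := e2)
  have a5 := c.bcard3 hx hy hB
  have a6 : (starF (V \ e0) y).card = (V.card - 4).choose 2 := by
    rw [card_starF (mem_sdiff.2 ⟨c.s1 hy, disjoint_right.1 c.e01 hy⟩), card_sdiff_of_subset c.s0,
      c.k0]
    congr 1
  omega

end Cfg

namespace Cfg
variable {V : Finset ℕ} {H S0 S1 S2 R B : Finset (Finset ℕ)} {e0 e1 e2 : Finset ℕ}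

theorem caseD1 (c : Cfg V H S0 S1 S2 R B e0 e1 e2) {y x : ℕ} (hy : y ∈ e1) (hx : x ∈ e2)
    (hy1 : ∀ s ∈ S1, y ∈ s) (hr : ∀ r ∈ R, y ∈ r ∨ x ∈ r)
    (h0 : S0 ⊆ {e0}) (h2 : S2 ⊆ {e2}) (hcom : ∀ z, (∀ s ∈ S1, z ∈ s) → z = y) : Good V H B := by
  have yb : ∀ b ∈ B, y ∈ b := by
    intro b hb
    obtain ⟨p', hp', y', hy', x', hx', rfl, -, g, -⟩ := c.btrans hb
    rw [hcom y' g]; simp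
  by_cases hall : ∀ r ∈ R, y ∈ r
  · exact good_bal c hy h0 h2 hy1 hall yb
  push Not at hall
  obtain ⟨a, b, hay, hby, hab, he1⟩ := split3 c.k1 hy
  have ex : ∀ a, a ≠ y → ∃ s ∈ S1, ∃ d d', a ∉ s ∧ s = {y, d, d'} := by
    intro a ha
    have : ¬ ∀ s ∈ S1, a ∈ s := fun h => ha (hcom a h)
    push Not at this
    obtain ⟨s, hs, has⟩ := this
    obtain ⟨d, d', -, -, -, h⟩ := split3 (c.cardE (Or.inr (Or.inl hs))) (hy1 s hs)
    exact ⟨s, hs, d, d', has, h⟩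
  obtain ⟨s, hs, d, d', has, hse⟩ := ex a hay
  obtain ⟨t, ht, f, f', hbt, hte⟩ := ex b hby
  have xS : ∀ s ∈ S1, x ∉ s := fun s hs => disjoint_right.1 (c.d12 _ hs _ c.m2) hx
  have key : ∀ r ∈ R, y ∉ r → r = {x, a, d} ∨ r = {x, a, d'} ∨ r = {x, b, f} ∨ r = {x, b, f'} := by
    intro r hrR hyr
    have hxr : x ∈ r := by have := hr r hrR; tauto
    have hrc : r.card = 3 := c.cardE (by tauto)
    obtain ⟨z, hz, hz'⟩ := not_disjoint_iff.1 (c.R1 _ c.m1 _ hrR)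
    have gen : ∀ a s d d', a ∈ e1 → a ∈ r → s ∈ S1 → a ∉ s → s = {y, d, d'} →
        r = {x, a, d} ∨ r = {x, a, d'} := by
      intro a s d d' ha har hs has hse
      obtain ⟨w, hw, hw'⟩ := not_disjoint_iff.1 (c.R1 _ hs _ hrR)
      have e := eq_triple hrc hxr har hw' (by rintro rfl; exact xS _ c.m1 ha)
        (by rintro rfl; exact xS _ hs hw) (by rintro rfl; exact has hw)
      rw [hse] at hw
      simp only [mem_insert, mem_singleton] at hw
      rcases hw with rfl | rfl | rfl
      · exact (hyr hw').elim
      · exact Or.inl e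
      · exact Or.inr e
    have hz1 := hz
    rw [he1] at hz
    simp only [mem_insert, mem_singleton] at hz
    rcases hz with rfl | rfl | rfl
    · exact (hyr hz').elim
    · have := gen _ s d d' hz1 hz' hs has hse; tauto
    · have := gen _ t f f' hz1 hz' ht hbt hte; tauto
  obtain ⟨r, hrR, hyr⟩ := hall
  have xb : ∀ b ∈ B, x ∈ b := by
    intro b' hb'
    obtain ⟨p', hp', y', hy', x', hx', rfl, -, g, -, g'⟩ := c.btrans hb'
    have hyy := hcom y' g
    subst hyy
    have hxr : x' ∈ r := by have := g' r hrR; tauto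
    have nx : ∀ s ∈ S1, x' ∉ s := fun s hs => disjoint_right.1 (c.d12 _ hs _ c.m2) hx'
    have n1 := nx _ c.m1
    have n2 := nx _ hs
    have n3 := nx _ ht
    rw [he1] at n1
    rw [hse] at n2
    rw [hte] at n3
    simp only [mem_insert, mem_singleton, not_or] at n1 n2 n3
    have : x' = x := by
      rcases key r hrR hyr with h | h | h | h <;> rw [h] at hxr <;>
      simp only [mem_insert, mem_singleton] at hxr <;> tauto
    rw [this]; simp
  refine c.direct hx hy (fun b hb => ⟨xb b hb, yb b hb⟩) h0 h2 hy1
    (X := {{x, a, d}, {x, a, d'}, {x, b, f}, {x, b, f'}}) ?_ ?_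
  · exact card_le_four.trans (by norm_num)
  · intro r hr hyr
    simpa using key r hr hyr

set_option maxHeartbeats 1000000 in
theorem caseD2 (c : Cfg V H S0 S1 S2 R B e0 e1 e2) (hn : 10 ≤ V.card)
    (ih : ∀ v ∈ V, v ∉ e0 → v ∉ e1 → v ∉ e2 → Good (V.erase v) (H.filter (v ∉ ·)) B)
    {y x u : ℕ} (hy : y ∈ e1) (hx : x ∈ e2)
    (hy1 : ∀ s ∈ S1, y ∈ s) (hr : ∀ r ∈ R, y ∈ r ∨ x ∈ r)
    (h0 : S0 ⊆ {e0}) (h2 : S2 ⊆ {e2}) (huy : u ≠ y) (hu1 : ∀ s ∈ S1, u ∈ s)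
    (cov : ∀ v ∈ V, v ∈ e0 ∨ v ∈ e2 ∨ ∃ s ∈ S1, v ∈ s) : Good V H B := by
  obtain ⟨w, hwy', hwu', he1⟩ := cfg_third c.k1 hy (hu1 _ c.m1) huy.symm
  obtain ⟨x1, x2, hx1', hx2', hx12, he2⟩ := split3 c.k2 hx
  have hu : u ∈ e1 := hu1 _ c.m1
  have hw : w ∈ e1 := by simp [he1]
  have mx1 : x1 ∈ e2 := by simp [he2]
  have mx2 : x2 ∈ e2 := by simp [he2]
  obtain ⟨v, hv, hv'⟩ : ∃ v ∈ V, v ∉ e0 ∪ e1 ∪ e2 := by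
    by_contra hcon
    push Not at hcon
    have := card_le_card (show V ⊆ e0 ∪ e1 ∪ e2 from hcon)
    rw [c.card012] at this; omega
  simp only [mem_union, not_or] at hv'
  obtain ⟨⟨v0, v1⟩, v2⟩ := hv'
  have leaf : ∀ v ∈ V, v ∉ e0 → v ∉ e1 → v ∉ e2 → ({y, u, v} : Finset ℕ) ∈ S1 := by
    intro v hv v0 v1 v2
    obtain ⟨s, hs, hvs⟩ : ∃ s ∈ S1, v ∈ s := ((cov v hv).resolve_left v0).resolve_left v2
    have := eq_triple (c.cardE (Or.inr (Or.inl hs))) (hy1 s hs) (hu1 s hs) hvs huy.symm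
      (by rintro rfl; exact v1 hy) (by rintro rfl; exact v1 hu)
    rwa [← this]
  have hs := leaf v hv v0 v1 v2
  have IH := ih v hv v0 v1 v2
  have hvy : v ≠ y := by rintro rfl; exact v1 hy
  have hvu : v ≠ u := by rintro rfl; exact v1 hu
  have hvw : v ≠ w := by rintro rfl; exact v1 hw
  have hvx : v ≠ x := by rintro rfl; exact v2 hx
  have ne12 : ∀ {a b}, a ∈ e1 → b ∈ e2 → a ≠ b := by
    rintro a b ha hb rfl; exact disjoint_left.1 c.e12 ha hb
  have hsub : H.filter (v ∈ ·) ⊆ {{y, u, v}, {v, x, y}, {v, x, u}, {v, x, w}, {v, y, x1},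
      {v, y, x2}} := by
    intro e he
    rw [mem_filter] at he
    rcases (c.hH e).1 he.1 with h | h | h | h | h
    · have := h0 h; rw [mem_singleton] at this; subst this; exact (v0 he.2).elim
    · have := eq_triple (c.cardE (Or.inr (Or.inl h))) (hy1 _ h) (hu1 _ h) he.2 huy.symm hvy.symm
        hvu.symm
      simp [this]
    · have := h2 h; rw [mem_singleton] at this; subst this; exact (v2 he.2).elim
    · have := c.rform v1 v2 he1 he2 hr h he.2
      simp only [mem_insert, mem_singleton]; exact Or.inr this
    · exact ((c.bsub h he.2).elim v0 (fun h => h.elim v1 v2)).elim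
  have c6 := card_le_six (a := ({y, u, v} : Finset ℕ)) (b := ({v, x, y} : Finset ℕ))
    (c := {v, x, u}) (d := {v, x, w}) (e := {v, y, x1}) (f := {v, y, x2})
  have hD := card_le_card hsub
  by_cases n12 : 12 ≤ V.card
  · refine c.step hn hv IH ?_ ?_ <;> omega
  by_cases n11 : 11 ≤ V.card
  · obtain ⟨v3, hv3, hv3'⟩ : ∃ v3 ∈ V, v3 ∉ insert v (e0 ∪ e1 ∪ e2) := by
      by_contra hcon
      push Not at hcon
      have := card_le_card (show V ⊆ insert v (e0 ∪ e1 ∪ e2) from hcon)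
      have := card_insert_le v (e0 ∪ e1 ∪ e2)
      rw [c.card012] at this; omega
    simp only [mem_insert, mem_union, not_or] at hv3'
    obtain ⟨g, ⟨g0, g1⟩, g2⟩ := hv3'
    have hs3 := leaf v3 hv3 g0 g1 g2
    have hsub' : H.filter (v ∈ ·) ⊆ {{y, u, v}, {v, x, y}, {v, x, u}, {v, y, x1}, {v, y, x2}} := by
      intro e he
      have := hsub he
      simp only [mem_insert, mem_singleton] at this
      rcases this with h | h | h | h | h | h
      · simp [h]
      · simp [h]
      · simp [h]
      · exfalso
        rw [mem_filter] at he
        have := c.inR v0 v1 v2 he.1 he.2 (not_disjoint_iff.2 ⟨w, hw, by simp [h]⟩)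
          (not_disjoint_iff.2 ⟨x, hx, by simp [h]⟩)
        apply c.R1 _ hs3 _ this
        rw [h]
        have q1 := ne12 hy hx
        have q2 := ne12 hu hx
        have q3 : v3 ≠ x := by rintro rfl; exact g2 hx
        have q4 : v3 ≠ w := by rintro rfl; exact g1 hw
        rw [disjoint_left]
        intro z hz hz'
        simp only [mem_insert, mem_singleton] at hz hz'
        rcases hz with h | h | h <;> rcases hz' with h' | h' | h'
        · exact hvy (h'.symm.trans h)
        · exact q1 (h.symm.trans h')
        · exact hwy' (h'.symm.trans h)
        · exact hvu (h'.symm.trans h)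
        · exact q2 (h.symm.trans h')
        · exact hwu' (h'.symm.trans h)
        · exact g (h.symm.trans h')
        · exact q3 (h.symm.trans h')
        · exact q4 (h.symm.trans h')
      · simp [h]
      · simp [h]
    have := (card_le_card hsub').trans card_le_five
    refine c.step hn hv IH ?_ ?_ <;> omega
  have nV : V.card = 10 := by omega
  by_cases hD5 : (H.filter (v ∈ ·)).card ≤ 4
  · refine c.step hn hv IH ?_ ?_ <;> omega
  have hc6 := hD5
  have inr : ∀ a ∈ e1, ∀ a' ∈ e2, ({v, a, a'} : Finset ℕ) ∈ H.filter (v ∈ ·) →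
      ({v, a, a'} : Finset ℕ) ∈ R := by
    intro a ha a' ha' h
    exact c.inR v0 v1 v2 (mem_filter.1 h).1 (by simp) (not_disjoint_iff.2 ⟨a, ha, by simp⟩)
      (not_disjoint_iff.2 ⟨a', ha', by simp⟩)
  have inr' : ∀ a ∈ e1, ∀ a' ∈ e2, ({v, a', a} : Finset ℕ) ∈ H.filter (v ∈ ·) →
      ({v, a', a} : Finset ℕ) ∈ R := by
    intro a ha a' ha' h
    rw [pair_comm a' a] at h ⊢; exact inr a ha a' ha' h
  have neq : ∀ a b d : ℕ, v ≠ d → a ≠ d → b ≠ d → ({v, a, b} : Finset ℕ) ≠ {v, a, d} := by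
    intro a b d q1 q2 q3 h
    have : d ∈ ({v, a, b} : Finset ℕ) := by rw [h]; simp
    simp only [mem_insert, mem_singleton] at this
    rcases this with h | h | h
    · exact q1 h.symm
    · exact q2 h.symm
    · exact q3 h.symm
  have xb : ∀ b ∈ B, x ∈ b := by
    have p1 := onein hsub (by omega) (f := {v, x, y}) (g := {v, x, u}) (by simp) (by simp)
      (neq _ _ _ hvu (ne12 hu hx).symm huy.symm)
    have p2 := onein hsub (by omega) (f := {v, x, y}) (g := {v, x, w}) (by simp) (by simp)
      (neq _ _ _ hvw (ne12 hw hx).symm hwy'.symm)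
    have p3 := onein hsub (by omega) (f := {v, x, u}) (g := {v, x, w}) (by simp) (by simp)
      (neq _ _ _ hvw (ne12 hw hx).symm hwu'.symm)
    have fo : ∀ a ∈ e1, ∀ a' ∈ e1, a ≠ a' → ({v, x, a} : Finset ℕ) ∈ H.filter (v ∈ ·) →
        ({v, x, a'} : Finset ℕ) ∈ H.filter (v ∈ ·) → ∀ b ∈ B, x ∈ b := by
      intro a ha a' ha' haa h h'
      exact c.force (inr' a ha x hx h) (inr' a' ha' x hx h') v1 v2 (disjoint_left.1 c.e12 ha)
        (disjoint_left.1 c.e12 ha') haa hx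
    rcases p1 with h | h
    · rcases p3 with h' | h'
      · exact fo y hy u hu huy.symm h h'
      · exact fo y hy w hw hwy'.symm h h'
    · rcases p2 with h' | h'
      · exact fo u hu y hy huy h h'
      · exact fo u hu w hw hwu'.symm h h'
  have yb : ∀ b ∈ B, y ∈ b := by
    have p1 := onein hsub (by omega) (f := {v, y, x1}) (g := {v, y, x2}) (by simp) (by simp)
      (neq _ _ _ (by rintro rfl; exact v2 mx2) (ne12 hy mx2) hx12)
    have fo : ∀ a ∈ e2, a ≠ x → ({v, y, a} : Finset ℕ) ∈ H.filter (v ∈ ·) → ∀ b ∈ B, y ∈ b := by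
      intro a ha hax h b hb
      have hR := inr y hy a ha h
      obtain ⟨p', hp', y', hy', x', hx', rfl, -, -, -, g'⟩ := c.btrans hb
      have hxx := xb _ hb
      have q0 : x ≠ p' := by rintro rfl; exact disjoint_left.1 c.e02 hp' hx
      have q1 := ne12 hy' hx
      have q2 := g' _ hR
      have q3 := ne12 hy' ha
      have q4 := ne12 hy hx'
      have q5 : x' ≠ v := by rintro rfl; exact v2 hx'
      have q6 : y' ≠ v := by rintro rfl; exact v1 hy'
      simp only [mem_insert, mem_singleton] at hxx q2 ⊢
      have hxe : x = x' := by
        rcases hxx with h | h | h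
        · exact (q0 h).elim
        · exact (q1 h.symm).elim
        · exact h
      rcases q2 with (h | h | h) | h | h | h
      · exact (q6 h).elim
      · exact Or.inr (Or.inl h.symm)
      · exact (q3 h).elim
      · exact (q5 h).elim
      · exact (q4 h.symm).elim
      · exact (hax (h.symm.trans hxe.symm)).elim
    rcases p1 with h | h
    · exact fo _ mx1 hx1' h
    · exact fo _ mx2 hx2' h
  refine c.direct hx hy (fun b hb => ⟨xb b hb, yb b hb⟩) h0 h2 hy1
    (X := {{x, u, v}, {x, u, w}, {x, u, x1}, {x, u, x2}, {x, w, v}}) card_le_five ?_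
  intro r hrR hyr
  have hxr : x ∈ r := (hr r hrR).resolve_left hyr
  have hrc : r.card = 3 := c.cardE (Or.inr (Or.inr (Or.inr (Or.inl hrR))))
  by_cases hur : u ∈ r
  · obtain ⟨z, hz1, hz2, rfl⟩ := cfg_third hrc hxr hur (ne12 hu hx).symm
    have hzV : z ∈ V := c.subE (Or.inr (Or.inr (Or.inr (Or.inl hrR)))) (by simp)
    have hVe : insert v (e0 ∪ e1 ∪ e2) = V := by
      apply eq_of_subset_of_card_le
      · exact insert_subset hv (union_subset (union_subset c.s0 c.s1) c.s2)
      · rw [card_insert_of_notMem (by simp only [mem_union]; exact fun h => h.elim (fun h => h.elim v0 v1) v2), c.card012, nV]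
    rw [← hVe, he1, he2] at hzV
    have hz0 : z ∉ e0 := disjoint_right.1 (c.dR _ c.m0 _ hrR) (by simp)
    have hzy : z ≠ y := by rintro rfl; simp at hyr
    simp only [mem_insert, mem_union, mem_singleton] at hzV ⊢
    rcases hzV with h | (h | h | h | h) | h | h | h
    · simp [h]
    · exact (hz0 h).elim
    · exact (hzy h).elim
    · exact (hz2 h).elim
    · simp [h]
    · exact (hz1 h).elim
    · simp [h]
    · simp [h]
  · obtain ⟨z, hz, hz'⟩ := not_disjoint_iff.1 (c.R1 _ c.m1 _ hrR)
    obtain ⟨z2, hz2, hz2'⟩ := not_disjoint_iff.1 (c.R1 _ hs _ hrR)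
    rw [he1] at hz
    simp only [mem_insert, mem_singleton] at hz hz2
    have hwr : w ∈ r := by
      rcases hz with h | h | h
      · exact (hyr (h ▸ hz')).elim
      · exact (hur (h ▸ hz')).elim
      · exact h ▸ hz'
    have hvr : v ∈ r := by
      rcases hz2 with h | h | h
      · exact (hyr (h ▸ hz2')).elim
      · exact (hur (h ▸ hz2')).elim
      · exact h ▸ hz2'
    have := eq_triple hrc hxr hwr hvr (ne12 hw hx).symm hvx.symm hvw.symm
    simp [this]

theorem caseD (c : Cfg V H S0 S1 S2 R B e0 e1 e2) (hn : 10 ≤ V.card)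
    (ih : ∀ v ∈ V, v ∉ e0 → v ∉ e1 → v ∉ e2 → Good (V.erase v) (H.filter (v ∉ ·)) B)
    (h0 : S0 ⊆ {e0}) (h2 : S2 ⊆ {e2})
    (cov : ∀ v ∈ V, v ∈ e0 ∨ v ∈ e2 ∨ ∃ s ∈ S1, v ∈ s) : Good V H B := by
  obtain ⟨b, hb⟩ := c.hB
  obtain ⟨p, hp, y, hy, x, hx, -, -, hy1, -, hr⟩ := c.btrans hb
  by_cases h : ∀ z, (∀ s ∈ S1, z ∈ s) → z = y
  · exact c.caseD1 hy hx hy1 hr h0 h2 h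
  · push Not at h
    obtain ⟨u, hu, huy⟩ := h
    exact c.caseD2 hn ih hy hx hy1 hr h0 h2 huy hu cov

end Cfg

theorem good_main (n : ℕ) (hn : 9 ≤ n) : ∀ (V : Finset ℕ) (H S0 S1 S2 R B : Finset (Finset ℕ))
    (e0 e1 e2 : Finset ℕ), V.card = n → Cfg V H S0 S1 S2 R B e0 e1 e2 → Good V H B := by
  induction n, hn using Nat.le_induction with
  | base => intro V H S0 S1 S2 R B e0 e1 e2 hV c; exact good_nine c hV
  | succ n hn ih =>
    intro V H S0 S1 S2 R B e0 e1 e2 hV c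
    have hn' : 10 ≤ V.card := by omega
    have IH : ∀ v ∈ V, v ∉ e0 → v ∉ e1 → v ∉ e2 → Good (V.erase v) (H.filter (v ∉ ·)) B := by
      intro v hv h0 h1 h2
      exact ih _ _ _ _ _ _ _ _ _ _ (by rw [card_erase_of_mem hv]; omega) (c.del h0 h1 h2)
    have sing : ∀ {S : Finset (Finset ℕ)} {e : Finset ℕ}, e.card = 3 → (∀ s ∈ S, s.card = 3) →
        (∀ s ∈ S, ∀ v ∈ s, v ∈ e) → S ⊆ {e} := by
      intro S e he hS h s hs
      rw [mem_singleton]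
      exact eq_of_subset_of_card_le (h s hs) (by rw [he, hS s hs])
    by_cases hB : ∃ s ∈ S0, ∃ v ∈ s, v ∉ e0
    · obtain ⟨s, hs, v, hvs, hv⟩ := hB
      have hvV := c.subE (Or.inl hs) hvs
      exact c.caseB hn' hvV (IH v hvV hv (disjoint_left.1 (c.d01 _ hs _ c.m1) hvs)
        (disjoint_left.1 (c.d02 _ hs _ c.m2) hvs)) hv hs hvs
    push Not at hB
    have h0 := sing c.k0 (fun s hs => c.cardE (Or.inl hs)) hB
    by_cases hA : ∃ v ∈ V, v ∉ e0 ∧ (∀ s ∈ S1, v ∉ s) ∧ ∀ s ∈ S2, v ∉ s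
    · obtain ⟨v, hv, g0, g1, g2⟩ := hA
      have q1 := g1 _ c.m1
      have q2 := g2 _ c.m2
      exact c.caseA hn' hv (IH v hv g0 q1 q2) g0 q1 q2 (fun s hs hvs => g0 (hB s hs v hvs)) g1 g2
    push Not at hA
    by_cases h2 : ∀ s ∈ S2, ∀ v ∈ s, v ∈ e2
    · refine c.caseD hn' IH h0 (sing c.k2 (fun s hs => c.cardE (by tauto)) h2) ?_
      intro v hv
      by_contra hcon
      push Not at hcon
      obtain ⟨s, hs, hvs⟩ := hA v hv hcon.1 hcon.2.2
      exact hcon.2.1 (h2 s hs v hvs)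
    by_cases h1 : ∀ s ∈ S1, ∀ v ∈ s, v ∈ e1
    · refine c.swap.caseD hn' (fun v hv a b d => IH v hv a d b) h0
        (sing c.k1 (fun s hs => c.cardE (by tauto)) h1) ?_
      intro v hv
      by_contra hcon
      push Not at hcon
      obtain ⟨s, hs, hvs⟩ := hA v hv hcon.1 (fun s hs hvs => hcon.2.1 (h1 s hs v hvs))
      exact hcon.2.2 s hs hvs
    push Not at h1 h2
    obtain ⟨s, hs, v, hvs, hv⟩ := h1
    obtain ⟨t, ht, w, hwt, hw⟩ := h2
    have hvV := c.subE (Or.inr (Or.inl hs)) hvs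
    exact c.caseC hn' hvV (IH v hvV (disjoint_right.1 (c.d01 _ c.m0 _ hs) hvs) hv
      (disjoint_left.1 (c.d12 _ hs _ c.m2) hvs)) hv hs hvs ht (by rintro rfl; exact hw hwt)

theorem lemma_M3 (n : ℕ) (hn : 9 ≤ n)
    (V : Finset ℕ) (H : Finset (Finset ℕ)) (hV : V.card = n)
    (hH : ThreeGraphOn V H) (hconn : ConnectedHG V H) (hfree : P4Free H)
    (hM3 : HasM3 H) :
    H.card ≤ (n - 4).choose 2 + 11 ∧
      (H.card = (n - 4).choose 2 + 11 ↔ IsBOn V H) := by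
  obtain ⟨S0, S1, S2, R, B, e0, e1, e2, c⟩ := mkcfg hH hconn hfree hM3
  have h := good_main n hn _ _ _ _ _ _ _ _ _ _ hV c
  unfold Good at h
  rw [hV] at h
  refine ⟨by omega, fun h' => ?_, fun h' => ?_⟩
  · rcases h with h | h
    · omega
    · exact h.2.1
  · rw [card_isB h', hV]
end

section
/- Let H be a connected 3-graph on n ≥ 8 vertices that is 𝒫₄-free, contains no three pairwise disjoint edges, and contains a copy of the minimal 4-cycle C₄. Then |H| ≤ 5n − 18. Moreover, for n ≥ 9 equality holds if and only if H is isomorphic to SPₙ, while for n = 8 equality holds if and only if H is isomorphic to SP₈ or to SK₈. -/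
open Finset

/-- `H` is the `P`-star `SPₙ` on `V`: a minimal 2-path `f₁, f₂` (two 3-edges
sharing exactly one vertex) together with all triples of `V` containing a
vertex `v` outside the path and at least one vertex of the path. -/
def IsSPOn (V : Finset ℕ) (H : Finset (Finset ℕ)) : Prop :=
  ∃ v ∈ V, ∃ f₁ f₂ : Finset ℕ, f₁ ⊆ V ∧ f₂ ⊆ V ∧ f₁.card = 3 ∧ f₂.card = 3 ∧
    (f₁ ∩ f₂).card = 1 ∧ v ∉ f₁ ∪ f₂ ∧
    H = {f₁, f₂} ∪
      (V.powersetCard 3).filter (fun t => v ∈ t ∧ (t ∩ (f₁ ∪ f₂)).Nonempty)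

/-- `H` is (isomorphic to) a sub-3-graph of `SPₙ` on `V`. -/
def SubSP (V : Finset ℕ) (H : Finset (Finset ℕ)) : Prop :=
  ∃ H' : Finset (Finset ℕ), IsSPOn V H' ∧ H ⊆ H'

/-- `H` is the `K`-star `SKₙ` on `V`: a complete 3-graph on a 4-set `A`
together with all triples of `V` containing a vertex `v ∉ A` and at least one
vertex of `A`. -/
def IsSKOn (V : Finset ℕ) (H : Finset (Finset ℕ)) : Prop :=
  ∃ v ∈ V, ∃ A : Finset ℕ, A ⊆ V ∧ A.card = 4 ∧ v ∉ A ∧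
    H = A.powersetCard 3 ∪
      (V.powersetCard 3).filter (fun t => v ∈ t ∧ (t ∩ A).Nonempty)


def pathsQ : List (ℕ × ℕ × ℕ × ℕ) := [
  (13,69,82,50), (13,69,98,50), (13,73,82,50), (13,73,98,50), (13,133,146,50),
  (13,133,162,50), (13,137,146,50), (13,137,162,50), (14,70,81,49), (14,70,97,49),
  (14,74,81,49), (14,74,97,49), (14,134,145,49), (14,134,161,49), (14,138,145,49),
  (14,138,161,49), (69,13,138,50), (69,13,152,50), (69,13,168,50), (70,14,152,49),
  (70,14,168,49), (73,13,134,50), (73,13,148,50), (73,13,164,50), (74,14,148,49),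
  (74,14,164,49), (81,49,164,14), (81,49,168,14), (82,50,164,13), (82,50,168,13),
  (97,13,14,146), (97,49,148,14), (97,49,152,14), (98,14,13,145), (98,50,148,13),
  (98,50,152,13), (133,13,74,50), (133,13,88,50), (133,13,104,50), (134,14,88,49),
  (134,14,104,49), (137,13,70,50), (137,13,84,50), (137,13,100,50), (138,14,84,49),
  (138,14,100,49), (145,49,100,14), (145,49,104,14), (146,50,100,13), (146,50,104,13),
  (161,13,14,82), (161,49,84,14), (161,49,88,14), (162,14,13,81), (162,50,84,13),
  (162,50,88,13)]

def pathsP : List (ℕ × ℕ × ℕ × ℕ) := [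
  (138,14,84,49), (137,13,38,50), (13,73,82,50), (134,14,56,49), (82,50,168,13),
  (145,49,38,14), (162,50,84,13), (70,14,168,49), (74,14,164,49), (73,13,38,50),
  (69,13,168,50), (97,49,152,14), (73,13,52,50), (82,50,37,13), (133,13,88,50),
  (146,50,104,13), (13,73,98,50), (70,14,41,49), (70,14,25,49), (134,14,104,49),
  (98,50,25,13), (98,50,28,13), (137,13,84,50), (137,13,22,50), (137,13,52,50),
  (74,14,52,49), (82,50,164,13), (81,49,38,14), (81,49,164,14), (145,49,100,14),
  (14,134,145,49), (133,13,26,50), (138,14,52,49), (74,14,148,49), (162,50,88,13),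
  (162,50,25,13), (134,14,41,49), (73,13,164,50), (81,49,168,14), (146,50,41,13),
  (82,50,44,13), (146,50,37,13), (161,13,14,82), (162,50,21,13), (98,50,148,13),
  (73,13,22,50), (97,49,22,14), (97,13,14,146), (138,14,21,49), (97,49,148,14),
  (133,13,42,50), (73,13,148,50), (81,49,42,14), (69,13,42,50), (81,49,44,14),
  (146,50,44,13), (138,14,37,49), (145,49,44,14), (145,49,104,14), (97,49,26,14),
  (69,13,152,50), (161,49,22,14), (161,49,88,14), (133,13,56,50), (98,50,152,13),
  (14,74,97,49), (70,14,152,49), (74,14,37,49), (134,14,88,49), (69,13,56,50),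
  (134,14,25,49), (133,13,104,50), (161,49,84,14), (146,50,100,13), (161,49,26,14),
  (138,14,100,49), (161,49,28,14), (82,50,41,13), (97,49,28,14), (162,50,28,13),
  (70,14,56,49), (137,13,100,50), (13,69,82,50), (98,50,21,13), (137,13,70,50)]

def pathsB : List (ℕ × ℕ × ℕ × ℕ) := [
  (67,35,56,152), (131,168,44,84), (19,148,164,104), (19,25,44,164), (44,164,131,67),
  (35,7,148,152), (35,131,148,88), (19,84,44,168), (100,38,26,152), (38,67,88,152),
  (19,11,168,100), (19,11,104,164), (131,148,28,104), (164,37,19,88), (7,164,168,88),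
  (84,7,35,168), (7,164,152,88), (19,11,168,164), (7,164,104,88), (148,22,42,104),
  (67,35,44,148), (67,11,44,164), (131,19,88,104), (21,84,104,42), (7,131,152,104),
  (52,44,11,131), (7,19,56,168), (11,168,148,84), (25,88,100,38), (7,67,88,168),
  (67,35,164,152), (19,26,44,164), (11,35,100,148), (44,84,67,131), (131,168,88,84),
  (7,19,152,168), (35,67,84,148), (19,22,44,104), (7,67,88,56), (11,35,100,84),
  (7,19,152,104), (25,19,38,100), (19,67,100,164), (11,67,84,164), (7,148,152,104),
  (35,11,88,84), (37,164,152,26), (67,35,168,152), (35,7,148,88), (148,21,41,104),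
  (67,7,164,168), (67,104,164,148), (148,7,35,104), (25,67,38,164), (35,164,152,88),
  (21,67,104,168), (42,11,21,84), (164,131,25,88), (67,7,44,168), (131,7,100,104),
  (37,38,26,88), (7,35,168,88), (67,88,148,164), (11,131,164,100), (35,67,84,28),
  (35,67,88,152), (84,19,41,168), (11,25,84,164), (11,19,148,100), (25,152,164,38),
  (37,67,88,152), (35,67,88,28), (19,67,104,44), (11,131,148,84), (11,25,52,164),
  (131,164,100,88), (19,67,100,168), (11,35,164,148), (19,131,168,104), (131,152,52,100),
  (164,38,26,88), (28,104,67,131), (19,88,168,164), (11,67,84,52), (11,88,52,164),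
  (11,19,52,164), (67,88,44,164), (44,100,67,131), (67,11,28,148), (37,164,152,88),
  (131,26,88,100), (7,131,152,88), (11,67,100,52), (35,131,152,84), (131,7,100,88),
  (7,131,168,104), (67,88,152,164), (35,38,148,152), (84,21,11,168), (131,7,84,104),
  (131,25,84,100), (67,35,44,152), (41,168,148,22), (19,21,44,104), (28,152,131,67),
  (35,168,148,84), (19,148,168,104), (67,100,56,152), (11,168,100,84), (52,148,131,67),
  (25,26,38,100), (131,7,84,88), (38,7,25,152), (35,131,152,88), (35,11,152,148),
  (11,104,100,148), (19,131,164,100), (35,38,28,152), (7,35,104,152), (11,35,164,84),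
  (56,168,131,67), (7,67,104,56), (67,104,52,148), (7,22,152,168), (41,35,22,84),
  (67,7,148,168), (35,67,88,148), (19,25,104,100), (41,11,22,148), (56,148,7,67),
  (7,22,56,168), (67,84,164,168), (67,35,164,148), (37,100,88,26), (19,11,104,100),
  (7,100,168,152), (100,37,11,152), (67,84,56,168), (35,131,148,84), (35,164,84,88),
  (41,104,84,22), (11,19,148,164), (35,104,152,148), (19,152,44,100), (67,19,52,164),
  (35,100,28,152), (25,19,38,164), (21,148,168,42)]

def ordL : List ℕ := [88, 152, 164, 148, 104, 100, 168, 82, 84, 67, 38, 25, 73, 22, 146, 131, 52, 97, 70, 137, 134, 98, 161, 145, 162, 41, 44, 138, 133, 74, 69, 42, 81, 56, 26, 28, 37, 21, 11, 19, 7, 35]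

def solL : List ℕ := [2923048063988069438170143321714666962724757989504,
  5846096125253879940972778935574761424521473321088,
  23384383041884730406906984332249089878857005686912,
  6199607165191513233683011057727361453132376192,
  406297455177991011282649812674092243590033923139712,
  374150128670155686510511749315985412464561965524992]

def ordL2 : List ℕ := [162, 98, 146, 82, 138, 74, 134, 70, 161, 97, 145, 81, 137, 73, 133, 69, 168, 104, 152, 88, 164, 100, 148, 84, 131, 67]

noncomputable def force {α : Type} (x : ℕ) (k : ℕ → α) : α :=
  Nat.rec (k 0) (fun n _ => k n) (Nat.succ x)

noncomputable def bi (b t e : Bool) : Bool := Bool.rec e t b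

/-- greedy packing of disjoint clauses inside `R`, consuming the budget `b` -/
noncomputable def packK (L : List ℕ) : ℕ → ℕ → (ℕ → ℕ → Bool) → Bool :=
  List.rec (motive := fun _ => ℕ → ℕ → (ℕ → ℕ → Bool) → Bool)
    (fun R b k => k R b)
    (fun c _ ih R b k => bi (Nat.beq (Nat.land c R) c)
      (Nat.rec (motive := fun _ => Bool) true
        (fun b' _ => force (Nat.xor R c) fun R' => ih R' b' k) b)
      (ih R b k)) L

/-- keep the clauses not containing `v` -/
noncomputable def filtK (v : ℕ) (L : List ℕ) : List ℕ → (List ℕ → Bool) → Bool :=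
  List.rec (motive := fun _ => List ℕ → (List ℕ → Bool) → Bool)
    (fun A k => k A)
    (fun c _ ih A k => bi (Nat.beq (Nat.land c v) 0) (ih (c :: A) k) (ih A k)) L

/-- is `v` one of the unit clauses -/
noncomputable def memK (v : ℕ) (L : List ℕ) : Bool :=
  List.rec (motive := fun _ => Bool) false (fun c _ ih => bi (Nat.beq c v) true ih) L

/-- assume `v` in the clauses of size two -/
noncomputable def pairK (v : ℕ) (L : List ℕ) :
    List ℕ → List ℕ → (List ℕ → List ℕ → Bool) → Bool :=
  List.rec (motive := fun _ => List ℕ → List ℕ → (List ℕ → List ℕ → Bool) → Bool)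
    (fun A B k => k A B)
    (fun c _ ih A B k => bi (Nat.beq (Nat.land c v) 0) (ih A (c :: B) k)
      (force (Nat.xor c v) fun c' => ih (c' :: A) B k)) L

/-- assume `v` in the large clauses -/
noncomputable def bigK (v : ℕ) (L : List ℕ) :
    List ℕ → List ℕ → (List ℕ → List ℕ → Bool) → Bool :=
  List.rec (motive := fun _ => List ℕ → List ℕ → (List ℕ → List ℕ → Bool) → Bool)
    (fun A B k => k A B)
    (fun c _ ih A B k => bi (Nat.beq (Nat.land c v) 0) (ih A (c :: B) k)
      (force (Nat.xor c v) fun c' => force (Nat.land c' (Nat.sub c' 1)) fun d =>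
        bi (Nat.beq (Nat.land d (Nat.sub d 1)) 0) (ih (c' :: A) B k) (ih A (c' :: B) k))) L

noncomputable def search (Wm Um : ℕ) (sols : List ℕ) (vs : List ℕ) :
    List ℕ → List ℕ → List ℕ → ℕ → ℕ → ℕ → Bool :=
  List.rec (motive := fun _ => List ℕ → List ℕ → List ℕ → ℕ → ℕ → ℕ → Bool)
    (fun _ _ _ R _ T =>
      bi (Nat.beq (Nat.land (Nat.lor T R) Wm) 0) true <|
      bi (Nat.beq (Nat.land (Nat.lor T R) Um) 0) true <|
      bi (Nat.beq R 0) (memK T sols) false)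
    (fun v _ ih U P B R b T =>
      bi (Nat.beq (Nat.land (Nat.lor T R) Wm) 0) true <|
      bi (Nat.beq (Nat.land (Nat.lor T R) Um) 0) true <|
      packK U R b fun R1 b1 => packK P R1 b1 fun _ _ =>
      force (Nat.pow 2 v) fun v2 =>
      bi (Nat.beq (Nat.land R v2) v2) (bi (Nat.ble 256 v) false <|
        force (Nat.xor R v2) fun R' =>
        bi (bi (memK v2 U) true
            (pairK v2 P U [] fun U' P' => bigK v2 B P' [] fun P'' B' =>
              force (Nat.lor T v2) fun T' => ih U' P'' B' R' b T'))
          (Nat.rec (motive := fun _ => Bool) true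
            (fun b' _ => filtK v2 U [] fun U' => filtK v2 P [] fun P' => filtK v2 B [] fun B' =>
              ih U' P' B' R' b' T) b)
          false)
        false) vs

def maskL : List ℕ → ℕ
  | [] => 0
  | t :: ts => Nat.lor (2 ^ t) (maskL ts)

def pop8 (t : ℕ) : ℕ := ((Finset.range 8).filter (fun i => t.testBit i = true)).card

def triL : List ℕ := (List.range 256).filter (fun t => pop8 t == 3)

def R0 : ℕ := maskL ordL
def c4L : List ℕ := [13, 14, 50, 49]
def T0 : ℕ := maskL c4L
def W0 : ℕ := maskL (triL.filter (fun t => t.testBit 6))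
def U0 : ℕ := maskL (triL.filter (fun t => t.testBit 7))
def R2 : ℕ := maskL ordL2

def clM (L : List (ℕ × ℕ × ℕ × ℕ)) : List ℕ :=
  L.map fun q => Nat.land (maskL [q.1, q.2.1, q.2.2.1, q.2.2.2]) R0

/-- evaluate a list of numbers completely before going on -/
noncomputable def forceL (L : List ℕ) : List ℕ → (List ℕ → Bool) → Bool :=
  List.rec (motive := fun _ => List ℕ → (List ℕ → Bool) → Bool)
    (fun A k => k A)
    (fun c _ ih A k => force c fun c' => ih (c' :: A) k) L

noncomputable def start (W U : ℕ) (sols vs P B : List ℕ) (R b T : ℕ) : Bool :=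
  force W fun W => force U fun U => force R fun R => force T fun T =>
  forceL P [] fun P => forceL B [] fun B => search W U sols vs [] P B R b T

theorem force_eq {α : Type} (x : ℕ) (k : ℕ → α) : force x k = k x := rfl

theorem bi_true {b t e : Bool} : bi b t e = true ↔ (b = true ∧ t = true) ∨ (b = false ∧ e = true) := by
  cases b <;> simp [bi]

theorem tb_land (a b i : ℕ) : (Nat.land a b).testBit i = (a.testBit i && b.testBit i) :=
  Nat.testBit_and a b i
theorem tb_lor (a b i : ℕ) : (Nat.lor a b).testBit i = (a.testBit i || b.testBit i) :=
  Nat.testBit_or a b i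
theorem tb_xor (a b i : ℕ) : (Nat.xor a b).testBit i = (a.testBit i ^^ b.testBit i) :=
  Nat.testBit_xor a b i
theorem tb_pow (v i : ℕ) : (Nat.pow 2 v).testBit i = decide (v = i) :=
  Nat.testBit_two_pow

/-- the clause `c` is respected by `h` -/
def CO (h : ℕ → Prop) (c : ℕ) : Prop := ∃ i < 256, c.testBit i = true ∧ ¬ h i

open Classical in
noncomputable def fal (h : ℕ → Prop) (R : ℕ) : ℕ :=
  ((range 256).filter (fun i => R.testBit i = true ∧ ¬ h i)).card

theorem fal_xor {h : ℕ → Prop} {c R : ℕ} (hc : CO h c) (hs : Nat.land c R = c) :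
    fal h (Nat.xor R c) + 1 ≤ fal h R := by
  classical
  obtain ⟨i, hi, hci, hhi⟩ := hc
  have sub : ∀ j, c.testBit j = true → R.testBit j = true := by
    intro j hj
    have := tb_land c R j
    rw [hs, hj] at this
    simpa using this.symm
  unfold fal
  apply Nat.succ_le_of_lt
  apply Finset.card_lt_card
  rw [Finset.ssubset_iff_of_subset]
  · refine ⟨i, ?_, ?_⟩
    · simp only [mem_filter, mem_range]
      exact ⟨hi, sub i hci, hhi⟩
    · simp only [mem_filter, tb_xor, hci, sub i hci]; simp
  · intro j
    simp only [mem_filter, mem_range, tb_xor]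
    rintro ⟨h1, h2, h3⟩
    refine ⟨h1, ?_, h3⟩
    cases hcj : c.testBit j
    · simpa [hcj] using h2
    · exact sub j hcj

theorem packK_sound {h : ℕ → Prop} (L : List ℕ) : ∀ (R b : ℕ) (k : ℕ → ℕ → Bool),
    packK L R b k = true → (∀ c ∈ L, CO h c) → fal h R ≤ b → ∃ R' b', k R' b' = true ∧ fal h R' ≤ b' := by
  induction L with
  | nil => intro R b k hk _ hf; exact ⟨R, b, hk, hf⟩
  | cons c cs ih =>
    intro R b k hk hL hf
    have hk' : bi (Nat.beq (Nat.land c R) c)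
      (Nat.rec (motive := fun _ => Bool) true
        (fun b' _ => packK cs (Nat.xor R c) b' k) b)
      (packK cs R b k) = true := hk
    rw [bi_true] at hk'
    have hcs : ∀ c ∈ cs, CO h c := fun d hd => hL d (List.mem_cons_of_mem _ hd)
    rcases hk' with ⟨h1, h2⟩ | ⟨_, h2⟩
    · have := fal_xor (hL c List.mem_cons_self) (Nat.eq_of_beq_eq_true h1)
      cases b with
      | zero => omega
      | succ b => exact ih _ _ _ h2 hcs (by omega)
    · exact ih _ _ _ h2 hcs hf

theorem filtK_sound {h : ℕ → Prop} (v : ℕ) (L : List ℕ) : ∀ (A : List ℕ) (k : List ℕ → Bool),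
    filtK v L A k = true → (∀ c ∈ L, CO h c) → (∀ c ∈ A, CO h c) →
      ∃ A', (∀ c ∈ A', CO h c) ∧ k A' = true := by
  induction L with
  | nil => intro A k hk _ hA; exact ⟨A, hA, hk⟩
  | cons c cs ih =>
    intro A k hk hL hA
    have hk' : bi (Nat.beq (Nat.land c v) 0) (filtK v cs (c :: A) k) (filtK v cs A k) = true := hk
    rw [bi_true] at hk'
    have hcs : ∀ c ∈ cs, CO h c := fun d hd => hL d (List.mem_cons_of_mem _ hd)
    rcases hk' with ⟨h1, h2⟩ | ⟨_, h2⟩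
    · exact ih _ _ h2 hcs (by simpa using ⟨hL c List.mem_cons_self, hA⟩)
    · exact ih _ _ h2 hcs hA

theorem memK_sound (v : ℕ) (L : List ℕ) : memK v L = true → v ∈ L := by
  induction L with
  | nil => intro hk; cases hk
  | cons c cs ih =>
    intro hk
    have hk' : bi (Nat.beq c v) true (memK v cs) = true := hk
    rw [bi_true] at hk'
    rcases hk' with ⟨h1, _⟩ | ⟨_, h2⟩
    · rw [Nat.eq_of_beq_eq_true h1]; exact List.mem_cons_self
    · exact List.mem_cons_of_mem _ (ih h2)

theorem CO_xor {h : ℕ → Prop} {v c : ℕ} (hv : h v) (hc : CO h c) : CO h (Nat.xor c (Nat.pow 2 v)) := by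
  obtain ⟨i, hi, hci, hhi⟩ := hc
  refine ⟨i, hi, ?_, hhi⟩
  have : v ≠ i := by rintro rfl; exact hhi hv
  rw [tb_xor, tb_pow, hci]; simp [this]

theorem pairK_sound {h : ℕ → Prop} (v : ℕ) (hv : h v) (L : List ℕ) :
    ∀ (A B : List ℕ) (k : List ℕ → List ℕ → Bool),
    pairK (Nat.pow 2 v) L A B k = true → (∀ c ∈ L, CO h c) → (∀ c ∈ A, CO h c) → (∀ c ∈ B, CO h c) →
      ∃ A' B', (∀ c ∈ A', CO h c) ∧ (∀ c ∈ B', CO h c) ∧ k A' B' = true := by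
  induction L with
  | nil => intro A B k hk _ hA hB; exact ⟨A, B, hA, hB, hk⟩
  | cons c cs ih =>
    intro A B k hk hL hA hB
    have hk' : bi (Nat.beq (Nat.land c (Nat.pow 2 v)) 0) (pairK (Nat.pow 2 v) cs A (c :: B) k)
      (pairK (Nat.pow 2 v) cs (Nat.xor c (Nat.pow 2 v) :: A) B k) = true := hk
    rw [bi_true] at hk'
    have hcs : ∀ c ∈ cs, CO h c := fun d hd => hL d (List.mem_cons_of_mem _ hd)
    have hc := hL c List.mem_cons_self
    rcases hk' with ⟨h1, h2⟩ | ⟨_, h2⟩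
    · exact ih _ _ _ h2 hcs hA (by simpa using ⟨hc, hB⟩)
    · exact ih _ _ _ h2 hcs (List.forall_mem_cons.2 ⟨CO_xor hv hc, hA⟩) hB

theorem bigK_sound {h : ℕ → Prop} (v : ℕ) (hv : h v) (L : List ℕ) :
    ∀ (A B : List ℕ) (k : List ℕ → List ℕ → Bool),
    bigK (Nat.pow 2 v) L A B k = true → (∀ c ∈ L, CO h c) → (∀ c ∈ A, CO h c) → (∀ c ∈ B, CO h c) →
      ∃ A' B', (∀ c ∈ A', CO h c) ∧ (∀ c ∈ B', CO h c) ∧ k A' B' = true := by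
  induction L with
  | nil => intro A B k hk _ hA hB; exact ⟨A, B, hA, hB, hk⟩
  | cons c cs ih =>
    intro A B k hk hL hA hB
    obtain ⟨x, hk'⟩ : ∃ x : Bool, bi (Nat.beq (Nat.land c (Nat.pow 2 v)) 0)
      (bigK (Nat.pow 2 v) cs A (c :: B) k)
      (bi x (bigK (Nat.pow 2 v) cs (Nat.xor c (Nat.pow 2 v) :: A) B k)
        (bigK (Nat.pow 2 v) cs A (Nat.xor c (Nat.pow 2 v) :: B) k)) = true := ⟨_, hk⟩
    rw [bi_true, bi_true] at hk'
    have hcs : ∀ c ∈ cs, CO h c := fun d hd => hL d (List.mem_cons_of_mem _ hd)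
    have hc := hL c List.mem_cons_self
    rcases hk' with ⟨h1, h2⟩ | ⟨_, ⟨_, h2⟩ | ⟨_, h2⟩⟩
    · exact ih _ _ _ h2 hcs hA (by simpa using ⟨hc, hB⟩)
    · exact ih _ _ _ h2 hcs (List.forall_mem_cons.2 ⟨CO_xor hv hc, hA⟩) hB
    · exact ih _ _ _ h2 hcs hA (List.forall_mem_cons.2 ⟨CO_xor hv hc, hB⟩)

theorem cover_ne {h : ℕ → Prop} {T R W : ℕ} (hTR : ∀ i, h i → T.testBit i = true ∨ R.testBit i = true)
    (hW : ∃ i, W.testBit i = true ∧ h i) : ¬ Nat.beq (Nat.land (Nat.lor T R) W) 0 = true := by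
  intro hb
  have hb := Nat.eq_of_beq_eq_true hb
  obtain ⟨i, h1, h2⟩ := hW
  have := tb_land (Nat.lor T R) W i
  rw [hb, tb_lor, h1] at this
  rcases hTR i h2 with h3 | h3 <;> simp [h3] at this

theorem fal_same {h : ℕ → Prop} {R v : ℕ} (hv : h v) : fal h (Nat.xor R (Nat.pow 2 v)) ≤ fal h R := by
  classical
  unfold fal
  apply Finset.card_le_card
  intro j
  simp only [mem_filter, mem_range, tb_xor, tb_pow]
  rintro ⟨h1, h2, h3⟩
  have : v ≠ j := by rintro rfl; exact h3 hv
  exact ⟨h1, by simpa [this] using h2, h3⟩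

theorem search_sound {h : ℕ → Prop} {Wm Um : ℕ} {sols : List ℕ}
    (hW : ∃ i, Wm.testBit i = true ∧ h i) (hU : ∃ i, Um.testBit i = true ∧ h i) (vs : List ℕ) :
    ∀ (U P B : List ℕ) (R b T : ℕ), search Wm Um sols vs U P B R b T = true →
      (∀ c ∈ U, CO h c) → (∀ c ∈ P, CO h c) → (∀ c ∈ B, CO h c) →
      (∀ i, h i → T.testBit i = true ∨ R.testBit i = true) → (∀ i, T.testBit i = true → h i) →
      fal h R ≤ b → ∃ s ∈ sols, ∀ i, h i ↔ s.testBit i = true := by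
  induction vs with
  | nil =>
    intro U P B R b T hs hcU hcP hcB hTR hT hf
    have hs' : bi (Nat.beq (Nat.land (Nat.lor T R) Wm) 0) true
      (bi (Nat.beq (Nat.land (Nat.lor T R) Um) 0) true
      (bi (Nat.beq R 0) (memK T sols) false)) = true := hs
    simp only [bi_true, cover_ne hTR hW, cover_ne hTR hU] at hs'
    simp only [false_and, false_or, Bool.false_eq_true, and_false, or_false] at hs'
    obtain ⟨_, _, h1, h2⟩ := hs'
    have h1 := Nat.eq_of_beq_eq_true h1
    subst h1
    refine ⟨T, memK_sound _ _ h2, fun i => ⟨fun hi => ?_, hT i⟩⟩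
    simpa using hTR i hi
  | cons v vs ih =>
    intro U P B R b T hs hcU hcP hcB hTR hT hf
    have hs' : bi (Nat.beq (Nat.land (Nat.lor T R) Wm) 0) true
      (bi (Nat.beq (Nat.land (Nat.lor T R) Um) 0) true
      (packK U R b fun R1 b1 => packK P R1 b1 fun _ _ =>
      bi (Nat.beq (Nat.land R (Nat.pow 2 v)) (Nat.pow 2 v)) (bi (Nat.ble 256 v) false <|
        bi (bi (memK (Nat.pow 2 v) U) true
            (pairK (Nat.pow 2 v) P U [] fun U' P' => bigK (Nat.pow 2 v) B P' [] fun P'' B' =>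
              search Wm Um sols vs U' P'' B' (Nat.xor R (Nat.pow 2 v)) b (Nat.lor T (Nat.pow 2 v))))
          (Nat.rec (motive := fun _ => Bool) true
            (fun b' _ => filtK (Nat.pow 2 v) U [] fun U' => filtK (Nat.pow 2 v) P [] fun P' =>
              filtK (Nat.pow 2 v) B [] fun B' =>
              search Wm Um sols vs U' P' B' (Nat.xor R (Nat.pow 2 v)) b' T) b)
          false)
        false)) = true := hs
    rcases bi_true.1 hs' with ⟨hx, _⟩ | ⟨_, hs'⟩
    · exact absurd hx (cover_ne hTR hW)
    rcases bi_true.1 hs' with ⟨hx, _⟩ | ⟨_, hp⟩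
    · exact absurd hx (cover_ne hTR hU)
    obtain ⟨R1, b1, hp, hf1⟩ := packK_sound U _ _ _ hp hcU hf
    obtain ⟨_, _, hp, _⟩ := packK_sound P _ _ _ hp hcP hf1
    simp only [bi_true, Bool.false_eq_true, and_false, or_false, false_or] at hp
    obtain ⟨hRv, h256, hTb, hFb⟩ := hp
    have hRv := Nat.eq_of_beq_eq_true hRv
    have hv256 : v < 256 := by
      by_contra hc
      rw [Nat.ble_eq_true_of_le (by omega)] at h256
      cases h256
    by_cases hv : h v
    · have hTb : (pairK (Nat.pow 2 v) P U [] fun U' P' => bigK (Nat.pow 2 v) B P' [] fun P'' B' =>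
              search Wm Um sols vs U' P'' B' (Nat.xor R (Nat.pow 2 v)) b (Nat.lor T (Nat.pow 2 v))) = true := by
        rcases hTb with ⟨h1, _⟩ | ⟨_, h2⟩
        · exfalso
          obtain ⟨i, _, h3, h4⟩ := hcU _ (memK_sound _ _ h1)
          rw [tb_pow] at h3
          simp at h3
          subst h3
          exact h4 hv
        · exact h2
      obtain ⟨U', P', hU', hP', hk⟩ := pairK_sound v hv P _ _ _ hTb hcP hcU (by simp)
      obtain ⟨P'', B', hP'', hB', hk⟩ := bigK_sound v hv B _ _ _ hk hcB hP' (by simp)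
      refine ih _ _ _ _ _ _ hk hU' hP'' hB' ?_ ?_ ((fal_same hv).trans hf)
      · intro i hi
        rw [tb_lor, tb_xor, tb_pow]
        by_cases hvi : v = i
        · simp [hvi]
        · simpa [hvi] using hTR i hi
      · intro i hi
        rw [tb_lor, tb_pow] at hi
        by_cases hvi : v = i
        · exact hvi ▸ hv
        · exact hT i (by simpa [hvi] using hi)
    · have hCv : CO h (Nat.pow 2 v) := ⟨v, hv256, by simp [tb_pow], hv⟩
      have hf' := fal_xor hCv (R := R) (by
        rw [← hRv]; apply Nat.eq_of_testBit_eq; intro i; rw [hRv, tb_land]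
        have := tb_land R (Nat.pow 2 v) i
        rw [hRv] at this
        rw [Bool.and_comm]; exact this.symm)
      cases b with
      | zero => omega
      | succ b =>
        obtain ⟨U', hU', hk⟩ := filtK_sound (h := h) _ U _ _ hFb hcU (by simp)
        obtain ⟨P', hP', hk⟩ := filtK_sound (h := h) _ P _ _ hk hcP (by simp)
        obtain ⟨B', hB', hk⟩ := filtK_sound (h := h) _ B _ _ hk hcB (by simp)
        refine ih _ _ _ _ _ _ hk hU' hP' hB' ?_ hT (by omega)
        intro i hi
        rw [tb_xor, tb_pow]
        have hvi : v ≠ i := by rintro rfl; exact hv hi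
        simpa [hvi] using hTR i hi

theorem forceL_sound {h : ℕ → Prop} (L : List ℕ) : ∀ (A : List ℕ) (k : List ℕ → Bool),
    forceL L A k = true → (∀ c ∈ L, CO h c) → (∀ c ∈ A, CO h c) →
      ∃ A', (∀ c ∈ A', CO h c) ∧ k A' = true := by
  induction L with
  | nil => intro A k hk _ hA; exact ⟨A, hA, hk⟩
  | cons c cs ih =>
    intro A k hk hL hA
    have hk' : forceL cs (c :: A) k = true := hk
    exact ih _ _ hk' (fun d hd => hL d (List.mem_cons_of_mem _ hd))
      (List.forall_mem_cons.2 ⟨hL c List.mem_cons_self, hA⟩)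

theorem start_sound {h : ℕ → Prop} {W U : ℕ} {sols vs P B : List ℕ} {R b T : ℕ}
    (hW : ∃ i, W.testBit i = true ∧ h i) (hU : ∃ i, U.testBit i = true ∧ h i)
    (hs : start W U sols vs P B R b T = true)
    (hcP : ∀ c ∈ P, CO h c) (hcB : ∀ c ∈ B, CO h c)
    (hTR : ∀ i, h i → T.testBit i = true ∨ R.testBit i = true) (hT : ∀ i, T.testBit i = true → h i)
    (hf : fal h R ≤ b) : ∃ s ∈ sols, ∀ i, h i ↔ s.testBit i = true := by
  have hs' : (forceL P [] fun P => forceL B [] fun B => search W U sols vs [] P B R b T) = true := hs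
  obtain ⟨P', hP', hk⟩ := forceL_sound P _ _ hs' hcP (by simp)
  obtain ⟨B', hB', hk⟩ := forceL_sound B _ _ hk hcB (by simp)
  exact search_sound hW hU vs _ _ _ _ _ _ hk (by simp) hP' hB' hTR hT hf

set_option maxRecDepth 100000 in
theorem run2 : start W0 U0 [] ordL2 (clM pathsQ) [] R2 15 0 = true := by decide +kernel

set_option maxRecDepth 100000 in
theorem run0 : start W0 U0 solL ordL (clM pathsP) (clM pathsB) R0 24 T0 = true := by decide +kernel

/-- the vertex set encoded by the mask `t` under the labelling `g` -/
def Em (g : ℕ → ℕ) (t : ℕ) : Finset ℕ := ((range 8).filter (fun i => t.testBit i = true)).image g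

def meets (s t : ℕ) : Bool := (List.range 8).any fun i => s.testBit i && t.testBit i

def isP (q : ℕ × ℕ × ℕ × ℕ) : Bool :=
  meets q.1 q.2.1 && meets q.2.1 q.2.2.1 && meets q.2.2.1 q.2.2.2 &&
    !meets q.1 q.2.2.1 && !meets q.1 q.2.2.2 && !meets q.2.1 q.2.2.2

def Inj8 (g : ℕ → ℕ) : Prop := ∀ i < 8, ∀ j < 8, g i = g j → i = j

theorem mem_Em {g : ℕ → ℕ} {t x : ℕ} : x ∈ Em g t ↔ ∃ i < 8, t.testBit i = true ∧ g i = x := by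
  simp [Em, and_assoc]

theorem mem_Em' {g : ℕ → ℕ} (hg : Inj8 g) {t i : ℕ} (hi : i < 8) : g i ∈ Em g t ↔ t.testBit i = true := by
  rw [mem_Em]
  constructor
  · rintro ⟨j, hj, h1, h2⟩
    rw [← hg j hj i hi h2]; exact h1
  · intro h; exact ⟨i, hi, h, rfl⟩

theorem meets_iff {s t : ℕ} : meets s t = true ↔ ∃ i < 8, s.testBit i = true ∧ t.testBit i = true := by
  simp [meets]

theorem Em_inter {g : ℕ → ℕ} (hg : Inj8 g) (s t : ℕ) :
    (Em g s ∩ Em g t).Nonempty ↔ meets s t = true := by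
  rw [meets_iff]
  constructor
  · rintro ⟨x, hx⟩
    rw [mem_inter] at hx
    obtain ⟨i, hi, h1, rfl⟩ := mem_Em.1 hx.1
    exact ⟨i, hi, h1, (mem_Em' hg hi).1 hx.2⟩
  · rintro ⟨i, hi, h1, h2⟩
    exact ⟨g i, mem_inter.2 ⟨(mem_Em' hg hi).2 h1, (mem_Em' hg hi).2 h2⟩⟩

theorem Em_inter' {g : ℕ → ℕ} (hg : Inj8 g) (s t : ℕ) :
    Em g s ∩ Em g t = ∅ ↔ meets s t = false := by
  rw [← Finset.not_nonempty_iff_eq_empty, Em_inter hg]; simp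

theorem Em_surj {g : ℕ → ℕ} {e : Finset ℕ} (he : e ⊆ (range 8).image g) :
    ∃ t < 256, e = Em g t := by
  refine ⟨Nat.ofBits (n := 8) (fun i => decide (g i ∈ e)), Nat.ofBits_lt_two_pow _, ?_⟩
  ext x
  rw [mem_Em]
  constructor
  · intro hx
    obtain ⟨i, hi, rfl⟩ := mem_image.1 (he hx)
    rw [mem_range] at hi
    refine ⟨i, hi, ?_, rfl⟩
    rw [Nat.testBit_ofBits_lt _ _ hi]; simpa using hx
  · rintro ⟨i, hi, h1, rfl⟩
    rw [Nat.testBit_ofBits_lt _ _ hi] at h1; simpa using h1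

theorem Em_card {g : ℕ → ℕ} (hg : Inj8 g) (t : ℕ) : (Em g t).card = pop8 t := by
  unfold Em
  rw [card_image_of_injOn]
  · rfl
  · intro i hi j hj h
    simp only [coe_filter, mem_range, Set.mem_ofPred_eq] at hi hj
    exact hg i hi.1 j hj.1 h

theorem Em_inj {g : ℕ → ℕ} (hg : Inj8 g) {s t : ℕ} (hs : s < 256) (ht : t < 256)
    (h : Em g s = Em g t) : s = t := by
  apply Nat.eq_of_testBit_eq
  intro i
  by_cases hi : i < 8
  · have := mem_Em' hg (t := s) hi
    rw [h, mem_Em' hg hi] at this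
    exact Bool.eq_iff_iff.2 this.symm
  · have h8 : (256 : ℕ) ≤ 2 ^ i := by
      calc (256 : ℕ) = 2 ^ 8 := by norm_num
        _ ≤ 2 ^ i := Nat.pow_le_pow_right (by norm_num) (by omega)
    rw [Nat.testBit_lt_two_pow (by omega), Nat.testBit_lt_two_pow (by omega)]

theorem no_path {H : Finset (Finset ℕ)} (hfree : P4Free H) {g : ℕ → ℕ} (hg : Inj8 g)
    {q : ℕ × ℕ × ℕ × ℕ} (hq : isP q = true) :
    ¬ (Em g q.1 ∈ H ∧ Em g q.2.1 ∈ H ∧ Em g q.2.2.1 ∈ H ∧ Em g q.2.2.2 ∈ H) := by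
  rintro ⟨h0, h1, h2, h3⟩
  simp only [isP, Bool.and_eq_true, Bool.not_eq_true'] at hq
  obtain ⟨⟨⟨⟨⟨p1, p2⟩, p3⟩, p4⟩, p5⟩, p6⟩ := hq
  exact hfree ⟨_, h0, _, h1, _, h2, _, h3, (Em_inter hg _ _).2 p1, (Em_inter hg _ _).2 p2,
    (Em_inter hg _ _).2 p3, (Em_inter' hg _ _).2 p4, (Em_inter' hg _ _).2 p5, (Em_inter' hg _ _).2 p6⟩

theorem mem_maskL (L : List ℕ) (i : ℕ) : (maskL L).testBit i = true ↔ i ∈ L := by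
  induction L with
  | nil => simp [maskL]
  | cons a L ih =>
    have : (maskL (a :: L)).testBit i = (decide (a = i) || (maskL L).testBit i) := by
      show (Nat.lor (2 ^ a) (maskL L)).testBit i = _
      rw [tb_lor]; congr 1; exact tb_pow a i
    rw [this, Bool.or_eq_true, ih, decide_eq_true_eq, List.mem_cons, eq_comm]

theorem mem_triL {t : ℕ} : t ∈ triL ↔ t < 256 ∧ pop8 t = 3 := by
  simp [triL]

/-- `h t`: the triple with mask `t` is an edge -/
def hE (g : ℕ → ℕ) (H : Finset (Finset ℕ)) (t : ℕ) : Prop := t ∈ triL ∧ Em g t ∈ H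

theorem chkOrd : ∀ t ∈ ordL, t ∈ triL ∧ (t.testBit 6 && t.testBit 7) = false := by decide +kernel
theorem chkC4 : ∀ t ∈ c4L, t ∈ triL ∧ t < 64 := by decide +kernel
theorem chkPB : ∀ q ∈ pathsB, isP q = true ∧ q.1 ∈ ordL ++ c4L ∧ q.2.1 ∈ ordL ++ c4L ∧
    q.2.2.1 ∈ ordL ++ c4L ∧ q.2.2.2 ∈ ordL ++ c4L := by
  decide +kernel
theorem chkPP : ∀ q ∈ pathsP, isP q = true ∧ q.1 ∈ ordL ++ c4L ∧ q.2.1 ∈ ordL ++ c4L ∧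
    q.2.2.1 ∈ ordL ++ c4L ∧ q.2.2.2 ∈ ordL ++ c4L := by
  decide +kernel
theorem chkPQ : ∀ q ∈ pathsQ, isP q = true ∧ q.1 ∈ ordL ++ c4L ∧ q.2.1 ∈ ordL ++ c4L ∧
    q.2.2.1 ∈ ordL ++ c4L ∧ q.2.2.2 ∈ ordL ++ c4L := by
  decide +kernel
theorem chkQ2 : ∀ c ∈ clM pathsQ, Nat.land c R2 = c := by decide +kernel
theorem chkBad : ∀ t ∈ triL, t ∈ ordL ∨ t ∈ c4L ∨ ∃ a ∈ c4L, ∃ b ∈ c4L, ∃ c ∈ c4L, isP (t, a, b, c) = true := by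
  decide +kernel
theorem chkR2 : ∀ t ∈ ordL2, t ∈ ordL ∧ (t.testBit 6 || t.testBit 7) = true := by decide +kernel
theorem chkR2' : ∀ t ∈ ordL, (t.testBit 6 || t.testBit 7) = true → t ∈ ordL2 := by decide +kernel
theorem chk46 : ((range 256).filter (fun t => t ∈ ordL ∨ t ∈ c4L)).card = 46 := by decide +kernel
theorem chk26 : ((range 256).filter (fun t => t ∈ ordL2)).card = 26 := by decide +kernel
theorem chk22 : ∀ s ∈ solL, ((range 256).filter (fun t => s.testBit t = true)).card = 22 := by decide +kernel

section fin
variable {g : ℕ → ℕ} {H : Finset (Finset ℕ)}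

theorem hE_cases (hg : Inj8 g) (hfree : P4Free H) (hc : ∀ t ∈ c4L, Em g t ∈ H) {t : ℕ}
    (ht : hE g H t) : t ∈ ordL ∨ t ∈ c4L := by
  rcases chkBad t ht.1 with h | h | ⟨a, ha, b, hb, c, hc', hp⟩
  · exact Or.inl h
  · exact Or.inr h
  · exact (no_path hfree hg hp ⟨ht.2, hc a ha, hc b hb, hc c hc'⟩).elim

theorem CO_of_path (hg : Inj8 g) (hfree : P4Free H) (hc : ∀ t ∈ c4L, Em g t ∈ H)
    {L : List (ℕ × ℕ × ℕ × ℕ)}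
    (hL : ∀ q ∈ L, isP q = true ∧ q.1 ∈ ordL ++ c4L ∧ q.2.1 ∈ ordL ++ c4L ∧
    q.2.2.1 ∈ ordL ++ c4L ∧ q.2.2.2 ∈ ordL ++ c4L) :
    ∀ c ∈ clM L, CO (hE g H) c := by
  intro c hcm
  obtain ⟨q, hq, rfl⟩ := List.mem_map.1 hcm
  obtain ⟨h0, h1, h2, h3, h4⟩ := hL q hq
  by_contra hno
  have key : ∀ t ∈ ordL ++ c4L, t ∈ [q.1, q.2.1, q.2.2.1, q.2.2.2] → Em g t ∈ H := by
    intro t ht htq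
    by_contra hn
    have htn : ¬ hE g H t := fun h => hn h.2
    rcases List.mem_append.1 ht with h | h
    · apply hno
      refine ⟨t, (mem_triL.1 (chkOrd t h).1).1, ?_, htn⟩
      rw [tb_land, Bool.and_eq_true]
      exact ⟨(mem_maskL _ _).2 htq, (mem_maskL _ _).2 h⟩
    · exact hn (hc t h)
  exact no_path hfree hg h0 ⟨key _ h1 (by simp), key _ h2 (by simp), key _ h3 (by simp), key _ h4 (by simp)⟩

end fin
open Classical in
noncomputable def cntP (g : ℕ → ℕ) (H : Finset (Finset ℕ)) (p : ℕ → Bool) : ℕ :=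
  ((range 256).filter (fun t => hE g H t ∧ p t = true)).card

section fin2
variable {g : ℕ → ℕ} {H : Finset (Finset ℕ)}

theorem mem_W0 {t : ℕ} (h : t ∈ triL) (h6 : t.testBit 6 = true) : W0.testBit t = true := by
  unfold W0; rw [mem_maskL, List.mem_filter]; exact ⟨h, h6⟩

theorem mem_U0 {t : ℕ} (h : t ∈ triL) (h6 : t.testBit 7 = true) : U0.testBit t = true := by
  unfold U0; rw [mem_maskL, List.mem_filter]; exact ⟨h, h6⟩

theorem fin_one (hg : Inj8 g) (hfree : P4Free H) (hc : ∀ t ∈ c4L, Em g t ∈ H)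
    (hw : ∃ t, hE g H t ∧ t.testBit 6 = true) (hu : ∃ t, hE g H t ∧ t.testBit 7 = true) :
    cntP g H (fun t => t.testBit 6 || t.testBit 7) ≤ 10 := by
  classical
  by_contra hcon
  have key : ∀ t, hE g H t → (t.testBit 6 || t.testBit 7) = true → t ∈ ordL2 := by
    intro t ht hb
    rcases hE_cases hg hfree hc ht with h | h
    · exact chkR2' t h hb
    · exfalso
      have := (chkC4 t h).2
      rw [Nat.testBit_lt_two_pow (by omega), Nat.testBit_lt_two_pow (by omega)] at hb
      cases hb
  have hsum : cntP g H (fun t => t.testBit 6 || t.testBit 7) + fal (fun t => hE g H t ∧ t ∈ ordL2) R2 = 26 := by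
    rw [← chk26]
    unfold cntP fal
    rw [← Finset.card_union_of_disjoint]
    · congr 1
      ext t
      simp only [mem_union, mem_filter, mem_range]
      have : R2.testBit t = true ↔ t ∈ ordL2 := mem_maskL _ _
      rw [this]
      constructor
      · rintro (⟨h1, h2, h3⟩ | ⟨h1, h2, _⟩)
        · exact ⟨h1, key t h2 h3⟩
        · exact ⟨h1, h2⟩
      · rintro ⟨h1, h2⟩
        by_cases hh : hE g H t
        · exact Or.inl ⟨h1, hh, (chkR2 t h2).2⟩
        · exact Or.inr ⟨h1, h2, fun h => hh h.1⟩
    · rw [Finset.disjoint_left]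
      intro t
      simp only [mem_filter]
      rintro ⟨h1, h2, h3⟩ ⟨_, _, h4⟩
      exact h4 ⟨h2, key t h2 h3⟩
  obtain ⟨tw, hw1, hw2⟩ := hw
  obtain ⟨tu, hu1, hu2⟩ := hu
  have := start_sound (h := fun t => hE g H t ∧ t ∈ ordL2)
    ⟨tw, mem_W0 hw1.1 hw2, hw1, key tw hw1 (by simp [hw2])⟩
    ⟨tu, mem_U0 hu1.1 hu2, hu1, key tu hu1 (by simp [hu2])⟩ run2
    (fun c hcm => by
      obtain ⟨i, h1, h2, h3⟩ := CO_of_path hg hfree hc chkPQ c hcm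
      exact ⟨i, h1, h2, fun h => h3 h.1⟩) (by simp)
    (fun i hi => Or.inr ((mem_maskL _ _).2 hi.2)) (by simp) (by omega)
  simp at this

theorem fin_sum (hg : Inj8 g) (hfree : P4Free H) (hc : ∀ t ∈ c4L, Em g t ∈ H) :
    cntP g H (fun _ => true) + fal (hE g H) R0 = 46 := by
  classical
  rw [← chk46]
  unfold cntP fal
  rw [← Finset.card_union_of_disjoint]
  · congr 1
    ext t
    simp only [mem_union, mem_filter, mem_range]
    have : R0.testBit t = true ↔ t ∈ ordL := mem_maskL _ _
    rw [this]
    constructor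
    · rintro (⟨h1, h2, _⟩ | ⟨h1, h2, _⟩)
      · exact ⟨h1, hE_cases hg hfree hc h2⟩
      · exact ⟨h1, Or.inl h2⟩
    · rintro ⟨h1, h2 | h2⟩
      · by_cases hh : hE g H t
        · exact Or.inl ⟨h1, hh, trivial⟩
        · exact Or.inr ⟨h1, h2, hh⟩
      · exact Or.inl ⟨h1, ⟨(chkC4 t h2).1, hc t h2⟩, trivial⟩
  · rw [Finset.disjoint_left]
    intro t
    simp only [mem_filter]
    rintro ⟨h1, h2, h3⟩ ⟨_, _, h4⟩
    exact h4 h2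

theorem fin_sol (hg : Inj8 g) (hfree : P4Free H) (hc : ∀ t ∈ c4L, Em g t ∈ H)
    (hw : ∃ t, hE g H t ∧ t.testBit 6 = true) (hu : ∃ t, hE g H t ∧ t.testBit 7 = true)
    (h22 : 22 ≤ cntP g H (fun _ => true)) :
    ∃ s ∈ solL, ∀ t, hE g H t ↔ s.testBit t = true := by
  have hsum := fin_sum hg hfree hc
  obtain ⟨tw, hw1, hw2⟩ := hw
  obtain ⟨tu, hu1, hu2⟩ := hu
  refine start_sound ⟨tw, mem_W0 hw1.1 hw2, hw1⟩ ⟨tu, mem_U0 hu1.1 hu2, hu1⟩ run0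
    (CO_of_path hg hfree hc chkPP) (CO_of_path hg hfree hc chkPB) ?_ ?_ (by omega)
  · intro i hi
    rcases hE_cases hg hfree hc hi with h | h
    · exact Or.inr ((mem_maskL _ _).2 h)
    · exact Or.inl ((mem_maskL _ _).2 h)
  · intro i hi
    have hi := (mem_maskL _ _).1 hi
    exact ⟨(chkC4 i hi).1, hc i hi⟩

theorem cntP_sol {s : ℕ} (hs : ∀ t, hE g H t ↔ s.testBit t = true) (p : ℕ → Bool) :
    cntP g H p = ((range 256).filter (fun t => s.testBit t = true ∧ p t = true)).card := by
  classical
  unfold cntP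
  simp only [hs]

theorem fin_two (hg : Inj8 g) (hfree : P4Free H) (hc : ∀ t ∈ c4L, Em g t ∈ H)
    (hw : ∃ t, hE g H t ∧ t.testBit 6 = true) (hu : ∃ t, hE g H t ∧ t.testBit 7 = true) :
    cntP g H (fun _ => true) ≤ 22 := by
  by_contra hcon
  obtain ⟨s, hs, h⟩ := fin_sol hg hfree hc hw hu (by omega)
  rw [cntP_sol h] at hcon
  simp only [and_true] at hcon
  rw [chk22 s hs] at hcon
  omega

/-- transfer of edge counts -/
theorem card_transfer (hg : Inj8 g) (h3 : ∀ e ∈ H, e.card = 3) (Q : Finset ℕ → Prop) [DecidablePred Q]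
    (p : ℕ → Bool) (hpq : ∀ t, t < 256 → (Q (Em g t) ↔ p t = true))
    (hQ : ∀ e ∈ H, Q e → e ⊆ (range 8).image g) :
    (H.filter Q).card = cntP g H p := by
  classical
  unfold cntP
  have : H.filter Q = ((range 256).filter (fun t => hE g H t ∧ p t = true)).image (Em g) := by
    ext e
    simp only [mem_filter, mem_image, mem_range]
    constructor
    · rintro ⟨he, hq⟩
      obtain ⟨t, ht, rfl⟩ := Em_surj (hQ e he hq)
      refine ⟨t, ⟨ht, ⟨mem_triL.2 ⟨ht, ?_⟩, he⟩, (hpq t ht).1 hq⟩, rfl⟩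
      rw [← Em_card hg, h3 _ he]
    · rintro ⟨t, ⟨h1, h2, h4⟩, rfl⟩
      exact ⟨h2.2, (hpq t h1).2 h4⟩
  rw [this, card_image_of_injOn]
  intro s hs t ht h
  simp only [coe_filter, mem_range, Set.mem_ofPred_eq] at hs ht
  exact Em_inj hg hs.1 ht.1 h

end fin2

def gw (x : ℕ → ℕ) (w u : ℕ) : ℕ → ℕ := fun i => if i = 6 then w else if i = 7 then u else x i

def KK (x : ℕ → ℕ) : Finset ℕ := (range 6).image x

structure Hyp (V : Finset ℕ) (H : Finset (Finset ℕ)) (x : ℕ → ℕ) : Prop where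
  three : ThreeGraphOn V H
  conn : ConnectedHG V H
  free : P4Free H
  m3 : ¬ HasM3 H
  inj : ∀ i < 6, ∀ j < 6, x i = x j → i = j
  xV : ∀ i < 6, x i ∈ V
  c4 : ∀ t ∈ c4L, Em x t ∈ H

theorem bits64 : ∀ t < 256, (decide (t < 64)) = !(t.testBit 6 || t.testBit 7) := by decide +kernel

section main
variable {V : Finset ℕ} {H : Finset (Finset ℕ)} {x : ℕ → ℕ} {w u : ℕ}

theorem mem_KK {y : ℕ} : y ∈ KK x ↔ ∃ i < 6, x i = y := by simp [KK]

theorem gw_lt {i : ℕ} (hi : i < 6) : gw x w u i = x i := by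
  have h6 : i ≠ 6 := by omega
  have h7 : i ≠ 7 := by omega
  simp [gw, h6, h7]

theorem gw_six : gw x w u 6 = w := by simp [gw]
theorem gw_seven : gw x w u 7 = u := by simp [gw]

theorem inj_gw (hx : ∀ i < 6, ∀ j < 6, x i = x j → i = j) (hw : w ∉ KK x) (hu : u ∉ KK x)
    (hwu : w ≠ u) : Inj8 (gw x w u) := by
  rw [mem_KK] at hw hu
  push Not at hw hu
  intro i hi j hj h
  by_cases hi6 : i < 6 <;> by_cases hj6 : j < 6
  · rw [gw_lt hi6, gw_lt hj6] at h; exact hx i hi6 j hj6 h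
  · rw [gw_lt hi6] at h
    have : j = 6 ∨ j = 7 := by omega
    rcases this with rfl | rfl
    · rw [gw_six] at h; exact absurd h (hw i hi6)
    · rw [gw_seven] at h; exact absurd h (hu i hi6)
  · rw [gw_lt hj6] at h
    have : i = 6 ∨ i = 7 := by omega
    rcases this with rfl | rfl
    · rw [gw_six] at h; exact absurd h.symm (hw j hj6)
    · rw [gw_seven] at h; exact absurd h.symm (hu j hj6)
  · have h1 : i = 6 ∨ i = 7 := by omega
    have h2 : j = 6 ∨ j = 7 := by omega
    rcases h1 with rfl | rfl <;> rcases h2 with rfl | rfl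
    · rfl
    · rw [gw_six, gw_seven] at h; exact absurd h hwu
    · rw [gw_six, gw_seven] at h; exact absurd h.symm hwu
    · rfl

theorem small_bit {t i : ℕ} (ht : t < 64) (hi : t.testBit i = true) : i < 6 := by
  by_contra h
  have h8 : (64 : ℕ) ≤ 2 ^ i := by
    calc (64 : ℕ) = 2 ^ 6 := by norm_num
      _ ≤ 2 ^ i := Nat.pow_le_pow_right (by norm_num) (by omega)
  rw [Nat.testBit_lt_two_pow (by omega)] at hi
  cases hi

theorem Em_gw {t : ℕ} (ht : t < 64) : Em (gw x w u) t = Em x t := by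
  ext y
  rw [mem_Em, mem_Em]
  constructor
  · rintro ⟨i, hi, h1, h2⟩
    exact ⟨i, hi, h1, by rw [← h2, gw_lt (small_bit ht h1)]⟩
  · rintro ⟨i, hi, h1, h2⟩
    exact ⟨i, hi, h1, by rw [← h2, gw_lt (small_bit ht h1)]⟩

theorem Em_sub {t : ℕ} (ht : t < 64) : Em x t ⊆ KK x := by
  intro y hy
  obtain ⟨i, hi, h1, h2⟩ := mem_Em.1 hy
  exact mem_KK.2 ⟨i, small_bit ht h1, h2⟩

theorem mem_img {y : ℕ} : y ∈ (range 8).image (gw x w u) ↔ y ∈ KK x ∨ y = w ∨ y = u := by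
  rw [mem_image, mem_KK]
  constructor
  · rintro ⟨i, hi, rfl⟩
    rw [mem_range] at hi
    by_cases h : i < 6
    · exact Or.inl ⟨i, h, (gw_lt h).symm⟩
    · have : i = 6 ∨ i = 7 := by omega
      rcases this with rfl | rfl
      · exact Or.inr (Or.inl gw_six)
      · exact Or.inr (Or.inr gw_seven)
  · rintro (⟨i, hi, rfl⟩ | rfl | rfl)
    · exact ⟨i, mem_range.2 (by omega), gw_lt hi⟩
    · exact ⟨6, by simp, gw_six⟩
    · exact ⟨7, by simp, gw_seven⟩

theorem Hyp.c4g (hy : Hyp V H x) : ∀ t ∈ c4L, Em (gw x w u) t ∈ H := by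
  intro t ht
  rw [Em_gw (chkC4 t ht).2]
  exact hy.c4 t ht

theorem Hyp.single (hy : Hyp V H x) {e : Finset ℕ} (he : e ∈ H) {a b : ℕ} (ha : a ∈ e) (hb : b ∈ e)
    (haK : a ∉ KK x) (hbK : b ∉ KK x) : a = b := by
  by_contra hab
  have hg := inj_gw hy.inj haK hbK hab
  have hcard := (hy.three e he).2
  by_cases hK : ∃ c ∈ e, c ∈ KK x
  · obtain ⟨c, hce, hcK⟩ := hK
    have hac : a ≠ c := by rintro rfl; exact haK hcK
    have hbc : b ≠ c := by rintro rfl; exact hbK hcK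
    have heq : ({a, b, c} : Finset ℕ) = e := by
      apply Finset.eq_of_subset_of_card_le
      · intro y; simp only [mem_insert, mem_singleton]; rintro (rfl | rfl | rfl) <;> assumption
      · rw [hcard, Finset.card_eq_three.2 ⟨a, b, c, hab, hac, hbc, rfl⟩]
    have hsub : e ⊆ (range 8).image (gw x a b) := by
      rw [← heq]
      intro y hy'
      simp only [mem_insert, mem_singleton] at hy'
      rw [mem_img]
      rcases hy' with rfl | rfl | rfl <;> simp [hcK]
    obtain ⟨t, ht, rfl⟩ := Em_surj hsub
    have h6 : t.testBit 6 = true := by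
      rw [← mem_Em' hg (by norm_num), gw_six]; exact ha
    have h7 : t.testBit 7 = true := by
      rw [← mem_Em' hg (by norm_num), gw_seven]; exact hb
    have hE' : hE (gw x a b) H t := ⟨mem_triL.2 ⟨ht, by rw [← Em_card hg, hcard]⟩, he⟩
    rcases hE_cases hg hy.free hy.c4g hE' with h | h
    · have := (chkOrd t h).2
      rw [h6, h7] at this
      cases this
    · have := small_bit (chkC4 t h).2 h6
      omega
  · push Not at hK
    apply hy.m3
    refine ⟨e, he, Em x 13, hy.c4 13 (by decide), Em x 50, hy.c4 50 (by decide), ?_, ?_, ?_⟩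
    · rw [← Finset.not_nonempty_iff_eq_empty]
      rintro ⟨y, hy'⟩
      rw [mem_inter] at hy'
      exact hK y hy'.1 (Em_sub (by norm_num) hy'.2)
    · rw [← Finset.not_nonempty_iff_eq_empty]
      rintro ⟨y, hy'⟩
      rw [mem_inter] at hy'
      exact hK y hy'.1 (Em_sub (by norm_num) hy'.2)
    · rw [← Em_gw (x := x) (w := a) (u := b) (t := 13) (by norm_num),
        ← Em_gw (x := x) (w := a) (u := b) (t := 50) (by norm_num), Em_inter' hg]
      decide

theorem Hyp.deg_pos (hy : Hyp V H x) (hw : w ∈ V) (hwK : w ∉ KK x) : ∃ e ∈ H, w ∈ e := by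
  obtain ⟨e, he, h1, _⟩ := hy.conn {w} (V.erase w) (by
      rw [← Finset.insert_eq, Finset.insert_erase hw]) (by simp) (by simp)
      ⟨x 0, Finset.mem_erase.2 ⟨by
        rintro h; exact hwK (mem_KK.2 ⟨0, by norm_num, h⟩), hy.xV 0 (by norm_num)⟩⟩
  obtain ⟨y, hy'⟩ := h1
  simp only [mem_inter, mem_singleton] at hy'
  exact ⟨e, he, hy'.2 ▸ hy'.1⟩

theorem Hyp.sub_img (hy : Hyp V H x) {e : Finset ℕ} (he : e ∈ H)
    {v : ℕ} (hv : v ∈ e) (hvK : v ∉ KK x) (hvw : v = w ∨ v = u) : e ⊆ (range 8).image (gw x w u) := by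
  intro y hy'
  rw [mem_img]
  by_cases hK : y ∈ KK x
  · exact Or.inl hK
  · right
    rw [hy.single he hy' hv hK hvK]; exact hvw

/-- number of edges inside the cycle vertices -/
def kk (H : Finset (Finset ℕ)) (x : ℕ → ℕ) : ℕ := (H.filter (fun e => e ⊆ KK x)).card

/-- degree -/
def dd (H : Finset (Finset ℕ)) (w : ℕ) : ℕ := (H.filter (fun e => w ∈ e)).card

theorem Hyp.dd_w (hy : Hyp V H x) (hwK : w ∉ KK x) (huK : u ∉ KK x) (hwu : w ≠ u) :
    dd H w = cntP (gw x w u) H (fun t => t.testBit 6) := by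
  have hg := inj_gw hy.inj hwK huK hwu
  refine card_transfer hg (fun e he => (hy.three e he).2) _ _ ?_ ?_
  · intro t ht
    rw [← mem_Em' hg (by norm_num : 6 < 8), gw_six]
  · intro e he hwe
    exact hy.sub_img he hwe hwK (Or.inl rfl)

theorem Hyp.dd_u (hy : Hyp V H x) (hwK : w ∉ KK x) (huK : u ∉ KK x) (hwu : w ≠ u) :
    dd H u = cntP (gw x w u) H (fun t => t.testBit 7) := by
  have hg := inj_gw hy.inj hwK huK hwu
  refine card_transfer hg (fun e he => (hy.three e he).2) _ _ ?_ ?_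
  · intro t ht
    rw [← mem_Em' hg (by norm_num : 7 < 8), gw_seven]
  · intro e he hwe
    exact hy.sub_img he hwe huK (Or.inr rfl)

theorem Hyp.kk_eq (hy : Hyp V H x) (hwK : w ∉ KK x) (huK : u ∉ KK x) (hwu : w ≠ u) :
    kk H x = cntP (gw x w u) H (fun t => decide (t < 64)) := by
  have hg := inj_gw hy.inj hwK huK hwu
  refine card_transfer hg (fun e he => (hy.three e he).2) _ _ ?_ ?_
  · intro t ht
    constructor
    · intro hs
      show decide (t < 64) = true
      rw [bits64 t ht]
      have h6 : t.testBit 6 = false := by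
        rw [← Bool.not_eq_true, ← mem_Em' hg (by norm_num : 6 < 8), gw_six]
        exact fun h => hwK (hs h)
      have h7 : t.testBit 7 = false := by
        rw [← Bool.not_eq_true, ← mem_Em' hg (by norm_num : 7 < 8), gw_seven]
        exact fun h => huK (hs h)
      rw [h6, h7]; rfl
    · intro h
      have h : t < 64 := by simpa using h
      rw [Em_gw h]; exact Em_sub h
  · intro e he h y hy'
    rw [mem_img]; exact Or.inl (h hy')

theorem Hyp.cnt_wu (hy : Hyp V H x) (hwK : w ∉ KK x) (huK : u ∉ KK x) (hwu : w ≠ u) :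
    cntP (gw x w u) H (fun t => t.testBit 6 || t.testBit 7) = dd H w + dd H u := by
  classical
  rw [hy.dd_w hwK huK hwu, hy.dd_u hwK huK hwu]
  have hg := inj_gw hy.inj hwK huK hwu
  unfold cntP
  rw [← Finset.card_union_of_disjoint]
  · congr 1
    ext t
    simp only [mem_union, mem_filter, Bool.or_eq_true]
    tauto
  · rw [Finset.disjoint_left]
    intro t
    simp only [mem_filter]
    rintro ⟨_, h1, h2⟩ ⟨_, _, h3⟩
    rcases hE_cases hg hy.free hy.c4g h1 with h | h
    · have := (chkOrd t h).2
      rw [h2, h3] at this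
      cases this
    · have := small_bit (chkC4 t h).2 h2
      omega

theorem Hyp.cnt_all (hy : Hyp V H x) (hwK : w ∉ KK x) (huK : u ∉ KK x) (hwu : w ≠ u) :
    cntP (gw x w u) H (fun _ => true) = kk H x + (dd H w + dd H u) := by
  classical
  rw [← hy.cnt_wu hwK huK hwu, hy.kk_eq hwK huK hwu]
  unfold cntP
  rw [← Finset.card_union_of_disjoint]
  · congr 1
    ext t
    simp only [mem_union, mem_filter, mem_range]
    constructor
    · rintro ⟨h1, h2, _⟩
      rw [bits64 t h1]
      cases h : (t.testBit 6 || t.testBit 7)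
      · left; exact ⟨h1, h2, rfl⟩
      · right; exact ⟨h1, h2, rfl⟩
    · rintro (⟨h1, h2, _⟩ | ⟨h1, h2, _⟩) <;> exact ⟨h1, h2, trivial⟩
  · rw [Finset.disjoint_left]
    intro t
    simp only [mem_filter, mem_range]
    rintro ⟨h0, h1, h2⟩ ⟨_, _, h3⟩
    rw [bits64 t h0, h3] at h2
    cases h2

theorem Hyp.edge_w (hy : Hyp V H x) (hwK : w ∉ KK x) (huK : u ∉ KK x) (hwu : w ≠ u) (hw : w ∈ V) :
    ∃ t, hE (gw x w u) H t ∧ t.testBit 6 = true := by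
  have hg := inj_gw hy.inj hwK huK hwu
  obtain ⟨e, he, hwe⟩ := hy.deg_pos hw hwK
  obtain ⟨t, ht, rfl⟩ := Em_surj (hy.sub_img (w := w) (u := u) he hwe hwK (Or.inl rfl))
  refine ⟨t, ⟨mem_triL.2 ⟨ht, by rw [← Em_card hg, (hy.three _ he).2]⟩, he⟩, ?_⟩
  rw [← mem_Em' hg (by norm_num), gw_six]; exact hwe

theorem Hyp.edge_u (hy : Hyp V H x) (hwK : w ∉ KK x) (huK : u ∉ KK x) (hwu : w ≠ u) (hu : u ∈ V) :
    ∃ t, hE (gw x w u) H t ∧ t.testBit 7 = true := by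
  have hg := inj_gw hy.inj hwK huK hwu
  obtain ⟨e, he, hwe⟩ := hy.deg_pos hu huK
  obtain ⟨t, ht, rfl⟩ := Em_surj (hy.sub_img (w := w) (u := u) he hwe huK (Or.inr rfl))
  refine ⟨t, ⟨mem_triL.2 ⟨ht, by rw [← Em_card hg, (hy.three _ he).2]⟩, he⟩, ?_⟩
  rw [← mem_Em' hg (by norm_num), gw_seven]; exact hwe

theorem Hyp.pair_one (hy : Hyp V H x) (hwK : w ∉ KK x) (huK : u ∉ KK x) (hwu : w ≠ u)
    (hw : w ∈ V) (hu : u ∈ V) : dd H w + dd H u ≤ 10 := by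
  rw [← hy.cnt_wu hwK huK hwu]
  exact fin_one (inj_gw hy.inj hwK huK hwu) hy.free hy.c4g (hy.edge_w hwK huK hwu hw)
    (hy.edge_u hwK huK hwu hu)

theorem Hyp.pair_two (hy : Hyp V H x) (hwK : w ∉ KK x) (huK : u ∉ KK x) (hwu : w ≠ u)
    (hw : w ∈ V) (hu : u ∈ V) : kk H x + (dd H w + dd H u) ≤ 22 := by
  rw [← hy.cnt_all hwK huK hwu]
  exact fin_two (inj_gw hy.inj hwK huK hwu) hy.free hy.c4g (hy.edge_w hwK huK hwu hw)
    (hy.edge_u hwK huK hwu hu)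

theorem Hyp.pair_sol (hy : Hyp V H x) (hwK : w ∉ KK x) (huK : u ∉ KK x) (hwu : w ≠ u)
    (hw : w ∈ V) (hu : u ∈ V) (h22 : kk H x + (dd H w + dd H u) = 22) :
    ∃ s ∈ solL, ∀ t, hE (gw x w u) H t ↔ s.testBit t = true :=
  fin_sol (inj_gw hy.inj hwK huK hwu) hy.free hy.c4g (hy.edge_w hwK huK hwu hw)
    (hy.edge_u hwK huK hwu hu) (by rw [hy.cnt_all hwK huK hwu, h22])

theorem Hyp.card_eq (hy : Hyp V H x) : H.card = kk H x + ∑ w ∈ V \ KK x, dd H w := by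
  unfold kk dd
  rw [← Finset.card_biUnion]
  · rw [← Finset.card_filter_add_card_filter_not (s := H) (fun e => e ⊆ KK x)]
    congr 2
    ext e
    simp only [mem_filter, mem_biUnion, mem_sdiff]
    constructor
    · rintro ⟨he, hne⟩
      obtain ⟨y, h1, h2⟩ := Finset.not_subset.1 hne
      exact ⟨y, ⟨(hy.three e he).1 h1, h2⟩, he, h1⟩
    · rintro ⟨y, ⟨_, h2⟩, he, h1⟩
      exact ⟨he, fun h => h2 (h h1)⟩
  · intro a ha b hb hab
    rw [Finset.mem_coe, mem_sdiff] at ha hb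
    rw [Function.onFun, Finset.disjoint_left]
    intro e
    simp only [mem_filter]
    rintro ⟨he, h1⟩ ⟨_, h2⟩
    exact hab (hy.single he h1 h2 ha.2 hb.2)

end main

theorem Em_or {g : ℕ → ℕ} (s t : ℕ) : Em g (s ||| t) = Em g s ∪ Em g t := by
  ext y
  simp only [mem_union, mem_Em, Nat.testBit_or, Bool.or_eq_true]
  constructor
  · rintro ⟨i, hi, h | h, rfl⟩
    · exact Or.inl ⟨i, hi, h, rfl⟩
    · exact Or.inr ⟨i, hi, h, rfl⟩
  · rintro (⟨i, hi, h, rfl⟩ | ⟨i, hi, h, rfl⟩)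
    · exact ⟨i, hi, Or.inl h, rfl⟩
    · exact ⟨i, hi, Or.inr h, rfl⟩

theorem Em_and {g : ℕ → ℕ} (hg : Inj8 g) (s t : ℕ) : Em g (s &&& t) = Em g s ∩ Em g t := by
  ext y
  simp only [mem_inter, mem_Em, Nat.testBit_and, Bool.and_eq_true]
  constructor
  · rintro ⟨i, hi, ⟨h, h'⟩, rfl⟩
    exact ⟨⟨i, hi, h, rfl⟩, ⟨i, hi, h', rfl⟩⟩
  · rintro ⟨⟨i, hi, h, rfl⟩, ⟨j, hj, h', e⟩⟩
    have := hg j hj i hi e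
    subst this
    exact ⟨j, hj, ⟨h, h'⟩, rfl⟩

section main2
variable {V : Finset ℕ} {H : Finset (Finset ℕ)} {x : ℕ → ℕ} {w u : ℕ}

theorem KK_sub (hy : Hyp V H x) : KK x ⊆ V := by
  intro y h
  obtain ⟨i, hi, rfl⟩ := mem_KK.1 h
  exact hy.xV i hi

theorem Hyp.star (hy : Hyp V H x) (hwK : w ∉ KK x) {s c F : ℕ} (hc : c < 6) (hF : F < 64)
    (hcF : F.testBit c = false) (Q : Finset ℕ → Prop) (R : ℕ → Bool)
    (hQ : ∀ e, Q e → e ⊆ KK x)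
    (hQR : ∀ u, Inj8 (gw x w u) → ∀ t ∈ triL, (Q (Em (gw x w u) t) ↔ R t = true))
    (tab : ∀ t ∈ triL, s.testBit t = (R t || (t.testBit c && meets t F)))
    (hall : ∀ u ∈ V \ KK x, u ≠ w → ∀ t, hE (gw x w u) H t ↔ s.testBit t = true)
    (hex : ∃ u ∈ V \ KK x, u ≠ w) (e : Finset ℕ) (heV : e ⊆ V) (he3 : e.card = 3) :
    e ∈ H ↔ Q e ∨ (x c ∈ e ∧ (e ∩ Em x F).Nonempty) := by
  have main : (∀ a ∈ e, ∀ b ∈ e, a ∉ KK x → b ∉ KK x → a = b) →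
      (e ∈ H ↔ Q e ∨ (x c ∈ e ∧ (e ∩ Em x F).Nonempty)) := by
    intro h1
    have : ∃ u ∈ V \ KK x, u ≠ w ∧ e ⊆ (range 8).image (gw x w u) := by
      by_cases h : ∃ a ∈ e, a ∉ KK x ∧ a ≠ w
      · obtain ⟨a, ha, haK, haw⟩ := h
        refine ⟨a, mem_sdiff.2 ⟨heV ha, haK⟩, haw, ?_⟩
        intro y hye
        rw [mem_img]
        by_cases hK : y ∈ KK x
        · exact Or.inl hK
        · exact Or.inr (Or.inr (h1 y hye a ha hK haK))
      · push Not at h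
        obtain ⟨u, hu, huw⟩ := hex
        refine ⟨u, hu, huw, ?_⟩
        intro y hye
        rw [mem_img]
        by_cases hK : y ∈ KK x
        · exact Or.inl hK
        · exact Or.inr (Or.inl (h y hye hK))
    obtain ⟨u, hu, huw, hsub⟩ := this
    have hg := inj_gw hy.inj hwK (mem_sdiff.1 hu).2 huw.symm
    obtain ⟨t, ht, rfl⟩ := Em_surj hsub
    have htt : t ∈ triL := mem_triL.2 ⟨ht, by rw [← Em_card hg, he3]⟩
    have hh := hall u hu huw t
    rw [← Em_gw (w := w) (u := u) hF, Em_inter hg, ← gw_lt (x := x) (w := w) (u := u) hc,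
      mem_Em' hg (by omega), hQR u hg t htt]
    have : hE (gw x w u) H t ↔ Em (gw x w u) t ∈ H := ⟨fun h => h.2, fun h => ⟨htt, h⟩⟩
    rw [← this, hh, tab t htt, Bool.or_eq_true, Bool.and_eq_true]
  constructor
  · intro he
    exact (main (fun a ha b hb haK hbK => hy.single he ha hb haK hbK)).1 he
  · intro hr
    refine (main ?_).2 hr
    intro a ha b hb haK hbK
    rcases hr with hq | ⟨hxc, ⟨y, hy'⟩⟩
    · exact absurd (hQ e hq ha) haK
    · by_contra hab
      rw [mem_inter] at hy'
      have hyK := Em_sub hF hy'.2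
      have hxK : x c ∈ KK x := mem_KK.2 ⟨c, hc, rfl⟩
      have hxy : x c ≠ y := by
        intro h
        obtain ⟨i, hi, h1, h2⟩ := mem_Em.1 hy'.2
        have : i = c := hy.inj i (small_bit hF h1) c hc (by rw [h2, h])
        rw [this, hcF] at h1
        cases h1
      have h4 : ({x c, y, a, b} : Finset ℕ).card ≤ e.card := by
        apply Finset.card_le_card
        intro z
        simp only [mem_insert, mem_singleton]
        rintro (rfl | rfl | rfl | rfl)
        · exact hxc
        · exact hy'.1
        · exact ha
        · exact hb
      have e1 : x c ≠ a := by rintro h; rw [h] at hxK; exact haK hxK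
      have e2 : x c ≠ b := by rintro h; rw [h] at hxK; exact hbK hxK
      have e3 : y ≠ a := by rintro rfl; exact haK hyK
      have e4 : y ≠ b := by rintro rfl; exact hbK hyK
      rw [Finset.card_insert_of_notMem (by simp [hxy, e1, e2]),
        Finset.card_insert_of_notMem (by simp [e3, e4]),
        Finset.card_insert_of_notMem (by simp [hab]), Finset.card_singleton, he3] at h4
      omega

theorem Hyp.toSP (hy : Hyp V H x) (hwK : w ∉ KK x) {s c f1 f2 : ℕ} (hc : c < 6) (h1 : f1 < 64)
    (h2 : f2 < 64) (hp1 : pop8 f1 = 3) (hp2 : pop8 f2 = 3) (hp : pop8 (f1 &&& f2) = 1)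
    (hcF : (f1 ||| f2).testBit c = false)
    (tab : ∀ t ∈ triL, s.testBit t = ((t == f1 || t == f2) || (t.testBit c && meets t (f1 ||| f2))))
    (hall : ∀ u ∈ V \ KK x, u ≠ w → ∀ t, hE (gw x w u) H t ↔ s.testBit t = true)
    (hex : ∃ u ∈ V \ KK x, u ≠ w) : IsSPOn V H := by
  have hor : f1 ||| f2 < 64 := Nat.or_lt_two_pow (n := 6) h1 h2
  have hand : f1 &&& f2 < 64 := Nat.and_lt_two_pow (n := 6) _ h2
  have key := hy.star hwK hc hor hcF (fun e => e = Em x f1 ∨ e = Em x f2)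
    (fun t => t == f1 || t == f2)
    (by rintro e (rfl | rfl)
        · exact Em_sub h1
        · exact Em_sub h2)
    (by intro u hg t ht
        have ht := (mem_triL.1 ht).1
        rw [← Em_gw (w := w) (u := u) h1, ← Em_gw (w := w) (u := u) h2]
        simp only [Bool.or_eq_true, beq_iff_eq]
        refine or_congr ⟨fun h => Em_inj hg ht (by omega) h, fun h => by rw [h]⟩
          ⟨fun h => Em_inj hg ht (by omega) h, fun h => by rw [h]⟩)
    tab hall hex
  obtain ⟨u, hu, huw⟩ := hex
  have hg := inj_gw hy.inj hwK (mem_sdiff.1 hu).2 huw.symm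
  have s1 : Em x f1 ⊆ V := (Em_sub h1).trans (KK_sub hy)
  have s2 : Em x f2 ⊆ V := (Em_sub h2).trans (KK_sub hy)
  have c1 : (Em x f1).card = 3 := by rw [← Em_gw (w := w) (u := u) h1, Em_card hg, hp1]
  have c2 : (Em x f2).card = 3 := by rw [← Em_gw (w := w) (u := u) h2, Em_card hg, hp2]
  refine ⟨x c, hy.xV c hc, Em x f1, Em x f2, s1, s2, c1, c2, ?_, ?_, ?_⟩
  · rw [← Em_gw (w := w) (u := u) h1, ← Em_gw (w := w) (u := u) h2, ← Em_and hg, Em_card hg, hp]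
  · rw [← Em_or, ← Em_gw (w := w) (u := u) hor, ← gw_lt (x := x) (w := w) (u := u) hc,
      mem_Em' hg (by omega), hcF]
    simp
  · ext e
    simp only [mem_union, mem_insert, mem_singleton, mem_filter, mem_powersetCard]
    rw [← Em_or]
    constructor
    · intro he
      obtain ⟨a, b⟩ := hy.three e he
      rcases (key e a b).1 he with h | h
      · exact Or.inl h
      · exact Or.inr ⟨⟨a, b⟩, h⟩
    · rintro (h | ⟨⟨a, b⟩, h⟩)
      · refine (key e ?_ ?_).2 (Or.inl h) <;> rcases h with rfl | rfl <;> assumption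
      · exact (key e a b).2 (Or.inr h)

theorem Hyp.toSK (hy : Hyp V H x) (hwK : w ∉ KK x) {s c A : ℕ} (hc : c < 6) (hA : A < 64)
    (hp1 : pop8 A = 4) (hcF : A.testBit c = false)
    (tab : ∀ t ∈ triL, s.testBit t = ((t &&& A == t) || (t.testBit c && meets t A)))
    (hall : ∀ u ∈ V \ KK x, u ≠ w → ∀ t, hE (gw x w u) H t ↔ s.testBit t = true)
    (hex : ∃ u ∈ V \ KK x, u ≠ w) : IsSKOn V H := by
  have key := hy.star hwK hc hA hcF (fun e => e ⊆ Em x A)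
    (fun t => t &&& A == t)
    (by intro e h
        exact h.trans (Em_sub hA))
    (by intro u hg t ht
        have ht := (mem_triL.1 ht).1
        rw [← Em_gw (w := w) (u := u) hA]
        simp only [beq_iff_eq]
        rw [← Finset.inter_eq_left, ← Em_and hg]
        exact ⟨fun h => Em_inj hg (lt_of_le_of_lt Nat.and_le_left ht) ht h, fun h => by rw [h]⟩)
    tab hall hex
  obtain ⟨u, hu, huw⟩ := hex
  have hg := inj_gw hy.inj hwK (mem_sdiff.1 hu).2 huw.symm
  have s1 : Em x A ⊆ V := (Em_sub hA).trans (KK_sub hy)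
  have c1 : (Em x A).card = 4 := by rw [← Em_gw (w := w) (u := u) hA, Em_card hg, hp1]
  refine ⟨x c, hy.xV c hc, Em x A, s1, c1, ?_, ?_⟩
  · rw [← Em_gw (w := w) (u := u) hA, ← gw_lt (x := x) (w := w) (u := u) hc,
      mem_Em' hg (by omega), hcF]
    simp
  · ext e
    simp only [mem_union, mem_filter, mem_powersetCard]
    constructor
    · intro he
      obtain ⟨a, b⟩ := hy.three e he
      rcases (key e a b).1 he with h | h
      · exact Or.inl ⟨h, b⟩
      · exact Or.inr ⟨⟨a, b⟩, h⟩
    · rintro (⟨h, b⟩ | ⟨⟨a, b⟩, h⟩)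
      · exact (key e (h.trans s1) b).2 (Or.inl h)
      · exact (key e a b).2 (Or.inr h)

theorem sol_len : solL.length = 6 := by decide
theorem tab0 : ∀ t ∈ triL, (solL.getD 0 0).testBit t = ((t == 14 || t == 50) || (t.testBit 0 && meets t (14 ||| 50))) := by
  decide +kernel
theorem tab1 : ∀ t ∈ triL, (solL.getD 1 0).testBit t = ((t == 13 || t == 49) || (t.testBit 1 && meets t (13 ||| 49))) := by
  decide +kernel
theorem tab2 : ∀ t ∈ triL, (solL.getD 2 0).testBit t = ((t &&& 51 == t) || (t.testBit 2 && meets t 51)) := by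
  decide +kernel
theorem tab3 : ∀ t ∈ triL, (solL.getD 3 0).testBit t = ((t &&& 15 == t) || (t.testBit 4 && meets t 15)) := by
  decide +kernel
theorem tab4 : ∀ t ∈ triL, (solL.getD 4 0).testBit t = ((t &&& 15 == t) || (t.testBit 5 && meets t 15)) := by
  decide +kernel
theorem tab5 : ∀ t ∈ triL, (solL.getD 5 0).testBit t = ((t &&& 51 == t) || (t.testBit 3 && meets t 51)) := by
  decide +kernel
theorem sol_cases : ∀ s ∈ solL, s = solL.getD 0 0 ∨ s = solL.getD 1 0 ∨ s = solL.getD 2 0 ∨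
    s = solL.getD 3 0 ∨ s = solL.getD 4 0 ∨ s = solL.getD 5 0 := by decide +kernel
theorem sol_five : ∀ s ∈ solL,
    ((range 256).filter (fun t => s.testBit t = true ∧ t.testBit 6 = true)).card = 5 →
    (s = solL.getD 0 0 ∧ s.testBit 69 = true) ∨ (s = solL.getD 1 0 ∧ s.testBit 69 = false) := by
  decide +kernel

theorem Hyp.toSP0 (hy : Hyp V H x) (hwK : w ∉ KK x)
    (hall : ∀ u ∈ V \ KK x, u ≠ w → ∀ t, hE (gw x w u) H t ↔ (solL.getD 0 0).testBit t = true)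
    (hex : ∃ u ∈ V \ KK x, u ≠ w) : IsSPOn V H :=
  hy.toSP hwK (c := 0) (f1 := 14) (f2 := 50) (by norm_num) (by norm_num) (by norm_num)
    (by decide) (by decide) (by decide) (by decide) tab0 hall hex

theorem Hyp.toSP1 (hy : Hyp V H x) (hwK : w ∉ KK x)
    (hall : ∀ u ∈ V \ KK x, u ≠ w → ∀ t, hE (gw x w u) H t ↔ (solL.getD 1 0).testBit t = true)
    (hex : ∃ u ∈ V \ KK x, u ≠ w) : IsSPOn V H :=
  hy.toSP hwK (c := 1) (f1 := 13) (f2 := 49) (by norm_num) (by norm_num) (by norm_num)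
    (by decide) (by decide) (by decide) (by decide) tab1 hall hex

theorem Hyp.toAny (hy : Hyp V H x) (hwK : w ∉ KK x) {s : ℕ} (hs : s ∈ solL)
    (hall : ∀ u ∈ V \ KK x, u ≠ w → ∀ t, hE (gw x w u) H t ↔ s.testBit t = true)
    (hex : ∃ u ∈ V \ KK x, u ≠ w) : IsSPOn V H ∨ IsSKOn V H := by
  rcases sol_cases s hs with rfl | rfl | rfl | rfl | rfl | rfl
  · exact Or.inl (hy.toSP0 hwK hall hex)
  · exact Or.inl (hy.toSP1 hwK hall hex)
  · exact Or.inr (hy.toSK hwK (c := 2) (A := 51) (by norm_num) (by norm_num) (by decide) (by decide)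
      tab2 hall hex)
  · exact Or.inr (hy.toSK hwK (c := 4) (A := 15) (by norm_num) (by norm_num) (by decide) (by decide)
      tab3 hall hex)
  · exact Or.inr (hy.toSK hwK (c := 5) (A := 15) (by norm_num) (by norm_num) (by decide) (by decide)
      tab4 hall hex)
  · exact Or.inr (hy.toSK hwK (c := 3) (A := 51) (by norm_num) (by norm_num) (by decide) (by decide)
      tab5 hall hex)

end main2
theorem star_card {V F : Finset ℕ} {v : ℕ} (hv : v ∈ V) (hF : F ⊆ V) (hvF : v ∉ F) :
    ((V.powersetCard 3).filter (fun t => v ∈ t ∧ (t ∩ F).Nonempty)).card =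
      (V.card - 1).choose 2 - (V.card - 1 - F.card).choose 2 := by
  have himg : (V.powersetCard 3).filter (fun t => v ∈ t ∧ (t ∩ F).Nonempty) =
      ((V.erase v).powersetCard 2 \ ((V.erase v) \ F).powersetCard 2).image (insert v) := by
    ext t
    simp only [mem_filter, mem_image, mem_sdiff, mem_powersetCard]
    constructor
    · rintro ⟨⟨h1, h2⟩, h3, y, h4⟩
      rw [mem_inter] at h4
      have hyv : y ≠ v := by rintro rfl; exact hvF h4.2
      refine ⟨t.erase v, ⟨⟨Finset.erase_subset_erase v h1, ?_⟩, ?_⟩, Finset.insert_erase h3⟩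
      · rw [Finset.card_erase_of_mem h3, h2]
      · rintro ⟨h5, _⟩
        exact (mem_sdiff.1 (h5 (Finset.mem_erase.2 ⟨hyv, h4.1⟩))).2 h4.2
    · rintro ⟨r, ⟨⟨h1, h2⟩, h3⟩, rfl⟩
      have hvr : v ∉ r := fun h => (Finset.mem_erase.1 (h1 h)).1 rfl
      refine ⟨⟨?_, by rw [Finset.card_insert_of_notMem hvr, h2]⟩, Finset.mem_insert_self _ _, ?_⟩
      · exact Finset.insert_subset hv (h1.trans (Finset.erase_subset _ _))
      · by_contra hne
        apply h3
        refine ⟨?_, h2⟩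
        intro y hy
        refine mem_sdiff.2 ⟨h1 hy, fun hyF => hne ⟨y, mem_inter.2 ⟨Finset.mem_insert_of_mem hy, hyF⟩⟩⟩
  rw [himg, card_image_of_injOn, Finset.card_sdiff_of_subset, card_powersetCard, card_powersetCard,
    Finset.card_sdiff_of_subset, Finset.card_erase_of_mem hv]
  · intro y hy
    exact Finset.mem_erase.2 ⟨by rintro rfl; exact hvF hy, hF hy⟩
  · exact Finset.powersetCard_mono sdiff_subset
  · intro r hr r' hr' h
    simp only [coe_sdiff, Set.mem_sdiff, mem_coe, mem_powersetCard] at hr hr'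
    have hvr : v ∉ r := fun h => (Finset.mem_erase.1 (hr.1.1 h)).1 rfl
    have hvr' : v ∉ r' := fun h => (Finset.mem_erase.1 (hr'.1.1 h)).1 rfl
    have h : insert v r = insert v r' := h
    rw [← Finset.erase_insert hvr, h, Finset.erase_insert hvr']

theorem ch2 (a : ℕ) : (a + 1).choose 2 = a + a.choose 2 := by
  rw [Nat.choose_succ_succ' a 1, Nat.choose_one_right]

theorem SP_card {V : Finset ℕ} {H : Finset (Finset ℕ)} (hn : 8 ≤ V.card) (h : IsSPOn V H) :
    H.card = 5 * V.card - 18 := by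
  obtain ⟨v, hv, f1, f2, s1, s2, c1, c2, c12, hvf, rfl⟩ := h
  have hne : f1 ≠ f2 := by rintro rfl; rw [Finset.inter_self] at c12; omega
  have hF : (f1 ∪ f2).card = 5 := by
    have := Finset.card_union_add_card_inter f1 f2
    omega
  rw [Finset.card_union_of_disjoint, star_card hv (union_subset s1 s2) hvf, hF, Finset.card_pair hne]
  · obtain ⟨m, hm⟩ : ∃ m, V.card = m + 8 := ⟨V.card - 8, by omega⟩
    rw [hm, show m + 8 - 1 = m + 2 + 1 + 1 + 1 + 1 + 1 by omega,
      show m + 2 + 1 + 1 + 1 + 1 + 1 - 5 = m + 2 by omega, ch2, ch2, ch2, ch2, ch2]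
    omega
  · rw [Finset.disjoint_left]
    intro t
    simp only [mem_insert, mem_singleton, mem_filter]
    rw [mem_union] at hvf
    push Not at hvf
    rintro (rfl | rfl) ⟨_, h, _⟩
    · exact hvf.1 h
    · exact hvf.2 h

theorem SK_card {V : Finset ℕ} {H : Finset (Finset ℕ)} (hn : V.card = 8) (h : IsSKOn V H) :
    H.card = 22 := by
  obtain ⟨v, hv, A, s1, c1, hvA, rfl⟩ := h
  rw [Finset.card_union_of_disjoint, star_card hv s1 hvA, c1, card_powersetCard, c1, hn]
  · decide
  · rw [Finset.disjoint_left]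
    intro t
    simp only [mem_powersetCard, mem_filter]
    rintro ⟨h1, _⟩ ⟨_, h, _⟩
    exact hvA (h1 h)

section main3
variable {V : Finset ℕ} {H : Finset (Finset ℕ)} {x : ℕ → ℕ}

theorem Hyp.cardKK (hy : Hyp V H x) : (KK x).card = 6 := by
  unfold KK
  rw [card_image_of_injOn, card_range]
  intro i hi j hj h
  exact hy.inj i (by simpa using hi) j (by simpa using hj) h

theorem Hyp.cardW (hy : Hyp V H x) : (V \ KK x).card = V.card - 6 := by
  rw [Finset.card_sdiff_of_subset (KK_sub hy), hy.cardKK]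

theorem Hyp.split (hy : Hyp V H x) {w u : ℕ} (hw : w ∈ V \ KK x) (hu : u ∈ V \ KK x) (huw : u ≠ w) :
    H.card = (kk H x + (dd H w + dd H u)) + ∑ v ∈ ((V \ KK x).erase w).erase u, dd H v := by
  rw [hy.card_eq, ← Finset.add_sum_erase _ _ hw,
    ← Finset.add_sum_erase ((V \ KK x).erase w) _ (Finset.mem_erase.2 ⟨huw, hu⟩)]
  omega

theorem Hyp.exMax (hy : Hyp V H x) (hn : 8 ≤ V.card) :
    ∃ w ∈ V \ KK x, (∃ u ∈ V \ KK x, u ≠ w) ∧ ∀ u ∈ V \ KK x, u ≠ w → dd H u ≤ dd H w ∧ dd H u ≤ 5 ∧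
      kk H x + (dd H w + dd H u) ≤ 22 ∧ dd H w + dd H u ≤ 10 := by
  have hW := hy.cardW
  obtain ⟨w, hw, hmax⟩ := Finset.exists_max_image (V \ KK x) (dd H)
    (Finset.card_pos.1 (by omega))
  refine ⟨w, hw, Finset.exists_mem_ne (by omega) w, ?_⟩
  intro u hu huw
  have h1 := hmax u hu
  rw [mem_sdiff] at hw hu
  have h2 := hy.pair_one hw.2 hu.2 huw.symm hw.1 hu.1
  have h3 := hy.pair_two hw.2 hu.2 huw.symm hw.1 hu.1
  exact ⟨h1, by omega, h3, h2⟩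

theorem cardEE {W : Finset ℕ} {w u : ℕ} (hw : w ∈ W) (hu : u ∈ W) (huw : u ≠ w) :
    ((W.erase w).erase u).card = W.card - 2 := by
  rw [Finset.card_erase_of_mem (Finset.mem_erase.2 ⟨huw, hu⟩), Finset.card_erase_of_mem hw]
  omega

theorem Hyp.upper (hy : Hyp V H x) (hn : 8 ≤ V.card) : H.card ≤ 5 * V.card - 18 := by
  obtain ⟨w, hw, ⟨u, hu, huw⟩, hmax⟩ := hy.exMax hn
  have hW := hy.cardW
  have hc := cardEE hw hu huw
  have hs := hy.split hw hu huw
  have : ∑ v ∈ ((V \ KK x).erase w).erase u, dd H v ≤ (((V \ KK x).erase w).erase u).card • 5 := by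
    apply Finset.sum_le_card_nsmul
    intro v hv
    rw [Finset.mem_erase, Finset.mem_erase] at hv
    exact (hmax v hv.2.2 hv.2.1).2.1
  rw [smul_eq_mul] at this
  have := (hmax u hu huw).2.2.1
  omega

theorem Hyp.tight (hy : Hyp V H x) (hn : 8 ≤ V.card) (heq : H.card = 5 * V.card - 18) :
    ∃ w ∈ V \ KK x, (∃ u ∈ V \ KK x, u ≠ w) ∧ (∀ u ∈ V \ KK x, u ≠ w →
      kk H x + (dd H w + dd H u) = 22) ∧ (9 ≤ V.card → dd H w = 5) := by
  obtain ⟨w, hw, hex, hmax⟩ := hy.exMax hn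
  have hW := hy.cardW
  have main : ∀ u ∈ V \ KK x, u ≠ w → kk H x + (dd H w + dd H u) = 22 ∧
      ∑ v ∈ ((V \ KK x).erase w).erase u, dd H v = (((V \ KK x).erase w).erase u).card * 5 := by
    intro u hu huw
    have hc := cardEE hw hu huw
    have hs := hy.split hw hu huw
    have : ∑ v ∈ ((V \ KK x).erase w).erase u, dd H v ≤ (((V \ KK x).erase w).erase u).card • 5 := by
      apply Finset.sum_le_card_nsmul
      intro v hv
      rw [Finset.mem_erase, Finset.mem_erase] at hv
      exact (hmax v hv.2.2 hv.2.1).2.1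
    rw [smul_eq_mul] at this
    have := (hmax u hu huw).2.2.1
    constructor <;> omega
  refine ⟨w, hw, hex, fun u hu huw => (main u hu huw).1, ?_⟩
  intro h9
  obtain ⟨u, hu, huw⟩ := hex
  have hc := cardEE hw hu huw
  obtain ⟨v, hv⟩ := Finset.card_pos.1 (show 0 < (((V \ KK x).erase w).erase u).card by omega)
  have hsum := (main u hu huw).2
  have h5 : dd H v = 5 := by
    have hall : ∀ y ∈ ((V \ KK x).erase w).erase u, dd H y ≤ 5 := by
      intro y hy'
      rw [Finset.mem_erase, Finset.mem_erase] at hy'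
      exact (hmax y hy'.2.2 hy'.2.1).2.1
    have := (Finset.sum_eq_sum_iff_of_le (g := fun _ => 5) hall).1 (by
      rw [hsum, Finset.sum_const, smul_eq_mul])
    exact this v hv
  rw [Finset.mem_erase, Finset.mem_erase] at hv
  have := hmax v hv.2.2 hv.2.1
  omega

theorem Hyp.eq8 (hy : Hyp V H x) (hn : V.card = 8) (heq : H.card = 5 * V.card - 18) :
    IsSPOn V H ∨ IsSKOn V H := by
  obtain ⟨w, hw, ⟨u, hu, huw⟩, h22, _⟩ := hy.tight (by omega) heq
  have hW := hy.cardW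
  have hw' := mem_sdiff.1 hw
  have hu' := mem_sdiff.1 hu
  obtain ⟨s, hs, hsol⟩ := hy.pair_sol hw'.2 hu'.2 huw.symm hw'.1 hu'.1 (h22 u hu huw)
  refine hy.toAny hw'.2 hs ?_ ⟨u, hu, huw⟩
  intro v hv hvw
  have : v = u := by
    by_contra hvu
    have hc := cardEE hw hu huw
    have h0 : ((V \ KK x).erase w).erase u = ∅ := Finset.card_eq_zero.1 (by omega)
    have : v ∈ ((V \ KK x).erase w).erase u := Finset.mem_erase.2 ⟨hvu, Finset.mem_erase.2 ⟨hvw, hv⟩⟩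
    rw [h0] at this
    simp at this
  rw [this]; exact hsol

theorem Hyp.eq9 (hy : Hyp V H x) (hn : 9 ≤ V.card) (heq : H.card = 5 * V.card - 18) :
    IsSPOn V H := by
  obtain ⟨w, hw, hex, h22, h5⟩ := hy.tight (by omega) heq
  have hw' := mem_sdiff.1 hw
  have h5 := h5 hn
  have h69 : ∀ u, Em (gw x w u) 69 = {x 0, x 2, w} := by
    intro u
    have : (range 8).filter (fun i => Nat.testBit 69 i = true) = {0, 2, 6} := by decide
    unfold Em
    rw [this]
    simp [gw]
  have hT : 69 ∈ triL := by decide +kernel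
  have key : ∀ u ∈ V \ KK x, u ≠ w → ∃ s, ((s = solL.getD 0 0 ∧ s.testBit 69 = true) ∨
      (s = solL.getD 1 0 ∧ s.testBit 69 = false)) ∧ ∀ t, hE (gw x w u) H t ↔ s.testBit t = true := by
    intro u hu huw
    have hu' := mem_sdiff.1 hu
    obtain ⟨s, hs, hsol⟩ := hy.pair_sol hw'.2 hu'.2 huw.symm hw'.1 hu'.1 (h22 u hu huw)
    refine ⟨s, sol_five s hs ?_, hsol⟩
    rw [← cntP_sol hsol (fun t => t.testBit 6), ← hy.dd_w hw'.2 hu'.2 huw.symm, h5]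
  by_cases hc : ({x 0, x 2, w} : Finset ℕ) ∈ H
  · refine hy.toSP0 hw'.2 ?_ hex
    intro u hu huw
    obtain ⟨s, h1 | h1, hsol⟩ := key u hu huw
    · rw [← h1.1]; exact hsol
    · have := (hsol 69).1 ⟨hT, by rw [h69]; exact hc⟩
      rw [h1.2] at this
      cases this
  · refine hy.toSP1 hw'.2 ?_ hex
    intro u hu huw
    obtain ⟨s, h1 | h1, hsol⟩ := key u hu huw
    · have := ((hsol 69).2 h1.2).2
      rw [h69] at this
      exact absurd this hc
    · rw [← h1.1]; exact hsol

end main3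

theorem mkHyp {V : Finset ℕ} {H : Finset (Finset ℕ)}
    (hH : ThreeGraphOn V H) (hconn : ConnectedHG V H) (hfree : P4Free H)
    (hM3 : ¬HasM3 H) (hC4 : HasC4 H) : ∃ x, Hyp V H x := by
  obtain ⟨x1, x2, y1, y2, z1, z2, h6, e1, e2, e3, e4⟩ := hC4
  let x : ℕ → ℕ := fun i => [x1, x2, y1, y2, z1, z2].getD i 0
  have hx : (range 6).image x = {x1, x2, y1, y2, z1, z2} := by
    have : range 6 = {0, 1, 2, 3, 4, 5} := by decide
    rw [this]
    simp [x]
  have hinj : Set.InjOn x (range 6 : Finset ℕ) := by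
    rw [← Finset.card_image_iff, hx, h6, card_range]
  refine ⟨x, hH, hconn, hfree, hM3, ?_, ?_, ?_⟩
  · intro i hi j hj h
    exact hinj (by simpa using hi) (by simpa using hj) h
  · intro i hi
    have m1 := (hH _ e1).1
    have m2 := (hH _ e2).1
    have m3 := (hH _ e3).1
    interval_cases i
    · exact m1 (by simp [x])
    · exact m2 (by simp [x])
    · exact m1 (by simp [x])
    · exact m1 (by simp [x])
    · exact m3 (by simp [x])
    · exact m3 (by simp [x])
  · intro t ht
    have a1 : (range 8).filter (fun i => Nat.testBit 13 i = true) = {0, 2, 3} := by decide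
    have a2 : (range 8).filter (fun i => Nat.testBit 14 i = true) = {2, 3, 1} := by decide
    have a3 : (range 8).filter (fun i => Nat.testBit 50 i = true) = {1, 4, 5} := by decide
    have a4 : (range 8).filter (fun i => Nat.testBit 49 i = true) = {4, 5, 0} := by decide
    simp only [c4L, List.mem_cons, List.not_mem_nil, or_false] at ht
    unfold Em
    rcases ht with rfl | rfl | rfl | rfl
    · rw [a1]; simpa [x] using e1
    · rw [a2]; simpa [x] using e2
    · rw [a3]; simpa [x] using e3
    · rw [a4]; simpa [x] using e4

/-- Lemma 3.4: a connected `𝒫₄`-free 3-graph on `n ≥ 8` vertices with no three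
pairwise disjoint edges and containing a minimal 4-cycle has at most `5n - 18`
edges; for `n ≥ 9` equality holds iff `H ≅ SPₙ`, and for `n = 8` equality
holds iff `H ≅ SP₈` or `H ≅ SK₈`. -/
theorem lemma_c41 (n : ℕ) (hn : 8 ≤ n)
    (V : Finset ℕ) (H : Finset (Finset ℕ)) (hV : V.card = n)
    (hH : ThreeGraphOn V H) (hconn : ConnectedHG V H) (hfree : P4Free H)
    (hM3 : ¬HasM3 H) (hC4 : HasC4 H) :
    H.card ≤ 5 * n - 18 ∧
      (9 ≤ n → (H.card = 5 * n - 18 ↔ IsSPOn V H)) ∧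
      (n = 8 → (H.card = 5 * n - 18 ↔ (IsSPOn V H ∨ IsSKOn V H))) := by
  obtain ⟨x, hy⟩ := mkHyp hH hconn hfree hM3 hC4
  subst hV
  refine ⟨hy.upper hn, fun h9 => ⟨hy.eq9 h9, SP_card hn⟩, fun h8 => ⟨hy.eq8 h8, ?_⟩⟩
  rintro (h | h)
  · exact SP_card hn h
  · rw [SK_card h8 h, h8]
end
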